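/- Mean square asymptotics in the circle problem (Nowak, 2004): with C = (1/(3π²)) Σ_{n=1}^∞ r(n)² n^{−3/2}, one has ∫_0^X P(x)² dx = C·X^{3/2} + O( X (log X)^{3/2} log log X ) as X → ∞. -/

import Mathlib

open Real Filter Asymptotics

/-- `r n` is the number of representations of `n` as a sum of two squares of integers. -/
noncomputable def rTwoSquares (n : ℕ) : ℕ :=
  {p : ℤ × ℤ | p.1 ^ 2 + p.2 ^ 2 = (n : ℤ)}.ncard

/-- The number of integer lattice points in the closed origin-centered disc of radius `√x`. -/
noncomputable def latticeA (x : ℝ) : ℕ :=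
  {p : ℤ × ℤ | (p.1 : ℝ) ^ 2 + (p.2 : ℝ) ^ 2 ≤ x}.ncard

/-- The lattice point discrepancy of the circle. -/
noncomputable def latticeP (x : ℝ) : ℝ := (latticeA x : ℝ) - Real.pi * x

/-- Integers of absolute value at most `W` in a fixed residue class modulo `q`. -/
lemma card_filter_modEq_Icc_le {W q : ℤ} (hq : 0 < q) (v : ℤ) :
    (((Finset.Icc (-W) W).filter (fun x => x ≡ v [ZMOD q])).card : ℝ) ≤
      max ((2 * (W : ℝ) + 1) / q + 1) 0 := by
  have h1 : Finset.Icc (-W) W = Finset.Ioc (-W - 1) W := by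
    ext x; simp only [Finset.mem_Icc, Finset.mem_Ioc]; omega
  rw [h1]
  have h2 := Int.Ioc_filter_modEq_card (-W - 1) W hq v
  have h3 : ((((Finset.Ioc (-W - 1) W).filter (fun x => x ≡ v [ZMOD q])).card : ℤ) : ℝ) =
      ((max (⌊((W : ℚ) - v) / q⌋ - ⌊(((-W - 1 : ℤ) : ℚ) - v) / q⌋) 0 : ℤ) : ℝ) := by
    rw [h2]
  rw [Int.cast_natCast] at h3
  rw [h3, Int.cast_max, Int.cast_zero]
  apply max_le_max _ le_rfl
  have hq' : (0 : ℚ) < q := by exact_mod_cast hq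
  have h4 : (⌊((W : ℚ) - v) / q⌋ : ℚ) ≤ ((W : ℚ) - v) / q := Int.floor_le _
  have h5 : (((-W - 1 : ℤ) : ℚ) - v) / q - 1 < (⌊(((-W - 1 : ℤ) : ℚ) - v) / q⌋ : ℚ) :=
    Int.sub_one_lt_floor _
  have h6 : ((⌊((W : ℚ) - v) / q⌋ - ⌊(((-W - 1 : ℤ) : ℚ) - v) / q⌋ : ℤ) : ℚ) ≤
      (2 * W + 1) / q + 1 := by
    have : ((W : ℚ) - v) / q - (((-W - 1 : ℤ) : ℚ) - v) / q = (2 * W + 1) / q := by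
      field_simp; push_cast; ring
    push_cast at *
    linarith
  have h7 := (Rat.cast_le (K := ℝ)).mpr h6
  push_cast at h7 ⊢
  exact h7

/-- Multiples of `g` in `[-W, W]`. -/
lemma card_filter_dvd_Icc_le {W g : ℤ} (hg : 0 < g) (hgW : g ≤ W) :
    (((Finset.Icc (-W) W).filter (fun x => g ∣ x)).card : ℝ) ≤ 4 * W / g := by
  have h := card_filter_modEq_Icc_le (W := W) hg 0
  simp only [Int.modEq_zero_iff_dvd] at h
  have hg' : (0 : ℝ) < g := by exact_mod_cast hg
  have hgW' : (g : ℝ) ≤ W := by exact_mod_cast hgW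
  have hg1 : (1 : ℝ) ≤ g := by exact_mod_cast hg
  refine h.trans (max_le ?_ (by have := hg'.trans_le hgW'; positivity))
  rw [div_add_one hg'.ne', div_le_div_iff_of_pos_right hg']
  linarith

/-- For fixed `u` and `w ≠ 0`, the number of solutions of `u v + w z = h` in a box. -/
lemma card_linear_solutions_le {Z u w : ℤ} (h : ℤ) (hw : w ≠ 0) (hwZ : |w| ≤ Z) :
    (((Finset.Icc (-Z) Z ×ˢ Finset.Icc (-Z) Z).filter
      (fun p : ℤ × ℤ => u * p.1 + w * p.2 = h)).card : ℝ) ≤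
      if (Int.gcd u w : ℤ) ∣ h then 4 * Z * (Int.gcd u w : ℝ) / |(w : ℝ)| else 0 := by
  set g := Int.gcd u w with hg
  set A := (Finset.Icc (-Z) Z ×ˢ Finset.Icc (-Z) Z).filter
      (fun p : ℤ × ℤ => u * p.1 + w * p.2 = h) with hA
  have hgpos : 0 < g := Int.gcd_pos_of_ne_zero_right _ hw
  have hgu : (g : ℤ) ∣ u := Int.gcd_dvd_left ..
  have hgw : (g : ℤ) ∣ w := Int.gcd_dvd_right ..
  have hw0 : 0 < |w| := abs_pos.mpr hw
  split_ifs with hd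
  · rcases A.eq_empty_or_nonempty with he | ⟨p0, hp0⟩
    · rw [he]; simp; have : (0:ℝ) < Z := by exact_mod_cast hw0.trans_le hwZ
      positivity
    · obtain ⟨q, hq⟩ : (g : ℤ) ∣ |w| := (dvd_abs _ _).mpr hgw
      have hgz : (0 : ℤ) < g := by exact_mod_cast hgpos
      have hqpos : 0 < q := by
        rw [hq] at hw0; exact pos_of_mul_pos_right hw0 hgz.le
      have hcard : A.card ≤ ((Finset.Icc (-Z) Z).filter (fun x => x ≡ p0.1 [ZMOD q])).card := by
        apply Finset.card_le_card_of_injOn (fun p => p.1)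
        · intro p hp
          simp only [hA, Finset.coe_filter, Finset.mem_product, Set.mem_ofPred_eq,
            Finset.mem_filter] at hp hp0 ⊢
          refine ⟨hp.1.1, ?_⟩
          have h1 : u * (p0.1 - p.1) = w * (p.2 - p0.2) := by linarith [hp.2, hp0.2]
          rw [Int.modEq_iff_dvd]
          obtain ⟨u', hu'⟩ := hgu
          have hcop : IsCoprime q u' := by
            have h2 : Int.gcd u |w| = g := by rw [hg, Int.gcd_def, Int.gcd_def, Int.natAbs_abs]
            rw [hu', hq, Int.gcd_mul_left] at h2
            have h3 : Int.gcd u' q = 1 := by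
              have h4 : (g : ℤ).natAbs = g := Int.natAbs_natCast g
              rw [h4] at h2
              exact Nat.eq_of_mul_eq_mul_left hgpos (by rw [h2, mul_one])
            exact (Int.isCoprime_iff_gcd_eq_one.mpr h3).symm
          have h5 : (g : ℤ) * q ∣ g * (u' * (p0.1 - p.1)) := by
            rw [← hq, ← mul_assoc, ← hu', h1]
            exact ((abs_dvd _ _).mpr dvd_rfl).mul_right _
          have h6 : q ∣ u' * (p0.1 - p.1) := Int.dvd_of_mul_dvd_mul_left hgz.ne' h5
          exact hcop.dvd_of_dvd_mul_left h6
        · intro p hp p' hp' hpp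
          simp only [hA, Finset.coe_filter, Set.mem_ofPred_eq] at hp hp' hpp
          have h1 : w * p.2 = w * p'.2 := by
            have := hp.2; have := hp'.2; rw [hpp] at *; linarith
          exact Prod.ext hpp (mul_left_cancel₀ hw h1)
      have h2 := card_filter_modEq_Icc_le (W := Z) hqpos p0.1
      have hqR : (0 : ℝ) < q := by exact_mod_cast hqpos
      have hq1 : (1 : ℝ) ≤ q := by exact_mod_cast hqpos
      have hgR : (0 : ℝ) < g := by exact_mod_cast hgpos
      have hqw : |(w : ℝ)| = g * q := by exact_mod_cast hq
      have hqZ : (q : ℝ) ≤ Z := by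
        have : q ≤ Z := by nlinarith
        exact_mod_cast this
      have h3 : 4 * Z * (g : ℝ) / |(w : ℝ)| = 4 * Z / q := by
        rw [hqw]; field_simp
      rw [h3]
      refine (Nat.cast_le.mpr hcard).trans
        (h2.trans (max_le ?_ (by have := hqR.trans_le hqZ; positivity)))
      rw [div_add_one hqR.ne', div_le_div_iff_of_pos_right hqR]
      linarith
  · have : A = ∅ := by
      apply Finset.filter_eq_empty_iff.mpr
      intro p _ hp
      exact hd (hp ▸ dvd_add (hgu.mul_right _) (hgw.mul_right _))
    rw [this]; simp

/-- The restricted sum `∑ 1 / g` over divisors `g ≤ Z` of `h`. -/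
noncomputable def recipDivisorSum (Z h : ℕ) : ℝ :=
  ∑ g ∈ (Finset.Icc 1 Z).filter (fun g => g ∣ h), (1 : ℝ) / g

lemma sum_gcd_weight_le (Z h : ℕ) :
    ∑ w ∈ (Finset.Icc (-(Z : ℤ)) Z).filter (fun w => w ≠ 0), ∑ u ∈ Finset.Icc (-|w|) |w|,
      (if (Int.gcd u w : ℤ) ∣ (h : ℤ) then 4 * (Z : ℝ) * (Int.gcd u w : ℝ) / |(w : ℝ)| else 0) ≤
      64 * (Z : ℝ) ^ 2 * recipDivisorSum Z h := by
  set D := (Finset.Icc 1 Z).filter (fun g => g ∣ h) with hD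
  set S := (Finset.Icc (-(Z : ℤ)) Z).filter (fun w => w ≠ 0) with hS
  have hstep : ∀ w ∈ S, ∀ u ∈ Finset.Icc (-|w|) |w|,
      (if (Int.gcd u w : ℤ) ∣ (h : ℤ) then 4 * (Z : ℝ) * (Int.gcd u w : ℝ) / |(w : ℝ)| else 0) ≤
      ∑ g ∈ D, if (g : ℤ) ∣ w then (if (g : ℤ) ∣ u then 4 * (Z : ℝ) * g / |(w : ℝ)| else 0)
        else 0 := by
    intro w hw u hu
    have hnn : ∀ g ∈ D, (0 : ℝ) ≤ if (g : ℤ) ∣ w then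
        (if (g : ℤ) ∣ u then 4 * (Z : ℝ) * g / |(w : ℝ)| else 0) else 0 := by
      intro g _; split_ifs <;> positivity
    split_ifs with hd
    · simp only [hS, Finset.mem_filter, Finset.mem_Icc] at hw
      have hgp : 0 < Int.gcd u w := Int.gcd_pos_of_ne_zero_right _ hw.2
      have hgw : (Int.gcd u w : ℤ) ∣ w := Int.gcd_dvd_right ..
      have hgu : (Int.gcd u w : ℤ) ∣ u := Int.gcd_dvd_left ..
      have hle : Int.gcd u w ≤ Z := by
        have h1 := Int.le_of_dvd (abs_pos.mpr hw.2) ((dvd_abs _ _).mpr hgw)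
        have h2 : |w| ≤ Z := abs_le.mpr hw.1
        exact_mod_cast h1.trans h2
      have hmem : Int.gcd u w ∈ D := by
        simp only [hD, Finset.mem_filter, Finset.mem_Icc]
        exact ⟨⟨hgp, hle⟩, by exact_mod_cast hd⟩
      have := Finset.single_le_sum hnn hmem
      rwa [if_pos hgw, if_pos hgu] at this
    · exact Finset.sum_nonneg hnn
  calc _ ≤ ∑ w ∈ S, ∑ u ∈ Finset.Icc (-|w|) |w|, ∑ g ∈ D, (if (g : ℤ) ∣ w then
        (if (g : ℤ) ∣ u then 4 * (Z : ℝ) * g / |(w : ℝ)| else 0) else 0) :=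
        Finset.sum_le_sum fun w hw => Finset.sum_le_sum fun u hu => hstep w hw u hu
    _ = ∑ g ∈ D, ∑ w ∈ S, ∑ u ∈ Finset.Icc (-|w|) |w|, (if (g : ℤ) ∣ w then
        (if (g : ℤ) ∣ u then 4 * (Z : ℝ) * g / |(w : ℝ)| else 0) else 0) := by
        rw [Finset.sum_comm]
        rw [Finset.sum_congr rfl fun w _ => Finset.sum_comm, Finset.sum_comm]
    _ ≤ ∑ g ∈ D, ∑ w ∈ S, if (g : ℤ) ∣ w then 16 * (Z : ℝ) else 0 := by
        refine Finset.sum_le_sum fun g hg => Finset.sum_le_sum fun w hw => ?_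
        simp only [hS, hD, Finset.mem_filter, Finset.mem_Icc] at hw hg
        by_cases hgw : (g : ℤ) ∣ w
        · simp only [if_pos hgw]
          rw [← Finset.sum_filter, Finset.sum_const, nsmul_eq_mul]
          have hg0 : (0 : ℤ) < g := by exact_mod_cast hg.1.1
          have hw0 := abs_pos.mpr hw.2
          have h1 := card_filter_dvd_Icc_le hg0
            (Int.le_of_dvd hw0 ((dvd_abs _ _).mpr hgw))
          have hg0' : (0 : ℝ) < g := by exact_mod_cast hg0
          have hw0' : (0 : ℝ) < |(w : ℝ)| := by exact_mod_cast hw0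
          push_cast at h1
          calc _ ≤ 4 * |(w : ℝ)| / g * (4 * Z * g / |(w : ℝ)|) := by gcongr
            _ = 16 * Z := by field_simp; ring
        · simp [hgw]
    _ ≤ ∑ g ∈ D, 64 * (Z : ℝ) ^ 2 * (1 / g) := by
        refine Finset.sum_le_sum fun g hg => ?_
        simp only [hD, Finset.mem_filter, Finset.mem_Icc] at hg
        rw [← Finset.sum_filter, Finset.sum_const, nsmul_eq_mul]
        have hg0 : (0 : ℤ) < g := by exact_mod_cast hg.1.1
        have h1 := card_filter_dvd_Icc_le (W := Z) hg0 (by exact_mod_cast hg.1.2)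
        have h2 : (S.filter (fun w => (g : ℤ) ∣ w)).card ≤
            ((Finset.Icc (-(Z : ℤ)) Z).filter (fun x => (g : ℤ) ∣ x)).card := by
          apply Finset.card_le_card
          rw [hS, Finset.filter_filter]
          intro x hx
          simp only [Finset.mem_filter] at hx ⊢
          exact ⟨hx.1, hx.2.2⟩
        have hg0' : (0 : ℝ) < g := by exact_mod_cast hg0
        have h3 := (Nat.cast_le (α := ℝ).mpr h2).trans h1
        push_cast at h3
        calc _ ≤ 4 * (Z : ℝ) / g * (16 * Z) := by gcongr
          _ = _ := by ring
    _ = _ := by rw [← Finset.mul_sum]; rfl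

/-- Solutions of `u v + w z = h` in the box `[-Z, Z]⁴` with `(u, w) ≠ (0, 0)`. -/
lemma card_bilinear_solutions_le (Z h : ℕ) :
    ((((Finset.Icc (-(Z : ℤ)) Z ×ˢ Finset.Icc (-(Z : ℤ)) Z) ×ˢ
      (Finset.Icc (-(Z : ℤ)) Z ×ˢ Finset.Icc (-(Z : ℤ)) Z)).filter
      (fun p : (ℤ × ℤ) × (ℤ × ℤ) => p.1 ≠ 0 ∧
        p.1.1 * p.2.1 + p.1.2 * p.2.2 = (h : ℤ))).card : ℝ) ≤
      128 * (Z : ℝ) ^ 2 * recipDivisorSum Z h := by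
  set B := Finset.Icc (-(Z : ℤ)) Z with hB
  set S := B.filter (fun w => w ≠ 0) with hS
  set c : ℤ → ℤ → ℕ := fun u w => ((B ×ˢ B).filter
      (fun p : ℤ × ℤ => u * p.1 + w * p.2 = h)).card with hc
  have hsymm : ∀ u w, c u w = c w u := by
    intro u w
    apply Finset.card_bij (fun p _ => p.swap)
    · intro p hp
      simp only [Finset.mem_filter, Finset.mem_product, Prod.fst_swap, Prod.snd_swap] at hp ⊢
      exact ⟨hp.1.symm, by linarith [hp.2]⟩
    · intro p _ q _ h; exact Prod.swap_injective h
    · intro p hp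
      refine ⟨p.swap, ?_, Prod.swap_swap p⟩
      simp only [Finset.mem_filter, Finset.mem_product, Prod.fst_swap, Prod.snd_swap] at hp ⊢
      exact ⟨hp.1.symm, by linarith [hp.2]⟩
  have hhalf : ∑ w ∈ S, ∑ u ∈ Finset.Icc (-|w|) |w|, (c u w : ℝ) ≤
      64 * (Z : ℝ) ^ 2 * recipDivisorSum Z h := by
    refine le_trans (Finset.sum_le_sum fun w hw => Finset.sum_le_sum fun u hu => ?_)
      (sum_gcd_weight_le Z h)
    simp only [hS, hB, Finset.mem_filter, Finset.mem_Icc] at hw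
    have := card_linear_solutions_le (Z := Z) (u := u) (h : ℤ) hw.2 (abs_le.mpr hw.1)
    push_cast at this
    exact this
  have hcard : (((B ×ˢ B) ×ˢ (B ×ˢ B)).filter
      (fun p : (ℤ × ℤ) × (ℤ × ℤ) => p.1 ≠ 0 ∧
        p.1.1 * p.2.1 + p.1.2 * p.2.2 = (h : ℤ))).card =
      ∑ q ∈ (B ×ˢ B).filter (fun q => q ≠ 0), c q.1 q.2 := by
    rw [Finset.card_filter, Finset.sum_product, Finset.sum_filter]
    refine Finset.sum_congr rfl fun q _ => ?_
    by_cases hq : q = 0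
    · simp [hq]
    · simp only [ne_eq, hq, not_false_eq_true, true_and, if_true, hc, Finset.card_filter]
  have hsub : (∑ q ∈ (B ×ˢ B).filter (fun q => q ≠ 0), (c q.1 q.2 : ℝ)) ≤
      ∑ w ∈ S, ∑ u ∈ Finset.Icc (-|w|) |w|, (c u w : ℝ) +
      ∑ w ∈ S, ∑ u ∈ Finset.Icc (-|w|) |w|, (c u w : ℝ) := by
    rw [Finset.sum_sigma' S]
    have h1 : ∑ x ∈ S.sigma (fun w => Finset.Icc (-|w|) |w|), (c x.2 x.1 : ℝ) =
        ∑ q ∈ (B ×ˢ B).filter (fun q => q.2 ≠ 0 ∧ |q.1| ≤ |q.2|), (c q.1 q.2 : ℝ) := by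
      refine Finset.sum_bij' (fun x _ => (x.2, x.1)) (fun q _ => ⟨q.2, q.1⟩) ?_ ?_ ?_ ?_ ?_
      · intro x hx
        simp only [hS, hB, Finset.mem_sigma, Finset.mem_filter, Finset.mem_Icc,
          Finset.mem_product] at hx ⊢
        have := abs_le.mpr hx.1.1
        have h3 := abs_le.mpr hx.2
        exact ⟨⟨abs_le.mp (h3.trans this), hx.1.1⟩, hx.1.2, h3⟩
      · intro q hq
        simp only [hS, hB, Finset.mem_sigma, Finset.mem_filter, Finset.mem_Icc,
          Finset.mem_product] at hq ⊢
        exact ⟨⟨hq.1.2, hq.2.1⟩, abs_le.mp hq.2.2⟩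
      all_goals simp
    have h2 : ∑ x ∈ S.sigma (fun w => Finset.Icc (-|w|) |w|), (c x.2 x.1 : ℝ) =
        ∑ q ∈ (B ×ˢ B).filter (fun q => q.1 ≠ 0 ∧ |q.2| ≤ |q.1|), (c q.1 q.2 : ℝ) := by
      refine Finset.sum_bij' (fun x _ => (x.1, x.2)) (fun q _ => ⟨q.1, q.2⟩) ?_ ?_ ?_ ?_ ?_
      · intro x hx
        simp only [hS, hB, Finset.mem_sigma, Finset.mem_filter, Finset.mem_Icc,
          Finset.mem_product] at hx ⊢
        have := abs_le.mpr hx.1.1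
        have h3 := abs_le.mpr hx.2
        exact ⟨⟨hx.1.1, abs_le.mp (h3.trans this)⟩, hx.1.2, h3⟩
      · intro q hq
        simp only [hS, hB, Finset.mem_sigma, Finset.mem_filter, Finset.mem_Icc,
          Finset.mem_product] at hq ⊢
        exact ⟨⟨hq.1.1, hq.2.1⟩, abs_le.mp hq.2.2⟩
      · simp
      · simp
      · intro x hx; simp only; rw [hsymm]
    nth_rewrite 1 [h1]
    rw [h2, ← Finset.sum_union_inter]
    refine le_trans (Finset.sum_le_sum_of_subset_of_nonneg ?_ fun _ _ _ => by positivity)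
      (le_add_of_nonneg_right (Finset.sum_nonneg fun _ _ => by positivity))
    intro q hq
    simp only [Finset.mem_filter, Finset.mem_union] at hq ⊢
    have hq2 : q.1 ≠ 0 ∨ q.2 ≠ 0 := by
      by_contra! hcon
      exact hq.2 (Prod.ext hcon.1 hcon.2)
    rcases le_total |q.1| |q.2| with hle | hle
    · left
      refine ⟨hq.1, ?_, hle⟩
      rcases hq2 with h | h
      · exact abs_pos.mp ((abs_pos.mpr h).trans_le hle)
      · exact h
    · right
      refine ⟨hq.1, ?_, hle⟩
      rcases hq2 with h | h
      · exact h
      · exact abs_pos.mp ((abs_pos.mpr h).trans_le hle)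
  rw [hcard]
  push_cast
  linarith

/-- The integer points of the square `[-W, W]²`. -/
noncomputable def squareBox (W : ℕ) : Finset (ℤ × ℤ) :=
  Finset.Icc (-(W : ℤ)) W ×ˢ Finset.Icc (-(W : ℤ)) W

lemma mem_squareBox_of_sq_add_sq_le {W : ℕ} {p : ℤ × ℤ} (h : p.1 ^ 2 + p.2 ^ 2 ≤ (W : ℤ) ^ 2) :
    p ∈ squareBox W := by
  have h1 : |p.1| ≤ W := abs_le_of_sq_le_sq (by nlinarith [sq_nonneg p.2]) (by positivity)
  have h2 : |p.2| ≤ W := abs_le_of_sq_le_sq (by nlinarith [sq_nonneg p.1]) (by positivity)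
  simp only [squareBox, Finset.mem_product, Finset.mem_Icc]
  exact ⟨abs_le.mp h1, abs_le.mp h2⟩

lemma rTwoSquares_eq_card {n W : ℕ} (h : n ≤ W ^ 2) :
    rTwoSquares n = ((squareBox W).filter (fun p => p.1 ^ 2 + p.2 ^ 2 = (n : ℤ))).card := by
  rw [rTwoSquares, ← Set.ncard_coe_finset]
  congr 1
  ext p
  simp only [Set.mem_ofPred_eq, Finset.coe_filter]
  refine ⟨fun hp => ⟨mem_squareBox_of_sq_add_sq_le (hp.trans_le (by exact_mod_cast h)), hp⟩,
    fun hp => hp.2⟩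

lemma card_squareBox (W : ℕ) : (squareBox W).card = (2 * W + 1) ^ 2 := by
  simp only [squareBox, Finset.card_product, Int.card_Icc]
  have : ((W : ℤ) + 1 - -W).toNat = 2 * W + 1 := by omega
  rw [this]; ring

lemma sum_rTwoSquares_range_le (Y : ℕ) :
    ∑ n ∈ Finset.range (Y ^ 2 + 1), rTwoSquares n ≤ (2 * Y + 1) ^ 2 := by
  rw [← card_squareBox Y]
  calc _ = ∑ n ∈ Finset.range (Y ^ 2 + 1),
        ((squareBox Y).filter (fun p => p.1 ^ 2 + p.2 ^ 2 = (n : ℤ))).card :=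
        Finset.sum_congr rfl fun n hn => rTwoSquares_eq_card (by simp at hn; omega)
    _ = ∑ n ∈ Finset.range (Y ^ 2 + 1),
        ((squareBox Y).filter (fun p => (p.1 ^ 2 + p.2 ^ 2).toNat = n)).card := by
        refine Finset.sum_congr rfl fun n _ =>
          congrArg Finset.card (Finset.filter_congr fun p _ => ?_)
        have : 0 ≤ p.1 ^ 2 + p.2 ^ 2 := by positivity
        omega
    _ ≤ _ := by
        rw [← Finset.card_biUnion]
        · exact Finset.card_le_card (Finset.biUnion_subset.mpr fun n _ => Finset.filter_subset _ _)
        · intro a _ b _ hab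
          refine Finset.disjoint_filter.mpr fun p _ h1 h2 => hab (h1.symm.trans h2)

lemma rTwoSquares_correlation_le_card {Y h : ℕ} (hh : h ≤ Y ^ 2) :
    ∑ m ∈ Finset.range (Y ^ 2 + 1), rTwoSquares m * rTwoSquares (m + h) ≤
      ((squareBox (3 * Y) ×ˢ squareBox (3 * Y)).filter (fun p : (ℤ × ℤ) × (ℤ × ℤ) =>
        p.1.1 * p.2.1 + p.1.2 * p.2.2 = (h : ℤ))).card := by
  calc _ = ∑ m ∈ Finset.range (Y ^ 2 + 1), ((squareBox Y ×ˢ squareBox (2 * Y)).filter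
        (fun p => (p.1.1 ^ 2 + p.1.2 ^ 2 = (m : ℤ)) ∧
          (p.2.1 ^ 2 + p.2.2 ^ 2 = ((m + h : ℕ) : ℤ)))).card := by
        refine Finset.sum_congr rfl fun m hm => ?_
        have hm' : m ≤ Y ^ 2 := by simp at hm; omega
        rw [rTwoSquares_eq_card hm', rTwoSquares_eq_card (W := 2 * Y) (n := m + h)
          (by nlinarith), ← Finset.card_product]
        congr 1
        ext p
        simp only [Finset.mem_product, Finset.mem_filter]
        tauto
    _ = ((Finset.range (Y ^ 2 + 1)).sigma fun m => ((squareBox Y ×ˢ squareBox (2 * Y)).filter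
        (fun p => (p.1.1 ^ 2 + p.1.2 ^ 2 = (m : ℤ)) ∧
          (p.2.1 ^ 2 + p.2.2 ^ 2 = ((m + h : ℕ) : ℤ))))).card := (Finset.card_sigma _ _).symm
    _ ≤ _ := by
        apply Finset.card_le_card_of_injOn
          (fun x => ((x.2.2.1 - x.2.1.1, x.2.2.2 - x.2.1.2),
            (x.2.2.1 + x.2.1.1, x.2.2.2 + x.2.1.2)))
        · rintro ⟨m, ⟨a, b⟩, ⟨c, d⟩⟩ hx
          simp only [squareBox, Finset.coe_sigma, Set.mem_sigma_iff, Finset.mem_coe,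
            Finset.mem_filter, Finset.mem_product, Finset.mem_Icc] at hx ⊢
          push_cast at hx ⊢
          obtain ⟨-, hx, h1, h2⟩ := hx
          refine ⟨⟨⟨⟨?_, ?_⟩, ?_, ?_⟩, ⟨?_, ?_⟩, ?_, ?_⟩, ?_⟩
          iterate 8 omega
          linarith
        · rintro ⟨m, ⟨a, b⟩, ⟨c, d⟩⟩ hx ⟨m', ⟨a', b'⟩, ⟨c', d'⟩⟩ hx' heq
          simp only [Finset.coe_sigma, Set.mem_sigma_iff, Finset.mem_coe,
            Finset.mem_filter] at hx hx'
          simp only [Prod.mk.injEq] at heq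
          have ha : a = a' := by omega
          have hb : b = b' := by omega
          have hc : c = c' := by omega
          have hd : d = d' := by omega
          subst ha hb hc hd
          have : m = m' := by
            have := hx.2.2.1.symm.trans hx'.2.2.1
            exact_mod_cast this
          subst this
          rfl

lemma rTwoSquares_correlation_le {Y h : ℕ} (hh : h ≤ Y ^ 2) (h0 : h ≠ 0) :
    ∑ m ∈ Finset.range (Y ^ 2 + 1), (rTwoSquares m : ℝ) * rTwoSquares (m + h) ≤
      1152 * (Y : ℝ) ^ 2 * recipDivisorSum (3 * Y) h := by
  have h1 := rTwoSquares_correlation_le_card hh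
  have h2 := card_bilinear_solutions_le (3 * Y) h
  have h3 : ((squareBox (3 * Y) ×ˢ squareBox (3 * Y)).filter (fun p : (ℤ × ℤ) × (ℤ × ℤ) =>
        p.1.1 * p.2.1 + p.1.2 * p.2.2 = (h : ℤ))) =
      ((squareBox (3 * Y) ×ˢ squareBox (3 * Y)).filter (fun p : (ℤ × ℤ) × (ℤ × ℤ) =>
        p.1 ≠ 0 ∧ p.1.1 * p.2.1 + p.1.2 * p.2.2 = (h : ℤ))) := by
    refine Finset.filter_congr fun p _ => ⟨fun hp => ⟨fun hp0 => h0 ?_, hp⟩, fun hp => hp.2⟩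
    rw [hp0] at hp; simpa using hp.symm
  rw [h3] at h1
  have h4 := (Nat.cast_le (α := ℝ)).mpr h1
  push_cast at h4 h2
  refine h4.trans (h2.trans (le_of_eq (by ring)))

lemma sum_rTwoSquares_sq_le {Y : ℕ} (hY : 1 ≤ Y) :
    ∑ m ∈ Finset.range (Y ^ 2 + 1), (rTwoSquares m : ℝ) ^ 2 ≤
      (Y : ℝ) ^ 2 * (1152 * recipDivisorSum (3 * Y) 0 + 49) := by
  have h1 := rTwoSquares_correlation_le_card (Y := Y) (h := 0) (by positivity)
  have h2 := card_bilinear_solutions_le (3 * Y) 0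
  have h3 : ((squareBox (3 * Y) ×ˢ squareBox (3 * Y)).filter (fun p : (ℤ × ℤ) × (ℤ × ℤ) =>
        p.1.1 * p.2.1 + p.1.2 * p.2.2 = ((0 : ℕ) : ℤ))).card ≤
      ((squareBox (3 * Y) ×ˢ squareBox (3 * Y)).filter (fun p : (ℤ × ℤ) × (ℤ × ℤ) =>
        p.1 ≠ 0 ∧ p.1.1 * p.2.1 + p.1.2 * p.2.2 = ((0 : ℕ) : ℤ))).card +
      (squareBox (3 * Y)).card := by
    rw [← Finset.card_image_of_injective (squareBox (3 * Y))
      (f := fun q : ℤ × ℤ => ((0 : ℤ × ℤ), q)) (fun a b hab => (Prod.mk.inj hab).2)]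
    refine (Finset.card_le_card ?_).trans (Finset.card_union_le _ _)
    intro p hp
    simp only [Finset.mem_union, Finset.mem_filter, Finset.mem_product, Finset.mem_image] at hp ⊢
    by_cases hp0 : p.1 = 0
    · exact Or.inr ⟨p.2, hp.1.2, Prod.ext hp0.symm rfl⟩
    · exact Or.inl ⟨hp.1, hp0, hp.2⟩
  rw [card_squareBox] at h3
  have h4 := (Nat.cast_le (α := ℝ)).mpr (h1.trans h3)
  have h5 : ∑ m ∈ Finset.range (Y ^ 2 + 1), (rTwoSquares m : ℝ) ^ 2 =
      ((∑ m ∈ Finset.range (Y ^ 2 + 1), rTwoSquares m * rTwoSquares (m + 0) : ℕ) : ℝ) := by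
    push_cast
    exact Finset.sum_congr rfl fun m _ => by rw [add_zero]; ring
  rw [h5]
  refine h4.trans ?_
  have hY' : (1 : ℝ) ≤ Y := by exact_mod_cast hY
  have h6 : ((((squareBox (3 * Y) ×ˢ squareBox (3 * Y)).filter (fun p : (ℤ × ℤ) × (ℤ × ℤ) =>
        p.1 ≠ 0 ∧ p.1.1 * p.2.1 + p.1.2 * p.2.2 = ((0 : ℕ) : ℤ))).card : ℕ) : ℝ) ≤
        128 * ((3 * Y : ℕ) : ℝ) ^ 2 * recipDivisorSum (3 * Y) 0 := h2
  rw [Nat.cast_add]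
  refine (add_le_add_left h6 _).trans ?_
  push_cast
  nlinarith

lemma recipDivisorSum_zero_le {Z : ℕ} : recipDivisorSum Z 0 ≤ 1 + Real.log Z := by
  have h := harmonic_le_one_add_log Z
  rw [harmonic_eq_sum_Icc] at h
  push_cast at h
  simpa [recipDivisorSum, one_div] using h

/-- The weight `min (1 / h) (H / h²)`. -/
noncomputable def decayWeight (H h : ℝ) : ℝ := min (1 / h) (H / h ^ 2)

lemma decayWeight_nonneg {H h : ℝ} (hH : 0 ≤ H) (hh : 0 ≤ h) : 0 ≤ decayWeight H h :=
  le_min (by positivity) (by positivity)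

lemma decayWeight_mul_le {H g k : ℝ} (hH : 0 ≤ H) (hg : 1 ≤ g) (hk : 0 < k) :
    decayWeight H (g * k) ≤ 1 / g * decayWeight H k := by
  have hg0 : 0 < g := by linarith
  rw [decayWeight, decayWeight, mul_min_of_nonneg _ _ (by positivity)]
  refine min_le_min (le_of_eq (by field_simp)) ?_
  rw [show 1 / g * (H / k ^ 2) = H / (g * k ^ 2) by field_simp]
  apply div_le_div_of_nonneg_left hH (by positivity)
  nlinarith [mul_pos hg0 (pow_pos hk 2)]

lemma sum_decayWeight_le {H : ℕ} (hH : 1 ≤ H) (L : ℕ) :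
    ∑ k ∈ Finset.Icc 1 L, decayWeight H k ≤ 2 + Real.log H := by
  have hH0 : (0 : ℝ) < H := by exact_mod_cast hH
  have h1 : ∑ k ∈ Finset.Icc 1 L, decayWeight H k ≤
      ∑ k ∈ Finset.Icc 1 H, 1 / (k : ℝ) + ∑ k ∈ Finset.Ioc H (max H L), (H : ℝ) / (k : ℝ) ^ 2 := by
    calc _ ≤ ∑ k ∈ Finset.Icc 1 H ∪ Finset.Ioc H (max H L), decayWeight H k := by
          refine Finset.sum_le_sum_of_subset_of_nonneg ?_ fun k _ _ =>
            decayWeight_nonneg hH0.le (Nat.cast_nonneg k)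
          intro k hk
          simp only [Finset.mem_union, Finset.mem_Icc, Finset.mem_Ioc] at hk ⊢
          omega
      _ = ∑ k ∈ Finset.Icc 1 H, decayWeight H k +
          ∑ k ∈ Finset.Ioc H (max H L), decayWeight H k := by
          apply Finset.sum_union
          rw [Finset.disjoint_left]
          intro k hk
          simp only [Finset.mem_Icc, Finset.mem_Ioc] at hk ⊢
          omega
      _ ≤ _ := add_le_add (Finset.sum_le_sum fun k _ => min_le_left _ _)
          (Finset.sum_le_sum fun k _ => min_le_right _ _)
  have h2 : ∑ k ∈ Finset.Icc 1 H, 1 / (k : ℝ) ≤ 1 + Real.log H := by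
    have h := harmonic_le_one_add_log H
    rw [harmonic_eq_sum_Icc] at h
    push_cast at h
    simpa [one_div] using h
  have h3 : ∑ k ∈ Finset.Ioc H (max H L), (H : ℝ) / (k : ℝ) ^ 2 ≤ 1 := by
    have h := sum_Ioc_inv_sq_le_sub (α := ℝ) (k := H) (n := max H L) (by omega) (le_max_left _ _)
    simp only [div_eq_mul_inv]
    rw [← Finset.mul_sum]
    calc _ ≤ (H : ℝ) * ((H : ℝ)⁻¹ - ((max H L : ℕ) : ℝ)⁻¹) := by gcongr
      _ ≤ (H : ℝ) * (H : ℝ)⁻¹ := by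
        gcongr
        have : (0 : ℝ) ≤ ((max H L : ℕ) : ℝ)⁻¹ := by positivity
        linarith
      _ = 1 := mul_inv_cancel₀ hH0.ne'
  linarith

lemma sum_decayWeight_mul_recipDivisorSum_le {H : ℕ} (hH : 1 ≤ H) (Z L : ℕ) :
    ∑ h ∈ Finset.Icc 1 L, decayWeight H h * recipDivisorSum Z h ≤ 2 * (2 + Real.log H) := by
  have hH0 : (0 : ℝ) < H := by exact_mod_cast hH
  have hinner : ∀ g ∈ Finset.Icc 1 Z, ∑ h ∈ (Finset.Icc 1 L).filter (fun h => g ∣ h),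
      decayWeight H h ≤ 1 / (g : ℝ) * (2 + Real.log H) := by
    intro g hg
    have hg1 : 1 ≤ g := (Finset.mem_Icc.mp hg).1
    have hg1' : (1 : ℝ) ≤ g := by exact_mod_cast hg1
    calc _ ≤ ∑ h ∈ (Finset.Icc 1 L).image (fun k => g * k), decayWeight H h := by
          refine Finset.sum_le_sum_of_subset_of_nonneg ?_ fun k _ _ =>
            decayWeight_nonneg hH0.le (Nat.cast_nonneg k)
          intro h hh
          simp only [Finset.mem_filter, Finset.mem_Icc, Finset.mem_image] at hh ⊢
          obtain ⟨⟨h1, h2⟩, k, rfl⟩ := hh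
          exact ⟨k, ⟨Nat.pos_of_mul_pos_left h1, (Nat.le_mul_of_pos_left k hg1).trans h2⟩, rfl⟩
      _ = ∑ k ∈ Finset.Icc 1 L, decayWeight H (g * k : ℕ) :=
          Finset.sum_image fun a _ b _ hab => Nat.eq_of_mul_eq_mul_left hg1 hab
      _ ≤ ∑ k ∈ Finset.Icc 1 L, 1 / (g : ℝ) * decayWeight H k := by
          refine Finset.sum_le_sum fun k hk => ?_
          push_cast
          exact decayWeight_mul_le hH0.le hg1' (by exact_mod_cast (Finset.mem_Icc.mp hk).1)
      _ ≤ _ := by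
          rw [← Finset.mul_sum]
          exact mul_le_mul_of_nonneg_left (sum_decayWeight_le hH L) (by positivity)
  have hlog : 0 ≤ Real.log H := Real.log_natCast_nonneg H
  calc _ = ∑ h ∈ Finset.Icc 1 L, ∑ g ∈ Finset.Icc 1 Z,
        if g ∣ h then 1 / (g : ℝ) * decayWeight H h else 0 := by
        refine Finset.sum_congr rfl fun h _ => ?_
        rw [recipDivisorSum, Finset.mul_sum, Finset.sum_filter]
        exact Finset.sum_congr rfl fun g _ => by split_ifs <;> ring
    _ = ∑ g ∈ Finset.Icc 1 Z, 1 / (g : ℝ) * ∑ h ∈ (Finset.Icc 1 L).filter (fun h => g ∣ h),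
        decayWeight H h := by
        rw [Finset.sum_comm]
        refine Finset.sum_congr rfl fun g _ => ?_
        rw [Finset.mul_sum, Finset.sum_filter]
    _ ≤ ∑ g ∈ Finset.Icc 1 Z, ((g : ℝ) ^ 2)⁻¹ * (2 + Real.log H) := by
        refine Finset.sum_le_sum fun g hg => ?_
        refine (mul_le_mul_of_nonneg_left (hinner g hg) (by positivity)).trans (le_of_eq ?_)
        rw [one_div, ← mul_assoc, ← mul_inv, sq]
    _ ≤ _ := by
        rw [← Finset.sum_mul]
        refine mul_le_mul_of_nonneg_right ?_ (by linarith)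
        rcases Nat.eq_zero_or_pos Z with rfl | hZ
        · simp
        have h := sum_Ioc_inv_sq_le_sub (α := ℝ) (k := 1) (n := Z) one_ne_zero hZ
        rw [← Finset.add_sum_Ioc_eq_sum_Icc hZ]
        have : (0 : ℝ) ≤ (Z : ℝ)⁻¹ := by positivity
        push_cast at h ⊢
        norm_num at h ⊢
        linarith

/-- Pairs of distinct arguments, counted with a weight decaying in their distance. -/
lemma sum_offDiag_decayWeight_le {Y H : ℕ} (hH : 1 ≤ H) :
    ∑ m ∈ Finset.range (Y ^ 2 + 1), ∑ n ∈ Finset.range (Y ^ 2 + 1),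
      (if m = n then 0 else (rTwoSquares m : ℝ) * rTwoSquares n *
        decayWeight H |(m : ℝ) - n|) ≤ 4608 * (Y : ℝ) ^ 2 * (2 + Real.log H) := by
  set R := Finset.range (Y ^ 2 + 1) with hR
  have hH0 : (0 : ℝ) < H := by exact_mod_cast hH
  set F : ℕ → ℕ → ℝ := fun m n => if m < n then (rTwoSquares m : ℝ) * rTwoSquares n *
        decayWeight H |(m : ℝ) - n| else 0 with hF
  have hsplit : ∀ m n : ℕ, (if m = n then 0 else (rTwoSquares m : ℝ) * rTwoSquares n *
        decayWeight H |(m : ℝ) - n|) = F m n + F n m := by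
    intro m n
    rcases lt_trichotomy m n with h | h | h
    · simp [hF, h, h.ne, h.le]
    · simp [hF, h]
    · simp only [hF, h, h.ne', h.le.not_gt, if_true, if_false, zero_add, abs_sub_comm (m : ℝ)]
      ring
  have hhalf : ∑ m ∈ R, ∑ n ∈ R, F m n ≤ 2304 * (Y : ℝ) ^ 2 * (2 + Real.log H) := by
    calc _ ≤ ∑ m ∈ R, ∑ h ∈ Finset.Icc 1 (Y ^ 2),
          (rTwoSquares m : ℝ) * rTwoSquares (m + h) * decayWeight H h := by
          refine Finset.sum_le_sum fun m hm => ?_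
          rw [← Finset.sum_filter]
          calc _ = ∑ n ∈ R.filter (fun n => m < n), (rTwoSquares m : ℝ) *
                rTwoSquares (m + (n - m)) * decayWeight H ((n - m : ℕ) : ℝ) := by
                refine Finset.sum_congr rfl fun n hn => ?_
                have hmn := (Finset.mem_filter.mp hn).2
                rw [Nat.add_sub_cancel' hmn.le, Nat.cast_sub hmn.le, abs_sub_comm,
                  abs_of_nonneg (by rw [sub_nonneg]; exact_mod_cast hmn.le)]
            _ = ∑ h ∈ (R.filter (fun n => m < n)).image (fun n => n - m), (rTwoSquares m : ℝ) *
                rTwoSquares (m + h) * decayWeight H (h : ℝ) := by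
                rw [Finset.sum_image]
                intro a ha b hb hab
                simp only [Finset.coe_filter, Set.mem_ofPred_eq] at ha hb hab
                omega
            _ ≤ _ := by
                refine Finset.sum_le_sum_of_subset_of_nonneg ?_ fun k _ _ =>
                  mul_nonneg (by positivity) (decayWeight_nonneg hH0.le (Nat.cast_nonneg k))
                intro h hh
                simp only [hR, Finset.mem_image, Finset.mem_filter, Finset.mem_range,
                  Finset.mem_Icc] at hh ⊢
                omega
      _ = ∑ h ∈ Finset.Icc 1 (Y ^ 2), decayWeight H h *
          ∑ m ∈ R, (rTwoSquares m : ℝ) * rTwoSquares (m + h) := by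
          rw [Finset.sum_comm]
          refine Finset.sum_congr rfl fun h _ => ?_
          rw [Finset.mul_sum]
          exact Finset.sum_congr rfl fun m _ => mul_comm _ _
      _ ≤ ∑ h ∈ Finset.Icc 1 (Y ^ 2), decayWeight H h *
          (1152 * (Y : ℝ) ^ 2 * recipDivisorSum (3 * Y) h) := by
          refine Finset.sum_le_sum fun h hh => mul_le_mul_of_nonneg_left ?_
            (decayWeight_nonneg hH0.le (Nat.cast_nonneg h))
          have := Finset.mem_Icc.mp hh
          exact rTwoSquares_correlation_le this.2 (by omega)
      _ = 1152 * (Y : ℝ) ^ 2 * ∑ h ∈ Finset.Icc 1 (Y ^ 2),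
          decayWeight H h * recipDivisorSum (3 * Y) h := by
          rw [Finset.mul_sum]
          exact Finset.sum_congr rfl fun h _ => by ring
      _ ≤ 1152 * (Y : ℝ) ^ 2 * (2 * (2 + Real.log H)) := by
          gcongr
          exact sum_decayWeight_mul_recipDivisorSum_le hH _ _
      _ = _ := by ring
  have h2 : ∑ m ∈ R, ∑ n ∈ R, F n m = ∑ m ∈ R, ∑ n ∈ R, F m n := Finset.sum_comm
  simp only [hsplit, Finset.sum_add_distrib]
  linarith

lemma Complex.re_cpow_half_nonneg (a : ℂ) : 0 ≤ (a ^ (1 / 2 : ℂ)).re := by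
  by_cases ha : a = 0
  · simp [ha]
  rw [Complex.cpow_def_of_ne_zero ha, Complex.exp_re]
  refine mul_nonneg (Real.exp_pos _).le (Real.cos_nonneg_of_mem_Icc ?_)
  have h1 : (Complex.log a * (1 / 2)).im = a.arg / 2 := by
    rw [show (1 / 2 : ℂ) = ((1 / 2 : ℝ) : ℂ) by push_cast; rfl, Complex.im_mul_ofReal,
      Complex.log_im]
    ring
  rw [h1]
  constructor <;> linarith [Complex.neg_pi_lt_arg a, Complex.arg_le_pi a]

lemma Complex.norm_cpow_half_sub_le (a b : ℂ) (hb : 0 < b.re) :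
    ‖a ^ (1 / 2 : ℂ) - b‖ ≤ ‖a - b ^ 2‖ / b.re := by
  rw [le_div_iff₀ hb]
  have h1 : (a ^ (1 / 2 : ℂ)) ^ 2 = a := by
    rw [← Complex.cpow_nat_mul]; norm_num
  have h2 : a - b ^ 2 = (a ^ (1 / 2 : ℂ) - b) * (a ^ (1 / 2 : ℂ) + b) := by
    nth_rewrite 1 [← h1]; ring
  rw [h2, norm_mul]
  refine mul_le_mul_of_nonneg_left ?_ (norm_nonneg _)
  refine le_trans ?_ (Complex.re_le_norm _)
  rw [Complex.add_re]
  linarith [Complex.re_cpow_half_nonneg a]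

/-- The Fourier transform of the unit disc, up to scaling: `π J₁(z) / z`. -/
noncomputable def discKernel (z : ℝ) : ℝ := ∫ s in (-1 : ℝ)..1, √(1 - s ^ 2) * Real.cos (z * s)

lemma discKernel_zero : discKernel 0 = π / 2 := by
  simp [discKernel, integral_sqrt_one_sub_sq]

lemma continuous_discKernel : Continuous discKernel := by
  unfold discKernel
  apply intervalIntegral.continuous_parametric_intervalIntegral_of_continuous'
  fun_prop

/-- The integrand of the contour integral for `discKernel`. -/
noncomputable def discContour (z : ℝ) (w : ℂ) : ℂ :=
  (1 - w ^ 2) ^ (1 / 2 : ℂ) * Complex.exp (Complex.I * z * w)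

lemma continuousAt_discContour (z : ℝ) {w : ℂ} (hw : |w.re| ≤ 1) :
    ContinuousAt (discContour z) w := by
  unfold discContour
  refine ContinuousAt.mul ?_ (by fun_prop)
  refine ContinuousAt.comp (f := fun w : ℂ => 1 - w ^ 2) (g := fun x : ℂ => x ^ (1 / 2 : ℂ))
    (Complex.continuousAt_cpow_const_of_re_pos (Or.inl ?_) (by norm_num)) (by fun_prop)
  have : w.re ^ 2 ≤ 1 := by rw [← sq_abs]; nlinarith [abs_nonneg w.re]
  simp only [sq, Complex.sub_re, Complex.mul_re, Complex.one_re]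
  nlinarith [sq_nonneg w.im]

lemma differentiableAt_discContour (z : ℝ) {w : ℂ} (hw : |w.re| < 1) :
    DifferentiableAt ℂ (discContour z) w := by
  unfold discContour
  refine DifferentiableAt.mul ?_ (by fun_prop)
  refine DifferentiableAt.cpow_const (by fun_prop) (Or.inl ?_)
  have : w.re ^ 2 < 1 := by rw [← sq_abs]; nlinarith [abs_nonneg w.re]
  simp only [sq, Complex.sub_re, Complex.mul_re, Complex.one_re]
  nlinarith [sq_nonneg w.im]

lemma discKernel_eq_contour (z R : ℝ) :
    discKernel z = (∫ x in (-1 : ℝ)..1, discContour z (x + R * Complex.I)).re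
      + (∫ y in (0 : ℝ)..R, discContour z (1 + y * Complex.I)).im
      - (∫ y in (0 : ℝ)..R, discContour z (-1 + y * Complex.I)).im := by
  have h := Complex.integral_boundary_rect_eq_zero_of_continuousOn_of_differentiableOn
    (discContour z) (-1) (1 + R * Complex.I) ?_ ?_
  · simp only [Complex.neg_re, Complex.one_re, Complex.add_re, Complex.mul_re, Complex.ofReal_re,
      Complex.I_re, mul_zero, Complex.ofReal_im, Complex.I_im, mul_one, sub_self, add_zero,
      Complex.neg_im, Complex.one_im, neg_zero, Complex.add_im, Complex.mul_im, zero_add,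
      Complex.ofReal_zero, zero_mul, Complex.ofReal_neg, Complex.ofReal_one] at h
    have h1 : (∫ x in (-1 : ℝ)..1, discContour z x).re = discKernel z := by
      have hint :
          IntervalIntegrable (fun x : ℝ => discContour z x) MeasureTheory.volume (-1) 1 := by
        apply ContinuousOn.intervalIntegrable
        intro x hx
        rw [Set.uIcc_of_le (by norm_num)] at hx
        exact (ContinuousAt.comp (f := fun x : ℝ => (x : ℂ)) (g := discContour z)
          (continuousAt_discContour z (by simpa using abs_le.mpr hx))
          (by fun_prop)).continuousWithinAt
      have := Complex.reCLM.intervalIntegral_comp_comm hint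
      simp only [Complex.reCLM_apply] at this
      rw [← this, discKernel]
      refine intervalIntegral.integral_congr fun x hx => ?_
      rw [Set.uIcc_of_le (by norm_num)] at hx
      have hx2 : 0 ≤ 1 - x ^ 2 := by nlinarith [hx.1, hx.2]
      simp only [discContour]
      have h3 : (1 - (x : ℂ) ^ 2) ^ (1 / 2 : ℂ) = ((√(1 - x ^ 2) : ℝ) : ℂ) := by
        rw [Real.sqrt_eq_rpow, Complex.ofReal_cpow hx2]; push_cast; rfl
      rw [h3, Complex.re_ofReal_mul, show Complex.I * z * x = ((z * x : ℝ) : ℂ) * Complex.I by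
        push_cast; ring, Complex.exp_ofReal_mul_I_re]
    have h2 := congrArg Complex.re h
    simp only [Complex.add_re, Complex.sub_re, smul_eq_mul, Complex.I_mul_re, Complex.zero_re,
      h1] at h2
    linarith
  · intro w hw
    apply (continuousAt_discContour z ?_).continuousWithinAt
    have := hw.1
    simp only [Complex.neg_re, Complex.one_re, Complex.add_re, Complex.mul_re, Complex.ofReal_re,
      Complex.I_re, mul_zero, Complex.ofReal_im, Complex.I_im, mul_one, sub_self, add_zero] at this
    rw [Set.uIcc_of_le (by norm_num)] at this
    exact abs_le.mpr this
  · intro w hw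
    apply (differentiableAt_discContour z ?_).differentiableWithinAt
    have := hw.1
    simp only [Complex.neg_re, Complex.one_re, Complex.add_re, Complex.mul_re, Complex.ofReal_re,
      Complex.I_re, mul_zero, Complex.ofReal_im, Complex.I_im, mul_one, sub_self, add_zero] at this
    norm_num at this
    exact abs_lt.mpr this

lemma norm_discContour_top_le (z : ℝ) {x R : ℝ} (hx : |x| ≤ 1) :
    ‖discContour z (x + R * Complex.I)‖ ≤ (2 + R ^ 2) * Real.exp (-(z * R)) := by
  rw [discContour, norm_mul, Complex.norm_exp]
  have h1 : (Complex.I * z * (x + R * Complex.I)).re = -(z * R) := by simp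
  rw [h1]
  refine mul_le_mul_of_nonneg_right ?_ (Real.exp_pos _).le
  have hx2 : x ^ 2 ≤ 1 := by rw [← sq_abs]; nlinarith [abs_nonneg x]
  have h2 : ‖(1 : ℂ) - (x + R * Complex.I) ^ 2‖ ≤ 2 + R ^ 2 := by
    refine (norm_sub_le _ _).trans ?_
    rw [norm_pow, norm_one, Complex.sq_norm, Complex.normSq_add_mul_I]
    linarith
  rw [show (1 / 2 : ℂ) = ((1 / 2 : ℝ) : ℂ) by push_cast; rfl]
  rw [Complex.norm_cpow_real]
  calc _ ≤ (2 + R ^ 2) ^ (1 / 2 : ℝ) := Real.rpow_le_rpow (norm_nonneg _) h2 (by norm_num)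
    _ ≤ (2 + R ^ 2) ^ (1 : ℝ) :=
      Real.rpow_le_rpow_of_exponent_le (by nlinarith [sq_nonneg R]) (by norm_num)
    _ = _ := Real.rpow_one _

lemma norm_discContour_side_sub_le (z : ℝ) {σ y : ℝ} (hσ : σ ^ 2 = 1) (hy : 0 ≤ y) :
    ‖discContour z (σ + y * Complex.I) - (√y * Real.exp (-(z * y)) : ℝ) *
      ((1 - σ * Complex.I) * Complex.exp ((σ * z : ℝ) * Complex.I))‖ ≤
      y ^ (3 / 2 : ℝ) * Real.exp (-(z * y)) := by
  have h1 : discContour z (σ + y * Complex.I) - (√y * Real.exp (-(z * y)) : ℝ) *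
      ((1 - σ * Complex.I) * Complex.exp ((σ * z : ℝ) * Complex.I)) =
      ((1 - (σ + y * Complex.I) ^ 2) ^ (1 / 2 : ℂ) - √y * (1 - σ * Complex.I)) *
        (Real.exp (-(z * y)) * Complex.exp ((σ * z : ℝ) * Complex.I)) := by
    have : Complex.exp (Complex.I * z * (σ + y * Complex.I)) =
        Real.exp (-(z * y)) * Complex.exp ((σ * z : ℝ) * Complex.I) := by
      rw [Complex.ofReal_exp, ← Complex.exp_add]
      congr 1
      push_cast
      linear_combination (z * y : ℂ) * Complex.I_sq
    rw [discContour, this]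
    push_cast
    ring
  have h2 : ‖(Real.exp (-(z * y)) : ℂ) * Complex.exp ((σ * z : ℝ) * Complex.I)‖ =
      Real.exp (-(z * y)) := by
    rw [norm_mul, Complex.norm_exp_ofReal_mul_I, mul_one, Complex.norm_real, Real.norm_eq_abs,
      abs_of_pos (Real.exp_pos _)]
  rw [h1, norm_mul, h2]
  refine mul_le_mul_of_nonneg_right ?_ (Real.exp_pos _).le
  rcases hy.eq_or_lt with rfl | hy
  · have : (1 : ℂ) - (σ : ℂ) ^ 2 = 0 := by rw [← Complex.ofReal_pow, hσ]; simp
    simp [this]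
  have hre : ((√y : ℂ) * (1 - σ * Complex.I)).re = √y := by simp
  refine (Complex.norm_cpow_half_sub_le _ _ (by rw [hre]; positivity)).trans ?_
  rw [hre]
  have h3 : 1 - ((σ : ℂ) + y * Complex.I) ^ 2 - ((√y : ℂ) * (1 - σ * Complex.I)) ^ 2 =
      ((y ^ 2 : ℝ) : ℂ) := by
    have ha : (√y : ℂ) ^ 2 = y := by rw [← Complex.ofReal_pow, Real.sq_sqrt hy.le]
    have hb : (σ : ℂ) ^ 2 = 1 := by rw [← Complex.ofReal_pow, hσ]; simp
    rw [mul_pow, ha]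
    push_cast
    linear_combination (-(1 : ℂ) - y * Complex.I ^ 2) * hb - (y ^ 2 + y : ℂ) * Complex.I_sq
  rw [h3, Complex.norm_real, Real.norm_eq_abs, abs_of_nonneg (by positivity),
    div_le_iff₀ (by positivity), Real.sqrt_eq_rpow, ← Real.rpow_add hy]
  norm_num

lemma abs_integral_discContour_side_sub_le (z : ℝ) {σ R : ℝ} (hσ : σ ^ 2 = 1) (hR : 0 ≤ R) :
    |(∫ y in (0 : ℝ)..R, discContour z (σ + y * Complex.I)).im -
      (∫ y in (0 : ℝ)..R, √y * Real.exp (-(z * y))) * (Real.sin (σ * z) - σ * Real.cos (σ * z))| ≤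
      ∫ y in (0 : ℝ)..R, y ^ (3 / 2 : ℝ) * Real.exp (-(z * y)) := by
  have hσ1 : |σ| ≤ 1 := by rw [← sq_le_one_iff_abs_le_one, hσ]
  have hc : Continuous fun y : ℝ => discContour z (σ + y * Complex.I) :=
    continuous_iff_continuousAt.mpr fun y =>
      ContinuousAt.comp (f := fun y : ℝ => (σ + y * Complex.I : ℂ)) (g := discContour z)
        (continuousAt_discContour z (by simpa using hσ1)) (by fun_prop)
  set K : ℂ := (1 - σ * Complex.I) * Complex.exp ((σ * z : ℝ) * Complex.I) with hK
  have hKim : K.im = Real.sin (σ * z) - σ * Real.cos (σ * z) := by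
    rw [hK, Complex.mul_im, Complex.exp_ofReal_mul_I_re, Complex.exp_ofReal_mul_I_im]
    simp
    ring
  have h1 : (∫ y in (0 : ℝ)..R, discContour z (σ + y * Complex.I)) -
      (∫ y in (0 : ℝ)..R, √y * Real.exp (-(z * y)) : ℝ) * K =
      ∫ y in (0 : ℝ)..R, (discContour z (σ + y * Complex.I) -
        (√y * Real.exp (-(z * y)) : ℝ) * K) := by
    have hgK : Continuous fun y : ℝ => ((√y * Real.exp (-(z * y)) : ℝ) : ℂ) * K := by fun_prop
    rw [intervalIntegral.integral_sub (hc.intervalIntegrable _ _) (hgK.intervalIntegrable _ _),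
      intervalIntegral.integral_mul_const,
      intervalIntegral.integral_ofReal]
  rw [← hKim, ← Complex.im_ofReal_mul, ← Complex.sub_im, h1]
  refine (Complex.abs_im_le_norm _).trans ?_
  refine intervalIntegral.norm_integral_le_of_norm_le hR ?_ ?_
  · refine Eventually.of_forall fun y hy => norm_discContour_side_sub_le z hσ hy.1.le
  · exact Continuous.intervalIntegrable (by fun_prop (disch := norm_num)) _ _

lemma abs_discKernel_sub_le_truncated (z : ℝ) {R : ℝ} (hR : 0 ≤ R) :
    |discKernel z - 2 * (Real.sin z - Real.cos z) * ∫ y in (0 : ℝ)..R, √y * Real.exp (-(z * y))| ≤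
      2 * ((2 + R ^ 2) * Real.exp (-(z * R))) +
        2 * ∫ y in (0 : ℝ)..R, y ^ (3 / 2 : ℝ) * Real.exp (-(z * y)) := by
  have h1 := abs_integral_discContour_side_sub_le z (σ := 1) (by norm_num) hR
  have h2 := abs_integral_discContour_side_sub_le z (σ := -1) (by norm_num) hR
  have h3 : |(∫ x in (-1 : ℝ)..1, discContour z (x + R * Complex.I)).re| ≤
      2 * ((2 + R ^ 2) * Real.exp (-(z * R))) := by
    refine (Complex.abs_re_le_norm _).trans ?_
    refine (intervalIntegral.norm_integral_le_of_norm_le_const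
      (C := (2 + R ^ 2) * Real.exp (-(z * R))) fun x hx => ?_).trans_eq (by norm_num; ring)
    rw [Set.uIoc_of_le (by norm_num)] at hx
    exact norm_discContour_top_le z (abs_le.mpr ⟨hx.1.le, hx.2⟩)
  have h4 := discKernel_eq_contour z R
  simp only [Complex.ofReal_one, Complex.ofReal_neg, one_mul, neg_mul, Real.sin_neg,
    Real.cos_neg] at h1 h2
  rw [h4]
  rw [abs_le] at *
  constructor <;> nlinarith [h1.1, h1.2, h2.1, h2.2, h3.1, h3.2]

/-- The classical asymptotics of the Bessel function `J₁`, with one term. -/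
lemma abs_discKernel_sub_le {z : ℝ} (hz : 0 < z) :
    |discKernel z - √π * z ^ (-(3 / 2) : ℝ) * (Real.sin z - Real.cos z)| ≤
      2 * Real.Gamma (5 / 2) * z ^ (-(5 / 2) : ℝ) := by
  have e1 : ∫ t in Set.Ioi (0 : ℝ), √t * Real.exp (-(z * t)) = z ^ (-(3 / 2) : ℝ) * (√π / 2) := by
    have := Real.integral_rpow_mul_exp_neg_mul_Ioi (a := 3 / 2) (r := z) (by norm_num) hz
    have hG : Real.Gamma (3 / 2) = √π / 2 := by
      rw [show (3 / 2 : ℝ) = 1 / 2 + 1 by norm_num, Real.Gamma_add_one (by norm_num),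
        Real.Gamma_one_half_eq]
      ring
    rw [hG, one_div, Real.inv_rpow hz.le, ← Real.rpow_neg hz.le] at this
    rw [← this]
    norm_num [Real.sqrt_eq_rpow]
  have e2 : ∫ t in Set.Ioi (0 : ℝ), t ^ (3 / 2 : ℝ) * Real.exp (-(z * t)) =
      z ^ (-(5 / 2) : ℝ) * Real.Gamma (5 / 2) := by
    have := Real.integral_rpow_mul_exp_neg_mul_Ioi (a := 5 / 2) (r := z) (by norm_num) hz
    rw [one_div, Real.inv_rpow hz.le, ← Real.rpow_neg hz.le] at this
    rw [← this]
    norm_num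
  have i1 : MeasureTheory.IntegrableOn (fun t : ℝ => √t * Real.exp (-(z * t))) (Set.Ioi 0) := by
    by_contra h
    have := MeasureTheory.integral_undef h
    rw [e1] at this
    have : 0 < z ^ (-(3 / 2) : ℝ) * (√π / 2) := by positivity
    linarith
  have i2 : MeasureTheory.IntegrableOn (fun t : ℝ => t ^ (3 / 2 : ℝ) * Real.exp (-(z * t)))
      (Set.Ioi 0) := by
    by_contra h
    have := MeasureTheory.integral_undef h
    rw [e2] at this
    have h5 : 0 < Real.Gamma (5 / 2) := Real.Gamma_pos_of_pos (by norm_num)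
    have : 0 < z ^ (-(5 / 2) : ℝ) * Real.Gamma (5 / 2) := by positivity
    linarith
  have t1 := MeasureTheory.intervalIntegral_tendsto_integral_Ioi 0 i1 tendsto_id
  have t2 := MeasureTheory.intervalIntegral_tendsto_integral_Ioi 0 i2 tendsto_id
  rw [e1] at t1
  rw [e2] at t2
  have t3 : Tendsto (fun R : ℝ => (2 + R ^ 2) * Real.exp (-(z * R))) atTop (nhds 0) := by
    have a1 := tendsto_rpow_mul_exp_neg_mul_atTop_nhds_zero 0 z hz
    have a2 := tendsto_rpow_mul_exp_neg_mul_atTop_nhds_zero 2 z hz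
    have := (a1.const_mul 2).add a2
    simp only [Real.rpow_zero, one_mul, Real.rpow_two, mul_zero, add_zero, neg_mul] at this
    exact this.congr fun R => by ring
  have lim := le_of_tendsto_of_tendsto ((tendsto_const_nhds (x := discKernel z)).sub
    (t1.const_mul (2 * (Real.sin z - Real.cos z)))).abs ((t3.const_mul 2).add (t2.const_mul 2))
    ((eventually_ge_atTop 0).mono fun R hR => abs_discKernel_sub_le_truncated z hR)
  refine le_trans (le_of_eq ?_) (lim.trans_eq ?_)
  · congr 1; ring
  · ring

lemma tsum_eq_tsum_fourier_of_eq_zero {f : ℝ → ℂ} (hc : Continuous f) {K : ℝ}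
    (hf : ∀ x, K < |x| → f x = 0) (hs : Summable fun n : ℤ => FourierTransform.fourier f (n : ℝ)) :
    ∑' n : ℤ, f n = ∑' n : ℤ, FourierTransform.fourier f (n : ℝ) := by
  have h := Real.tsum_eq_tsum_fourier_of_rpow_decay_of_summable hc (b := 2) (by norm_num)
    (IsBigO.of_bound 1 ?_) hs 0
  · simpa using h
  · filter_upwards [(tendsto_norm_cocompact_atTop (E := ℝ)).eventually (eventually_gt_atTop K)]
      with x hx
    rw [hf x hx, norm_zero]
    positivity

/-- The truncated paraboloid whose lattice sum is the integrated lattice point count. -/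
noncomputable def paraboloid (x s y : ℝ) : ℝ := max (x - s ^ 2 - y ^ 2) 0

lemma paraboloid_eq_zero {x s y : ℝ} (h : x ≤ s ^ 2 + y ^ 2) : paraboloid x s y = 0 :=
  max_eq_right (by linarith)

lemma paraboloid_eq_zero_left {x s y : ℝ} (h : √x < |s|) : paraboloid x s y = 0 := by
  refine paraboloid_eq_zero ?_
  have := (Real.sqrt_lt' (lt_of_le_of_lt (Real.sqrt_nonneg _) h)).mp h
  rw [sq_abs] at this
  nlinarith [sq_nonneg y]

lemma paraboloid_eq_zero_right {x s y : ℝ} (h : √x < |y|) : paraboloid x s y = 0 := by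
  refine paraboloid_eq_zero ?_
  have := (Real.sqrt_lt' (lt_of_le_of_lt (Real.sqrt_nonneg _) h)).mp h
  rw [sq_abs] at this
  nlinarith [sq_nonneg s]

/-- The partial Fourier transform of the truncated paraboloid in the first variable. -/
noncomputable def paraboloidFourier (x l y : ℝ) : ℂ :=
  FourierTransform.fourier (fun s => (paraboloid x s y : ℂ)) l

lemma paraboloidFourier_eq_zero {x l y : ℝ} (h : √x < |y|) : paraboloidFourier x l y = 0 := by
  simp [paraboloidFourier, Real.fourier_real_eq_integral_exp_smul, paraboloid_eq_zero_right h]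

lemma intervalIntegral_eq_integral_of_eq_zero {E : Type*} [NormedAddCommGroup E]
    [NormedSpace ℝ E] {f : ℝ → E} {S : ℝ} (hS : 0 ≤ S)
    (hf : ∀ s, S < |s| → f s = 0) : ∫ s, f s = ∫ s in (-S)..S, f s := by
  rw [intervalIntegral.integral_of_le (by linarith), ← MeasureTheory.integral_Icc_eq_integral_Ioc]
  refine (MeasureTheory.setIntegral_eq_integral_of_forall_compl_eq_zero fun s hs => hf s ?_).symm
  by_contra h
  exact hs (abs_le.mp (not_lt.mp h))

lemma paraboloidFourier_eq_interval {x l y S : ℝ} (hS : √x ≤ S) :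
    paraboloidFourier x l y =
      ∫ s in (-S)..S, Complex.exp (((-2 * π * s * l : ℝ) : ℂ) * Complex.I) * paraboloid x s y := by
  rw [paraboloidFourier, Real.fourier_real_eq_integral_exp_smul]
  simp only [smul_eq_mul]
  exact intervalIntegral_eq_integral_of_eq_zero ((Real.sqrt_nonneg _).trans hS) fun s hs => by
    simp [paraboloid_eq_zero_left (hS.trans_lt hs)]

lemma continuous_paraboloidFourier (x l : ℝ) : Continuous (paraboloidFourier x l) := by
  have : paraboloidFourier x l = fun y => ∫ s in (-√x)..√x,
      Complex.exp (((-2 * π * s * l : ℝ) : ℂ) * Complex.I) * paraboloid x s y := by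
    ext y
    exact paraboloidFourier_eq_interval le_rfl
  rw [this]
  apply intervalIntegral.continuous_parametric_intervalIntegral_of_continuous'
  unfold paraboloid
  fun_prop

lemma norm_integral_exp_mul_sq_sub_sq_le {c : ℂ} (hc : 1 ≤ ‖c‖) (hre : c.re = 0) {r : ℝ}
    (hr : 0 ≤ r) :
    ‖∫ s in (-r)..r, Complex.exp (c * s) * ((r ^ 2 - s ^ 2 : ℝ) : ℂ)‖ ≤ (4 * r + 4) / ‖c‖ ^ 2 := by
  have hc0 : c ≠ 0 := by rintro rfl; norm_num at hc
  have hd : ∀ s : ℝ, HasDerivAt (fun s : ℝ => Complex.exp (c * s) *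
      ((r ^ 2 - s ^ 2) / c + 2 * s / c ^ 2 - 2 / c ^ 3))
      (Complex.exp (c * s) * ((r ^ 2 - s ^ 2 : ℝ) : ℂ)) s := by
    intro s
    have h0 : HasDerivAt (fun s : ℝ => (s : ℂ)) 1 s := Complex.ofRealCLM.hasDerivAt
    have h1 : HasDerivAt (fun s : ℝ => Complex.exp (c * s)) (Complex.exp (c * s) * (c * 1)) s :=
      (h0.const_mul c).cexp
    have h2 := h1.mul (((((h0.pow 2).const_sub ((r : ℂ) ^ 2)).div_const c).add
      ((h0.const_mul 2).div_const (c ^ 2))).sub_const (2 / c ^ 3))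
    refine HasDerivAt.congr_deriv h2 ?_
    push_cast
    simp
    field_simp
    ring
  rw [intervalIntegral.integral_eq_sub_of_hasDerivAt (fun s _ => hd s)
    (Continuous.intervalIntegrable (by fun_prop) _ _)]
  have hb : ∀ s : ℝ, s ^ 2 = r ^ 2 → ‖Complex.exp (c * s) *
      (((r : ℂ) ^ 2 - (s : ℂ) ^ 2) / c + 2 * s / c ^ 2 - 2 / c ^ 3)‖ ≤ (2 * r + 2) / ‖c‖ ^ 2 := by
    intro s hs
    have hs' : (s : ℂ) ^ 2 = (r : ℂ) ^ 2 := by exact_mod_cast congrArg (fun t : ℝ => (t : ℂ)) hs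
    have h3 : |s| = r := by rw [← Real.sqrt_sq_eq_abs, hs, Real.sqrt_sq hr]
    rw [norm_mul, Complex.norm_exp, Complex.re_mul_ofReal, hre, zero_mul, Real.exp_zero, one_mul,
      hs', sub_self, zero_div, zero_add]
    refine (norm_sub_le _ _).trans ?_
    rw [norm_div, norm_div, norm_pow, norm_pow, norm_mul, Complex.norm_real, Real.norm_eq_abs, h3,
      Complex.norm_ofNat, add_div]
    gcongr
    · norm_num
  refine (norm_sub_le _ _).trans ?_
  have := add_le_add (hb r rfl) (hb (-r) (by ring))
  push_cast at this ⊢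
  refine this.trans_eq ?_
  ring

lemma norm_paraboloidFourier_le {x y : ℝ} {l : ℤ} (hl : l ≠ 0) :
    ‖paraboloidFourier x l y‖ ≤ (4 * √(x - y ^ 2) + 4) * (1 / (l : ℝ) ^ 2) := by
  set r := √(x - y ^ 2) with hr
  have h1 : paraboloidFourier x l y = ∫ s in (-r)..r,
      Complex.exp (((-2 * π * l : ℝ) * Complex.I : ℂ) * s) * ((r ^ 2 - s ^ 2 : ℝ) : ℂ) := by
    rw [paraboloidFourier, Real.fourier_real_eq_integral_exp_smul]
    simp only [smul_eq_mul]
    rw [intervalIntegral_eq_integral_of_eq_zero (S := r) (Real.sqrt_nonneg _)]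
    · refine intervalIntegral.integral_congr fun s hs => ?_
      rw [Set.uIcc_of_le (by linarith [Real.sqrt_nonneg (x - y ^ 2)])] at hs
      congr 1
      · congr 1; push_cast; ring
      · congr 1
        have h2 : s ^ 2 ≤ r ^ 2 := sq_le_sq' hs.1 hs.2
        rcases le_or_gt 0 (x - y ^ 2) with h | h
        · rw [hr, Real.sq_sqrt h] at h2 ⊢
          rw [paraboloid, max_eq_left (by linarith)]; ring
        · rw [hr, Real.sqrt_eq_zero_of_nonpos h.le] at h2 ⊢
          rw [paraboloid_eq_zero (by nlinarith [sq_nonneg s])]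
          nlinarith [sq_nonneg s]
    · intro s hs
      rw [paraboloid_eq_zero]
      · simp
      · have := (Real.sqrt_lt' (lt_of_le_of_lt (Real.sqrt_nonneg _) hs)).mp hs
        rw [sq_abs] at this
        linarith
  have hn : ‖((-2 * π * l : ℝ) * Complex.I : ℂ)‖ = 2 * π * |(l : ℝ)| := by
    rw [norm_mul, Complex.norm_I, mul_one, Complex.norm_real, Real.norm_eq_abs, abs_mul, abs_mul,
      abs_of_pos Real.pi_pos]
    norm_num
  have hl1 : (1 : ℝ) ≤ |(l : ℝ)| := by exact_mod_cast Int.one_le_abs hl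
  have hpi := Real.pi_gt_three
  have hle : |(l : ℝ)| ≤ 2 * π * |(l : ℝ)| := by nlinarith
  rw [h1]
  refine (norm_integral_exp_mul_sq_sub_sq_le (by rw [hn]; linarith) (by simp)
    (Real.sqrt_nonneg _)).trans ?_
  rw [hn, div_eq_mul_one_div]
  have : (l : ℝ) ^ 2 ≤ (2 * π * |(l : ℝ)|) ^ 2 := by rw [← sq_abs]; gcongr
  have h5 : 0 < (l : ℝ) ^ 2 := by positivity
  gcongr

lemma summable_paraboloidFourier (x y : ℝ) : Summable fun l : ℤ => paraboloidFourier x l y := by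
  refine Summable.of_norm_bounded_eventually
    (((Real.summable_one_div_int_pow (p := 2)).mpr (by norm_num)).mul_left
      (4 * √(x - y ^ 2) + 4)) ?_
  filter_upwards [Set.Finite.compl_mem_cofinite (Set.finite_singleton (0 : ℤ))] with l hl
  exact norm_paraboloidFourier_le hl

lemma tsum_paraboloid_eq (x y : ℝ) :
    ∑' m : ℤ, (paraboloid x m y : ℂ) = ∑' l : ℤ, paraboloidFourier x l y :=
  tsum_eq_tsum_fourier_of_eq_zero (f := fun s => (paraboloid x s y : ℂ)) (K := √x)
    (by unfold paraboloid; fun_prop) (fun s hs => by simp [paraboloid_eq_zero_left hs])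
    (summable_paraboloidFourier x y)

/-- The radial profile of the Fourier transform of the truncated paraboloid, at a frequency
whose norm squared is `a`. -/
noncomputable def diskTransform (a x : ℝ) : ℝ :=
  ∫ u in (0 : ℝ)..x, 2 * u * discKernel (2 * π * √(a * u))

lemma hasCompactSupport_paraboloid_mul (x : ℝ) (g : ℝ × ℝ → ℂ) :
    HasCompactSupport fun p : ℝ × ℝ => g p * (paraboloid x p.1 p.2 : ℂ) := by
  refine HasCompactSupport.intro (K := Set.Icc (-√x) √x ×ˢ Set.Icc (-√x) √x)
    (isCompact_Icc.prod isCompact_Icc) fun p hp => ?_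
  have : √x < |p.1| ∨ √x < |p.2| := by
    by_contra! h
    exact hp ⟨abs_le.mp h.1, abs_le.mp h.2⟩
  rcases this with h | h
  · simp [paraboloid_eq_zero_left h]
  · simp [paraboloid_eq_zero_right h]

lemma integral_paraboloid_exp_rotate (x l j : ℝ) :
    ∫ w : ℂ, Complex.exp (((-2 * π * (w.re * l + w.im * j) : ℝ) : ℂ) * Complex.I) *
      (paraboloid x w.re w.im : ℂ) =
    ∫ w : ℂ, Complex.exp (((-2 * π * (w.re * √(l ^ 2 + j ^ 2)) : ℝ) : ℂ) * Complex.I) *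
      (paraboloid x w.re w.im : ℂ) := by
  set ξ : ℂ := l + j * Complex.I with hξ
  set c : Circle := Circle.exp ξ.arg with hcdef
  have hρ : √(l ^ 2 + j ^ 2) = ‖ξ‖ := by rw [hξ, Complex.norm_add_mul_I]
  have hc : (‖ξ‖ : ℂ) * c = ξ := by
    rw [hcdef, Circle.coe_exp]; exact Complex.norm_mul_exp_arg_mul_I ξ
  have h := (LinearIsometryEquiv.measurePreserving (rotation c)).integral_comp
    (rotation c).toHomeomorph.measurableEmbedding
    (fun w : ℂ => Complex.exp (((-2 * π * (w.re * l + w.im * j) : ℝ) : ℂ) * Complex.I) *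
      (paraboloid x w.re w.im : ℂ))
  rw [← h]
  refine MeasureTheory.integral_congr_ae (Eventually.of_forall fun w => ?_)
  have hn : (c : ℂ).re ^ 2 + (c : ℂ).im ^ 2 = 1 := by
    have := Circle.normSq_coe c
    rw [Complex.normSq_apply] at this
    linarith
  have hl : l = ‖ξ‖ * (c : ℂ).re := by
    have := congrArg Complex.re hc
    simpa [hξ] using this.symm
  have hj : j = ‖ξ‖ * (c : ℂ).im := by
    have := congrArg Complex.im hc
    simpa [hξ] using this.symm
  have h1 : ((rotation c w).re * l + (rotation c w).im * j) = w.re * ‖ξ‖ := by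
    rw [rotation_apply, Complex.mul_re, Complex.mul_im]
    rw [hl, hj]
    have e : ‖((‖ξ‖ * (c : ℂ).re : ℝ) : ℂ) + ((‖ξ‖ * (c : ℂ).im : ℝ) : ℂ) * Complex.I‖ = ‖ξ‖ := by
      rw [← hl, ← hj]
    clear_value ξ
    linear_combination (w.re * ‖ξ‖) * hn
  have h2 : (rotation c w).re ^ 2 + (rotation c w).im ^ 2 = w.re ^ 2 + w.im ^ 2 := by
    rw [rotation_apply, Complex.mul_re, Complex.mul_im]
    linear_combination (w.re ^ 2 + w.im ^ 2) * hn
  have h3 : paraboloid x (rotation c w).re (rotation c w).im = paraboloid x w.re w.im := by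
    unfold paraboloid
    rw [sub_sub, sub_sub, h2]
  simp only [h1, h3, hρ]

lemma integral_complex_eq_integral_integral {g : ℝ × ℝ → ℂ} (hg : Continuous g)
    (hs : HasCompactSupport g) :
    ∫ w : ℂ, g (w.re, w.im) = ∫ s : ℝ, ∫ y : ℝ, g (s, y) := by
  rw [← MeasureTheory.integral_prod (fun p : ℝ × ℝ => g p) (hg.integrable_of_hasCompactSupport hs)]
  exact Complex.volume_preserving_equiv_real_prod.integral_comp
    Complex.measurableEquivRealProd.measurableEmbedding g

lemma integral_max_sub_sq (x s : ℝ) (hx : 0 ≤ x) :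
    ∫ y : ℝ, paraboloid x s y = ∫ u in (0 : ℝ)..x, 2 * √(u - s ^ 2) := by
  rcases le_or_gt (x - s ^ 2) 0 with h | h
  · have h1 : ∀ y, paraboloid x s y = 0 := fun y =>
      paraboloid_eq_zero (by nlinarith [sq_nonneg y])
    simp only [h1, MeasureTheory.integral_zero]
    rw [intervalIntegral.integral_congr (g := fun _ => 0), intervalIntegral.integral_zero]
    intro u hu
    rw [Set.uIcc_of_le hx] at hu
    simp [Real.sqrt_eq_zero_of_nonpos (show u - s ^ 2 ≤ 0 by linarith [hu.2])]
  · set r := √(x - s ^ 2) with hr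
    have hr0 : 0 ≤ r := Real.sqrt_nonneg _
    have hr2 : r ^ 2 = x - s ^ 2 := Real.sq_sqrt h.le
    have h1 : ∫ y : ℝ, paraboloid x s y = ∫ y in (-r)..r, (r ^ 2 - y ^ 2) := by
      rw [intervalIntegral_eq_integral_of_eq_zero hr0]
      · refine intervalIntegral.integral_congr fun y hy => ?_
        rw [Set.uIcc_of_le (by linarith)] at hy
        have : y ^ 2 ≤ r ^ 2 := sq_le_sq' hy.1 hy.2
        simp only [paraboloid]
        rw [max_eq_left (by linarith), hr2]
      · intro y hy
        refine paraboloid_eq_zero ?_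
        have : r ^ 2 < y ^ 2 := by rw [← sq_abs y]; gcongr
        linarith
    have h2 : ∫ u in (0 : ℝ)..x, 2 * √(u - s ^ 2) = ∫ v in (0 : ℝ)..(x - s ^ 2), 2 * √v := by
      rw [intervalIntegral.integral_comp_sub_right (fun v => 2 * √v), zero_sub,
        ← intervalIntegral.integral_add_adjacent_intervals (b := 0)
          (Continuous.intervalIntegrable (by fun_prop) _ _)
          (Continuous.intervalIntegrable (by fun_prop) _ _),
        intervalIntegral.integral_congr (a := -s ^ 2) (g := fun _ => 0),
        intervalIntegral.integral_zero, zero_add]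
      intro v hv
      rw [Set.uIcc_of_le (by nlinarith [sq_nonneg s])] at hv
      simp [Real.sqrt_eq_zero_of_nonpos hv.2]
    rw [h1, h2, intervalIntegral.integral_const_mul]
    simp only [Real.sqrt_eq_rpow]
    rw [integral_rpow (Or.inl (by norm_num)), ← hr2, ← Real.rpow_natCast r 2, ← Real.rpow_mul hr0,
      Real.zero_rpow (by norm_num)]
    rw [intervalIntegral.integral_sub (by simp) (Continuous.intervalIntegrable (by fun_prop) _ _),
      integral_pow]
    norm_num
    rw [← Real.rpow_natCast r 3]
    simp only [← Real.rpow_natCast]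
    norm_num
    ring

lemma integral_sqrt_one_sub_sq_mul_exp (z : ℝ) :
    ∫ s in (-1 : ℝ)..1, Complex.exp (((-(z * s) : ℝ) : ℂ) * Complex.I) * (√(1 - s ^ 2) : ℂ) =
      discKernel z := by
  have hodd : ∫ s in (-1 : ℝ)..1, √(1 - s ^ 2) * Real.sin (z * s) = 0 := by
    have h := intervalIntegral.integral_comp_neg (a := -1) (b := 1)
      (fun s : ℝ => √(1 - s ^ 2) * Real.sin (z * s))
    simp only [neg_neg, even_two.neg_pow, mul_neg, Real.sin_neg,
      intervalIntegral.integral_neg] at h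
    linarith
  have h1 : ∀ s : ℝ, Complex.exp (((-(z * s) : ℝ) : ℂ) * Complex.I) * (√(1 - s ^ 2) : ℂ) =
      ((√(1 - s ^ 2) * Real.cos (z * s) : ℝ) : ℂ) -
        ((√(1 - s ^ 2) * Real.sin (z * s) : ℝ) : ℂ) * Complex.I := by
    intro s
    rw [Complex.exp_mul_I]
    push_cast
    rw [Complex.cos_neg, Complex.sin_neg]
    ring
  simp only [h1]
  rw [intervalIntegral.integral_sub (Continuous.intervalIntegrable (by fun_prop) _ _)
    (Continuous.intervalIntegrable (by fun_prop) _ _), intervalIntegral.integral_mul_const,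
    intervalIntegral.integral_ofReal, intervalIntegral.integral_ofReal, hodd, discKernel]
  simp

lemma integral_sqrt_sub_sq_mul_exp {u S : ℝ} (ρ : ℝ) (hu : 0 ≤ u) (hS : √u ≤ S) :
    ∫ s in (-S)..S, Complex.exp (((-2 * π * (s * ρ) : ℝ) : ℂ) * Complex.I) *
      ((2 * √(u - s ^ 2) : ℝ) : ℂ) = ((2 * u * discKernel (2 * π * (ρ * √u)) : ℝ) : ℂ) := by
  have h1 : ∫ s in (-S)..S, Complex.exp (((-2 * π * (s * ρ) : ℝ) : ℂ) * Complex.I) *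
      ((2 * √(u - s ^ 2) : ℝ) : ℂ) = ∫ s in (-√u)..√u,
      Complex.exp (((-2 * π * (s * ρ) : ℝ) : ℂ) * Complex.I) * ((2 * √(u - s ^ 2) : ℝ) : ℂ) := by
    have hz : ∀ s : ℝ, √u < |s| → Complex.exp (((-2 * π * (s * ρ) : ℝ) : ℂ) * Complex.I) *
        ((2 * √(u - s ^ 2) : ℝ) : ℂ) = 0 := by
      intro s hs
      have := (Real.sqrt_lt' (lt_of_le_of_lt (Real.sqrt_nonneg _) hs)).mp hs
      rw [sq_abs] at this
      simp [Real.sqrt_eq_zero_of_nonpos (show u - s ^ 2 ≤ 0 by linarith)]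
    rw [← intervalIntegral_eq_integral_of_eq_zero (Real.sqrt_nonneg u) hz,
      ← intervalIntegral_eq_integral_of_eq_zero ((Real.sqrt_nonneg u).trans hS)
        fun s hs => hz s (hS.trans_lt hs)]
  have h2 := intervalIntegral.smul_integral_comp_mul_left (a := -1) (b := 1) (c := √u)
    (f := fun s : ℝ => Complex.exp (((-2 * π * (s * ρ) : ℝ) : ℂ) * Complex.I) *
      ((2 * √(u - s ^ 2) : ℝ) : ℂ))
  rw [mul_neg, mul_one] at h2
  rw [h1, ← h2, Complex.real_smul]
  have h3 : ∀ s : ℝ, Complex.exp (((-2 * π * (√u * s * ρ) : ℝ) : ℂ) * Complex.I) *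
      ((2 * √(u - (√u * s) ^ 2) : ℝ) : ℂ) = (2 * √u : ℝ) *
        (Complex.exp (((-((2 * π * (ρ * √u)) * s) : ℝ) : ℂ) * Complex.I) *
          (√(1 - s ^ 2) : ℂ)) := by
    intro s
    have : √(u - (√u * s) ^ 2) = √u * √(1 - s ^ 2) := by
      rw [← Real.sqrt_mul hu, mul_pow, Real.sq_sqrt hu]; congr 1; ring
    rw [this]
    push_cast
    ring_nf
  simp only [h3]
  rw [intervalIntegral.integral_const_mul, integral_sqrt_one_sub_sq_mul_exp]
  push_cast
  have : (√u : ℂ) * √u = u := by rw [← Complex.ofReal_mul, Real.mul_self_sqrt hu]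
  linear_combination (2 * (discKernel (2 * π * (ρ * √u)) : ℂ)) * this

lemma fourier_paraboloidFourier {x : ℝ} (hx : 0 ≤ x) (l j : ℝ) :
    FourierTransform.fourier (paraboloidFourier x l) j = diskTransform (l ^ 2 + j ^ 2) x := by
  set ρ := √(l ^ 2 + j ^ 2) with hρ
  have h1 : FourierTransform.fourier (paraboloidFourier x l) j = ∫ y : ℝ, ∫ s : ℝ,
      Complex.exp (((-2 * π * (s * l + y * j) : ℝ) : ℂ) * Complex.I) * (paraboloid x s y : ℂ) := by
    simp only [paraboloidFourier, Real.fourier_real_eq_integral_exp_smul, smul_eq_mul]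
    refine MeasureTheory.integral_congr_ae (Eventually.of_forall fun y => ?_)
    simp only
    rw [← MeasureTheory.integral_const_mul]
    refine MeasureTheory.integral_congr_ae (Eventually.of_forall fun s => ?_)
    simp only
    rw [← mul_assoc, ← Complex.exp_add]
    congr 2
    push_cast
    ring
  have hcont : ∀ a b : ℝ, Continuous fun p : ℝ × ℝ =>
      Complex.exp (((-2 * π * (p.1 * a + p.2 * b) : ℝ) : ℂ) * Complex.I) *
        (paraboloid x p.1 p.2 : ℂ) := by
    intro a b; unfold paraboloid; fun_prop
  rw [h1, MeasureTheory.integral_integral_swap (f := fun y s : ℝ =>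
      Complex.exp (((-2 * π * (s * l + y * j) : ℝ) : ℂ) * Complex.I) * (paraboloid x s y : ℂ))
    (((hcont l j).integrable_of_hasCompactSupport (hasCompactSupport_paraboloid_mul x _)).swap),
    ← integral_complex_eq_integral_integral (hcont l j) (hasCompactSupport_paraboloid_mul x _)]
  simp only
  rw [integral_paraboloid_exp_rotate]
  have h2 := integral_complex_eq_integral_integral (hcont ρ 0)
    (hasCompactSupport_paraboloid_mul x _)
  simp only [mul_zero, add_zero] at h2
  rw [h2]
  have h3 : ∀ s : ℝ, ∫ y : ℝ, Complex.exp (((-2 * π * (s * ρ) : ℝ) : ℂ) * Complex.I) *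
      (paraboloid x s y : ℂ) = ∫ u in (0 : ℝ)..x,
        Complex.exp (((-2 * π * (s * ρ) : ℝ) : ℂ) * Complex.I) * ((2 * √(u - s ^ 2) : ℝ) : ℂ) := by
    intro s
    rw [MeasureTheory.integral_const_mul, integral_complex_ofReal, integral_max_sub_sq x s hx,
      ← intervalIntegral.integral_ofReal, ← intervalIntegral.integral_const_mul]
  simp only [h3]
  rw [intervalIntegral_eq_integral_of_eq_zero (S := √x) (Real.sqrt_nonneg _),
    MeasureTheory.intervalIntegral_intervalIntegral_swap]
  · rw [diskTransform, ← intervalIntegral.integral_ofReal]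
    refine intervalIntegral.integral_congr fun u hu => ?_
    rw [Set.uIcc_of_le hx] at hu
    rw [integral_sqrt_sub_sq_mul_exp ρ hu.1 (Real.sqrt_le_sqrt hu.2),
      Real.sqrt_mul (by positivity)]
  · refine MeasureTheory.IntegrableOn.mono_set (t := Set.uIcc (-√x) √x ×ˢ Set.uIcc 0 x)
      (ContinuousOn.integrableOn_compact (isCompact_uIcc.prod isCompact_uIcc) ?_)
      (Set.prod_mono Set.uIoc_subset_uIcc Set.uIoc_subset_uIcc)
    unfold Function.uncurry
    fun_prop
  · intro s hs
    rw [intervalIntegral.integral_congr (g := fun _ => 0), intervalIntegral.integral_zero]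
    intro u hu
    rw [Set.uIcc_of_le hx] at hu
    have := (Real.sqrt_lt' (lt_of_le_of_lt (Real.sqrt_nonneg _) hs)).mp hs
    rw [sq_abs] at this
    simp [Real.sqrt_eq_zero_of_nonpos (show u - s ^ 2 ≤ 0 by linarith [hu.2])]

/-- The quadratic form `x² + y²` with values in `ℕ`. -/
def sumSq (p : ℤ × ℤ) : ℕ := p.1.natAbs ^ 2 + p.2.natAbs ^ 2

lemma sumSq_cast_int (p : ℤ × ℤ) : (sumSq p : ℤ) = p.1 ^ 2 + p.2 ^ 2 := by
  simp [sumSq]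

lemma sumSq_cast_real (p : ℤ × ℤ) : (sumSq p : ℝ) = (p.1 : ℝ) ^ 2 + (p.2 : ℝ) ^ 2 := by
  exact_mod_cast congrArg (fun z : ℤ => (z : ℝ)) (sumSq_cast_int p)

lemma setOf_sumSq_le_finite (n : ℕ) : {p : ℤ × ℤ | sumSq p ≤ n}.Finite := by
  refine (squareBox n).finite_toSet.subset fun p hp => ?_
  have h1 : sumSq p ≤ n := hp
  have h2 := sumSq_cast_int p
  refine mem_squareBox_of_sq_add_sq_le ?_
  rw [← h2]
  have h3 : (sumSq p : ℤ) ≤ n := by exact_mod_cast h1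
  have h4 : (n : ℤ) ≤ (n : ℤ) ^ 2 := by exact_mod_cast Nat.le_self_pow two_ne_zero n
  linarith

lemma rTwoSquares_eq_ncard_sumSq (n : ℕ) : rTwoSquares n = Nat.card {p : ℤ × ℤ // sumSq p = n} := by
  rw [rTwoSquares, ← Nat.card_coe_set_eq]
  congr! 3 with p
  show p.1 ^ 2 + p.2 ^ 2 = (n : ℤ) ↔ _
  rw [← sumSq_cast_int]
  norm_cast

lemma hasSum_rTwoSquares_mul {g : ℕ → ℝ} (hg : Summable fun p : ℤ × ℤ => g (sumSq p)) :
    HasSum (fun n => (rTwoSquares n : ℝ) * g n) (∑' p : ℤ × ℤ, g (sumSq p)) := by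
  have h1 := (Equiv.sigmaFiberEquiv sumSq).hasSum_iff.mpr hg.hasSum
  refine h1.sigma fun n => ?_
  have : Finite {p : ℤ × ℤ // sumSq p = n} :=
    ((setOf_sumSq_le_finite n).subset fun p hp => le_of_eq hp).to_subtype
  have := Fintype.ofFinite {p : ℤ × ℤ // sumSq p = n}
  have h2 : ∑ c : {p : ℤ × ℤ // sumSq p = n},
      ((fun p => g (sumSq p)) ∘ Equiv.sigmaFiberEquiv sumSq) ⟨n, c⟩ = rTwoSquares n * g n := by
    rw [rTwoSquares_eq_ncard_sumSq, Nat.card_eq_fintype_card,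
      Finset.sum_congr rfl (g := fun _ => g n)]
    · simp
    · rintro ⟨p, hp⟩ -
      simp [hp]
  rw [← h2]
  exact hasSum_fintype _

lemma rTwoSquares_zero : rTwoSquares 0 = 1 := by
  rw [rTwoSquares_eq_ncard_sumSq, Nat.card_eq_one_iff_unique]
  refine ⟨⟨fun p q => ?_⟩, ⟨⟨(0, 0), rfl⟩⟩⟩
  have : ∀ p : {p : ℤ × ℤ // sumSq p = 0}, p = ⟨(0, 0), rfl⟩ := by
    rintro ⟨⟨a, b⟩, h⟩
    simp only [sumSq, Nat.add_eq_zero_iff] at h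
    simp at h
    simp [h.1, h.2]
  rw [this p, this q]

lemma summable_sumSq_rpow {s : ℝ} (hs : 1 < s) :
    Summable fun p : ℤ × ℤ => (sumSq p : ℝ) ^ (-s) := by
  have h := EisensteinSeries.summable_one_div_norm_rpow (k := 2 * s) (by linarith)
  rw [← (finTwoArrowEquiv ℤ).symm.summable_iff] at h
  refine Summable.of_nonneg_of_le (fun p => by positivity) (fun p => ?_) h
  simp only [Function.comp_def, finTwoArrowEquiv_symm_apply]
  set v : Fin 2 → ℤ := ![p.1, p.2] with hv
  have hle : ‖v‖ ^ 2 ≤ (sumSq p : ℝ) := by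
    rw [sumSq_cast_real]
    have h1 : ‖v‖ ≤ √((p.1 : ℝ) ^ 2 + (p.2 : ℝ) ^ 2) := by
      rw [pi_norm_le_iff_of_nonneg (Real.sqrt_nonneg _)]
      intro i
      fin_cases i
      · simpa [hv, Int.norm_eq_abs] using Real.abs_le_sqrt (by nlinarith [sq_nonneg (p.2 : ℝ)])
      · simpa [hv, Int.norm_eq_abs] using Real.abs_le_sqrt (by nlinarith [sq_nonneg (p.1 : ℝ)])
    calc _ ≤ _ := pow_le_pow_left₀ (norm_nonneg _) h1 2
      _ = _ := Real.sq_sqrt (by positivity)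
  rcases eq_or_ne v 0 with h0 | h0
  · have : sumSq p = 0 := by
      have h1 : p.1 = 0 := congrFun h0 0
      have h2 : p.2 = 0 := congrFun h0 1
      simp [sumSq, h1, h2]
    rw [this, Nat.cast_zero, Real.zero_rpow (by linarith)]
    positivity
  · have hpos : 0 < ‖v‖ := norm_pos_iff.mpr h0
    rw [show -(2 * s) = 2 * (-s) by ring, Real.rpow_mul hpos.le, Real.rpow_two]
    exact Real.rpow_le_rpow_of_nonpos (by positivity) hle (by linarith)

lemma summable_rTwoSquares_mul_rpow {s : ℝ} (hs : 1 < s) :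
    Summable fun n : ℕ => (rTwoSquares n : ℝ) * (n : ℝ) ^ (-s) :=
  (hasSum_rTwoSquares_mul (g := fun n : ℕ => (n : ℝ) ^ (-s)) (summable_sumSq_rpow hs)).summable

/-- A first derivative test with monotone amplitude. -/
lemma abs_integral_mul_cos_le {ψ ψ' : ℝ → ℝ} {a b μ : ℝ} (θ : ℝ) (hab : a ≤ b) (hμ : 0 < μ)
    (hd : ∀ v ∈ Set.Icc a b, HasDerivAt ψ (ψ' v) v) (hc : ContinuousOn ψ' (Set.Icc a b))
    (h0 : ∀ v ∈ Set.Icc a b, 0 ≤ ψ' v) :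
    |∫ v in a..b, ψ v * Real.cos (μ * v + θ)| ≤ (|ψ a| + |ψ b| + (ψ b - ψ a)) / μ := by
  have hu : Set.uIcc a b = Set.Icc a b := Set.uIcc_of_le hab
  have hi : IntervalIntegrable ψ' MeasureTheory.volume a b :=
    ContinuousOn.intervalIntegrable (by rwa [hu])
  have hs : ∀ v : ℝ, HasDerivAt (fun v => Real.sin (μ * v + θ) / μ) (Real.cos (μ * v + θ)) v := by
    intro v
    have := ((((hasDerivAt_id v).const_mul μ).add_const θ).sin).div_const μ
    refine this.congr_deriv ?_
    simp
    field_simp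
  have hp := intervalIntegral.integral_mul_deriv_eq_deriv_mul
    (u := ψ) (v := fun v => Real.sin (μ * v + θ) / μ) (u' := ψ')
    (v' := fun v => Real.cos (μ * v + θ)) (a := a) (b := b) (fun v hv => hd v (hu ▸ hv))
    (fun v _ => hs v) hi (Continuous.intervalIntegrable (by fun_prop) _ _)
  rw [hp]
  have hsl : ∀ v : ℝ, |Real.sin (μ * v + θ) / μ| ≤ 1 / μ := by
    intro v
    rw [abs_div, abs_of_pos hμ]
    gcongr
    exact Real.abs_sin_le_one _
  have h3 : |∫ v in a..b, ψ' v * (Real.sin (μ * v + θ) / μ)| ≤ (ψ b - ψ a) / μ := by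
    have h4 : ∫ v in a..b, ψ' v * (1 / μ) = (ψ b - ψ a) / μ := by
      rw [intervalIntegral.integral_mul_const,
        intervalIntegral.integral_eq_sub_of_hasDerivAt (f := ψ) (fun v hv => hd v (hu ▸ hv)) hi]
      ring
    rw [← h4, ← Real.norm_eq_abs]
    refine intervalIntegral.norm_integral_le_of_norm_le hab
      (Eventually.of_forall fun v hv => ?_) (hi.mul_const _)
    have hv' : v ∈ Set.Icc a b := ⟨hv.1.le, hv.2⟩
    rw [Real.norm_eq_abs, abs_mul, abs_of_nonneg (h0 v hv')]
    exact mul_le_mul_of_nonneg_left (hsl v) (h0 v hv')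
  have h1 : |ψ b * (Real.sin (μ * b + θ) / μ)| ≤ |ψ b| * (1 / μ) := by
    rw [abs_mul]; exact mul_le_mul_of_nonneg_left (hsl b) (abs_nonneg _)
  have h2 : |ψ a * (Real.sin (μ * a + θ) / μ)| ≤ |ψ a| * (1 / μ) := by
    rw [abs_mul]; exact mul_le_mul_of_nonneg_left (hsl a) (abs_nonneg _)
  have h5 : (|ψ a| + |ψ b| + (ψ b - ψ a)) / μ =
      |ψ a| * (1 / μ) + |ψ b| * (1 / μ) + (ψ b - ψ a) / μ := by ring
  rw [h5]
  rw [abs_le] at *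
  constructor <;> linarith [h1.1, h1.2, h2.1, h2.2, h3.1, h3.2]

lemma sin_sub_cos_eq (z : ℝ) :
    Real.sin z - Real.cos z = √2 * Real.cos (z + -(3 * π / 4)) := by
  rw [Real.cos_add, Real.cos_neg, Real.sin_neg, show 3 * π / 4 = π - π / 4 by ring,
    Real.cos_pi_sub, Real.sin_pi_sub, Real.cos_pi_div_four, Real.sin_pi_div_four]
  have : √2 * √2 = 2 := Real.mul_self_sqrt (by norm_num)
  linear_combination (-(Real.sin z - Real.cos z) / 2) * this

lemma two_mul_Gamma_five_half_le : 2 * Real.Gamma (5 / 2) ≤ 3 := by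
  rw [show (5 / 2 : ℝ) = 1 / 2 + 1 + 1 by norm_num, Real.Gamma_add_one (by norm_num),
    Real.Gamma_add_one (by norm_num), Real.Gamma_one_half_eq]
  have : √π ≤ 2 := Real.sqrt_le_iff.mpr ⟨by norm_num, by linarith [Real.pi_lt_four]⟩
  linarith

lemma mul_sqrt_mul_rpow {n v : ℝ} (hn : 0 ≤ n) (hv : 0 ≤ v) (q : ℝ) :
    (2 * π * √n * v) ^ q = (2 * π) ^ q * n ^ (q / 2) * v ^ q := by
  rw [Real.mul_rpow (by positivity) hv, Real.mul_rpow (by positivity) (by positivity),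
    Real.sqrt_eq_rpow, ← Real.rpow_mul hn]
  congr 3
  ring

lemma abs_pow_mul_discKernel_sub_le {n : ℝ} (hn : 0 < n) {v : ℝ} (hv : 0 < v) :
    |4 * v ^ 3 * discKernel (2 * π * √n * v) - 2 / π * n ^ (-(3 / 4) : ℝ) *
      (v ^ (3 / 2 : ℝ) * Real.cos (2 * π * √n * v + -(3 * π / 4)))| ≤
      3 * n ^ (-(5 / 4) : ℝ) * √v := by
  have hz : 0 < 2 * π * √n * v := by positivity
  have h := abs_discKernel_sub_le hz
  rw [sin_sub_cos_eq, mul_sqrt_mul_rpow hn.le hv.le, mul_sqrt_mul_rpow hn.le hv.le] at h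
  have h2 : 4 * v ^ 3 * (√π * ((2 * π) ^ (-(3 / 2) : ℝ) * n ^ (-(3 / 2) / 2 : ℝ) *
      v ^ (-(3 / 2) : ℝ)) * (√2 * Real.cos (2 * π * √n * v + -(3 * π / 4)))) =
      2 / π * n ^ (-(3 / 4) : ℝ) *
      (v ^ (3 / 2 : ℝ) * Real.cos (2 * π * √n * v + -(3 * π / 4))) := by
    have e1 : v ^ 3 * v ^ (-(3 / 2) : ℝ) = v ^ (3 / 2 : ℝ) := by
      rw [← Real.rpow_natCast, ← Real.rpow_add hv]; norm_num
    have e2 : 4 * √π * √2 * (2 * π) ^ (-(3 / 2) : ℝ) = 2 / π := by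
      have : (2 * π) ^ (3 / 2 : ℝ) = 2 * π * (√2 * √π) := by
        rw [← Real.sqrt_mul (by norm_num), show (3 / 2 : ℝ) = 1 + 1 / 2 by norm_num,
          Real.rpow_add (by positivity), Real.rpow_one, Real.sqrt_eq_rpow]
      rw [Real.rpow_neg (by positivity), this]
      have : 0 < √π := by positivity
      field_simp
      norm_num
    rw [show (-(3 / 2) / 2 : ℝ) = -(3 / 4) by norm_num, ← e1, ← e2]
    ring
  rw [← h2, ← mul_sub, abs_mul, abs_of_pos (by positivity)]
  refine (mul_le_mul_of_nonneg_left h (by positivity)).trans ?_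
  have e3 : v ^ 3 * v ^ (-(5 / 2) : ℝ) = √v := by
    rw [← Real.rpow_natCast, ← Real.rpow_add hv, Real.sqrt_eq_rpow]; norm_num
  have e4 : 4 * (2 * π) ^ (-(5 / 2) : ℝ) ≤ 1 := by
    rw [Real.rpow_neg (by positivity), ← div_eq_mul_inv, div_le_one (by positivity)]
    have hpi := Real.pi_gt_three
    calc (4 : ℝ) ≤ (2 * π) ^ (2 : ℝ) := by rw [Real.rpow_two]; nlinarith
      _ ≤ _ := Real.rpow_le_rpow_of_exponent_le (by linarith) (by norm_num)
  have hG := two_mul_Gamma_five_half_le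
  have hG0 : 0 < Real.Gamma (5 / 2) := Real.Gamma_pos_of_pos (by norm_num)
  rw [show (-(5 / 2) / 2 : ℝ) = -(5 / 4) by norm_num, ← e3]
  have h5 : 4 * (2 * π) ^ (-(5 / 2) : ℝ) * (2 * Real.Gamma (5 / 2)) ≤ 1 * 3 :=
    mul_le_mul e4 hG (by positivity) (by norm_num)
  have h6 : 0 ≤ n ^ (-(5 / 4) : ℝ) * (v ^ 3 * v ^ (-(5 / 2) : ℝ)) := by positivity
  nlinarith

lemma continuous_diskTransform_integrand (a : ℝ) :
    Continuous fun u : ℝ => 2 * u * discKernel (2 * π * √(a * u)) := by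
  have := continuous_discKernel
  fun_prop

lemma diskTransform_sub_eq {n : ℝ} (hn : 0 ≤ n) {t t' : ℝ} (ht : 0 ≤ t) (htt : t ≤ t') :
    diskTransform n (t' ^ 2) - diskTransform n (t ^ 2) =
      ∫ v in t..t', 4 * v ^ 3 * discKernel (2 * π * √n * v) := by
  have hc := continuous_diskTransform_integrand n
  rw [diskTransform, diskTransform, intervalIntegral.integral_interval_sub_left
    (hc.intervalIntegrable _ _) (hc.intervalIntegrable _ _)]
  rw [← intervalIntegral.integral_comp_mul_deriv (f := fun v : ℝ => v ^ 2)
    (f' := fun v => 2 * v) (g := fun u : ℝ => 2 * u * discKernel (2 * π * √(n * u)))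
    (fun v _ => by simpa using hasDerivAt_pow 2 v) (by fun_prop) hc]
  refine intervalIntegral.integral_congr fun v hv => ?_
  rw [Set.uIcc_of_le htt] at hv
  simp only [Function.comp_apply]
  rw [Real.sqrt_mul hn, Real.sqrt_sq (ht.trans hv.1)]
  ring_nf

lemma abs_diskTransform_sub_main_le {n : ℝ} (hn : 0 < n) {t t' : ℝ} (ht : 0 ≤ t) (htt : t ≤ t') :
    |diskTransform n (t' ^ 2) - diskTransform n (t ^ 2) - 2 / π * n ^ (-(3 / 4) : ℝ) *
      ∫ v in t..t', v ^ (3 / 2 : ℝ) * Real.cos (2 * π * √n * v + -(3 * π / 4))| ≤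
      3 * n ^ (-(5 / 4) : ℝ) * √t' * (t' - t) := by
  have hc := continuous_discKernel
  rw [diskTransform_sub_eq hn.le ht htt, ← intervalIntegral.integral_const_mul,
    ← intervalIntegral.integral_sub (Continuous.intervalIntegrable (by fun_prop) _ _)
      (Continuous.intervalIntegrable (by fun_prop (disch := norm_num)) _ _), ← Real.norm_eq_abs,
    ← abs_of_nonneg (sub_nonneg.mpr htt)]
  refine intervalIntegral.norm_integral_le_of_norm_le_const fun v hv => ?_
  rw [Set.uIoc_of_le htt] at hv
  refine (abs_pow_mul_discKernel_sub_le hn (ht.trans_lt hv.1)).trans ?_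
  have := Real.sqrt_le_sqrt hv.2
  gcongr

lemma abs_integral_rpow_mul_cos_le {n : ℝ} (hn : 0 < n) {t t' : ℝ} (ht : 0 ≤ t) (htt : t ≤ t')
    {κ : ℝ} (h1 : t ^ (3 / 2 : ℝ) ≤ κ) (h2 : κ ≤ t' ^ (3 / 2 : ℝ)) :
    |∫ v in t..t', (v ^ (3 / 2 : ℝ) - κ) * Real.cos (2 * π * √n * v + -(3 * π / 4))| ≤
      (t' ^ (3 / 2 : ℝ) - t ^ (3 / 2 : ℝ)) / √n := by
  refine (abs_integral_mul_cos_le (ψ := fun v => v ^ (3 / 2 : ℝ) - κ)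
    (ψ' := fun v => 3 / 2 * v ^ (3 / 2 - 1 : ℝ)) _ htt (by positivity) (fun v _ =>
      (Real.hasDerivAt_rpow_const (Or.inr (by norm_num))).sub_const κ)
    (Continuous.continuousOn (by fun_prop (disch := norm_num)))
    fun v hv => mul_nonneg (by norm_num) (Real.rpow_nonneg (ht.trans hv.1) _)).trans ?_
  rw [abs_of_nonpos (sub_nonpos.mpr h1), abs_of_nonneg (sub_nonneg.mpr h2), div_le_div_iff₀
    (by positivity) (by positivity)]
  have hpi := Real.pi_gt_three
  have h3 : 0 ≤ (t' ^ (3 / 2 : ℝ) - t ^ (3 / 2 : ℝ)) * √n :=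
    mul_nonneg (by linarith) (Real.sqrt_nonneg _)
  nlinarith

lemma abs_diskTransform_sub_le {n : ℝ} (hn : 0 < n) {t t' : ℝ} (ht : 0 ≤ t) (htt : t ≤ t') :
    |diskTransform n (t' ^ 2) - diskTransform n (t ^ 2)| ≤
      n ^ (-(5 / 4) : ℝ) * (2 * t' ^ (3 / 2 : ℝ) + 3 * √t' * (t' - t)) := by
  have h1 := abs_diskTransform_sub_main_le hn ht htt
  have hpi := Real.pi_gt_three
  have h2 : |∫ v in t..t', v ^ (3 / 2 : ℝ) * Real.cos (2 * π * √n * v + -(3 * π / 4))| ≤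
      2 * t' ^ (3 / 2 : ℝ) / √n := by
    have h3 := abs_integral_mul_cos_le (ψ := fun v => v ^ (3 / 2 : ℝ))
      (ψ' := fun v => 3 / 2 * v ^ (3 / 2 - 1 : ℝ)) (μ := 2 * π * √n) (-(3 * π / 4)) htt
      (by positivity) (fun v _ => Real.hasDerivAt_rpow_const (Or.inr (by norm_num)))
      (Continuous.continuousOn (by fun_prop (disch := norm_num)))
      fun v hv => mul_nonneg (by norm_num) (Real.rpow_nonneg (ht.trans hv.1) _)
    refine h3.trans ?_
    have h4 : 0 ≤ t' ^ (3 / 2 : ℝ) := Real.rpow_nonneg (ht.trans htt) _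
    have h5 : 0 ≤ t ^ (3 / 2 : ℝ) := Real.rpow_nonneg ht _
    rw [abs_of_nonneg h5, abs_of_nonneg h4, div_le_div_iff₀ (by positivity) (by positivity)]
    have h6 : 0 ≤ t' ^ (3 / 2 : ℝ) * √n := by positivity
    nlinarith
  have h7 : |2 / π * n ^ (-(3 / 4) : ℝ) *
      ∫ v in t..t', v ^ (3 / 2 : ℝ) * Real.cos (2 * π * √n * v + -(3 * π / 4))| ≤
      n ^ (-(5 / 4) : ℝ) * (2 * t' ^ (3 / 2 : ℝ)) := by
    rw [abs_mul, abs_of_pos (by positivity)]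
    have h8 : 2 / π ≤ 1 := by rw [div_le_one (by positivity)]; linarith
    have h9 : n ^ (-(5 / 4) : ℝ) = n ^ (-(3 / 4) : ℝ) / √n := by
      rw [Real.sqrt_eq_rpow, ← Real.rpow_sub hn]; norm_num
    have h4 : 0 ≤ t' ^ (3 / 2 : ℝ) := Real.rpow_nonneg (ht.trans htt) _
    calc _ ≤ 1 * n ^ (-(3 / 4) : ℝ) * (2 * t' ^ (3 / 2 : ℝ) / √n) := by gcongr
      _ = _ := by rw [h9]; ring
  rw [abs_le] at *
  constructor <;> linarith [h1.1, h1.2, h7.1, h7.2]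

lemma setOf_sq_add_sq_le_eq (x : ℝ) :
    {p : ℤ × ℤ | (p.1 : ℝ) ^ 2 + (p.2 : ℝ) ^ 2 ≤ x} = {p | (sumSq p : ℝ) ≤ x} := by
  ext p
  simp only [Set.mem_ofPred_eq, sumSq_cast_real]

lemma setOf_sumSq_le_real_finite (x : ℝ) : {p : ℤ × ℤ | (sumSq p : ℝ) ≤ x}.Finite :=
  (setOf_sumSq_le_finite ⌊x⌋₊).subset fun _ hp => Nat.le_floor hp

lemma latticeA_mono : Monotone latticeA := by
  intro x y hxy
  rw [latticeA, latticeA, setOf_sq_add_sq_le_eq, setOf_sq_add_sq_le_eq]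
  exact Set.ncard_le_ncard (fun p hp => le_trans (show (sumSq p : ℝ) ≤ x from hp) hxy)
    (setOf_sumSq_le_real_finite y)

lemma intervalIntegrable_latticeA (a b : ℝ) :
    IntervalIntegrable (fun x => (latticeA x : ℝ)) MeasureTheory.volume a b :=
  Monotone.intervalIntegrable fun _ _ h => Nat.cast_le.mpr (latticeA_mono h)

lemma intervalIntegrable_latticeP (a b : ℝ) :
    IntervalIntegrable latticeP MeasureTheory.volume a b :=
  (intervalIntegrable_latticeA a b).sub (Continuous.intervalIntegrable (by fun_prop) _ _)

lemma mem_squareBox_of_sumSq_le {W : ℕ} {p : ℤ × ℤ} (h : (sumSq p : ℝ) ≤ (W : ℝ) ^ 2) :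
    p ∈ squareBox W := by
  refine mem_squareBox_of_sq_add_sq_le ?_
  rw [← sumSq_cast_int]
  exact_mod_cast h

lemma latticeA_eq_sum {W : ℕ} {u : ℝ} (h : u ≤ (W : ℝ) ^ 2) :
    (latticeA u : ℝ) = ∑ p ∈ squareBox W, if (sumSq p : ℝ) ≤ u then 1 else 0 := by
  rw [← Finset.sum_filter, Finset.sum_const, nsmul_eq_mul, mul_one, latticeA,
    setOf_sq_add_sq_le_eq, ← Set.ncard_coe_finset]
  congr 2
  ext p
  simp only [Set.mem_ofPred_eq, Finset.coe_filter]
  exact ⟨fun hp => ⟨mem_squareBox_of_sumSq_le (hp.trans h), hp⟩, fun hp => hp.2⟩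

lemma monotone_ite_le (c : ℝ) : Monotone fun u : ℝ => if c ≤ u then (1 : ℝ) else 0 := by
  intro u v h
  dsimp only
  split_ifs with h1 h2
  · rfl
  · exact absurd (h1.trans h) h2
  · norm_num
  · rfl

lemma integral_ite_le {c : ℝ} (hc : 0 ≤ c) (x : ℝ) :
    ∫ u in (0 : ℝ)..x, (if c ≤ u then (1 : ℝ) else 0) = max (x - c) 0 := by
  have h := MeasureTheory.integral_eq_of_hasDerivAt_off_countable (a := 0) (b := x)
    (fun u => max (u - c) 0)
    (fun u : ℝ => if c ≤ u then (1 : ℝ) else 0) (Set.countable_singleton c)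
    (Continuous.continuousOn (by fun_prop)) ?_ (monotone_ite_le c).intervalIntegrable
  · rw [h, max_eq_right (a := 0 - c) (by linarith), sub_zero]
  · rintro u ⟨-, hu⟩
    rcases lt_or_gt_of_ne hu with h | h
    · rw [if_neg (not_le.mpr h)]
      refine (hasDerivAt_const u (0 : ℝ)).congr_of_eventuallyEq ?_
      filter_upwards [eventually_lt_nhds h] with v hv
      exact max_eq_right (by linarith)
    · rw [if_pos h.le]
      refine ((hasDerivAt_id u).sub_const c).congr_of_eventuallyEq ?_
      filter_upwards [eventually_gt_nhds h] with v hv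
      exact max_eq_left (by linarith)

lemma integral_latticeA_eq {W : ℕ} {x : ℝ} (hx : 0 ≤ x) (h : x ≤ (W : ℝ) ^ 2) :
    ∫ u in (0 : ℝ)..x, (latticeA u : ℝ) = ∑ p ∈ squareBox W, paraboloid x p.1 p.2 := by
  have h1 : ∫ u in (0 : ℝ)..x, (latticeA u : ℝ) =
      ∫ u in (0 : ℝ)..x, ∑ p ∈ squareBox W, if (sumSq p : ℝ) ≤ u then (1 : ℝ) else 0 := by
    refine intervalIntegral.integral_congr fun u hu => ?_
    rw [Set.uIcc_of_le hx] at hu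
    exact latticeA_eq_sum (hu.2.trans h)
  rw [h1, intervalIntegral.integral_finsetSum
    fun p _ => (monotone_ite_le (sumSq p : ℝ)).intervalIntegrable]
  refine Finset.sum_congr rfl fun p _ => ?_
  rw [integral_ite_le (Nat.cast_nonneg _), sumSq_cast_real, paraboloid, sub_sub]

lemma abs_diskTransform_le {n : ℕ} (hn : 1 ≤ n) {x : ℝ} (hx : 0 ≤ x) :
    |diskTransform n x| ≤
      (n : ℝ) ^ (-(5 / 4) : ℝ) * (2 * √x ^ (3 / 2 : ℝ) + 3 * √(√x) * √x) := by
  have h := abs_diskTransform_sub_le (n := n) (by exact_mod_cast hn) le_rfl (Real.sqrt_nonneg x)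
  rw [Real.sq_sqrt hx, sub_zero] at h
  simpa [diskTransform] using h

lemma summable_diskTransform {x : ℝ} (hx : 0 ≤ x) :
    Summable fun p : ℤ × ℤ => diskTransform (sumSq p : ℝ) x := by
  refine Summable.of_norm_bounded_eventually ((summable_sumSq_rpow (s := 5 / 4)
    (by norm_num)).mul_right (2 * √x ^ (3 / 2 : ℝ) + 3 * √(√x) * √x)) ?_
  filter_upwards [Set.Finite.compl_mem_cofinite (Set.finite_singleton (0 : ℤ × ℤ))] with p hp
  refine abs_diskTransform_le ?_ hx
  by_contra h0
  refine hp ?_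
  have : sumSq p = 0 := by omega
  simp [sumSq] at this
  exact Prod.ext this.1 this.2

lemma tsum_paraboloidFourier_eq {x : ℝ} (hx : 0 ≤ x) (l : ℤ) :
    ∑' k : ℤ, paraboloidFourier x l k = ∑' j : ℤ, (diskTransform (sumSq (l, j)) x : ℂ) := by
  have h1 : ∀ j : ℤ, FourierTransform.fourier (paraboloidFourier x l) (j : ℝ) =
      (diskTransform (sumSq (l, j)) x : ℂ) := fun j => by
    rw [fourier_paraboloidFourier hx, sumSq_cast_real]
  rw [tsum_eq_tsum_fourier_of_eq_zero (continuous_paraboloidFourier x l) (K := √x)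
    fun y hy => paraboloidFourier_eq_zero hy]
  · simp only [h1]
  · simp only [h1]
    have := (summable_diskTransform hx).comp_injective (Prod.mk_right_injective l)
    exact Complex.ofRealCLM.summable this

lemma sqrt_lt_abs_of_notMem {W : ℕ} {x : ℝ} (h : x ≤ (W : ℝ) ^ 2) {k : ℤ}
    (hk : k ∉ Finset.Icc (-(W : ℤ)) W) : √x < |(k : ℝ)| := by
  have h1 : (W : ℤ) < |k| := by
    by_contra! h2
    exact hk (Finset.mem_Icc.mpr (abs_le.mp h2))
  have h2 : (W : ℝ) < |(k : ℝ)| := by exact_mod_cast h1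
  exact (Real.sqrt_le_iff.mpr ⟨Nat.cast_nonneg _, h⟩).trans_lt h2

lemma integral_latticeA_eq_tsum {x : ℝ} (hx : 0 ≤ x) :
    ∫ u in (0 : ℝ)..x, (latticeA u : ℝ) = ∑' p : ℤ × ℤ, diskTransform (sumSq p) x := by
  obtain ⟨W, hW⟩ : ∃ W : ℕ, x ≤ (W : ℝ) ^ 2 := by
    obtain ⟨W, hW⟩ := exists_nat_ge x
    refine ⟨W + 1, ?_⟩
    push_cast
    nlinarith [(Nat.cast_nonneg W : (0 : ℝ) ≤ W)]
  set B := Finset.Icc (-(W : ℤ)) W with hB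
  rw [← Complex.ofReal_inj, integral_latticeA_eq hx hW, squareBox, Finset.sum_product_right]
  push_cast
  calc ∑ k ∈ B, ∑ m ∈ B, (paraboloid x m k : ℂ)
      = ∑ k ∈ B, ∑' m : ℤ, (paraboloid x m k : ℂ) := by
        refine Finset.sum_congr rfl fun k _ => (tsum_eq_sum fun m hm => ?_).symm
        rw [paraboloid_eq_zero_left (sqrt_lt_abs_of_notMem hW hm), Complex.ofReal_zero]
    _ = ∑ k ∈ B, ∑' l : ℤ, paraboloidFourier x l k :=
        Finset.sum_congr rfl fun k _ => tsum_paraboloid_eq x k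
    _ = ∑' l : ℤ, ∑ k ∈ B, paraboloidFourier x l k :=
        (Summable.tsum_finsetSum fun (k : ℤ) _ => summable_paraboloidFourier x k).symm
    _ = ∑' l : ℤ, ∑' k : ℤ, paraboloidFourier x l k := by
        refine tsum_congr fun l => (tsum_eq_sum fun k hk => ?_).symm
        exact paraboloidFourier_eq_zero (sqrt_lt_abs_of_notMem hW hk)
    _ = ∑' l : ℤ, ∑' j : ℤ, (diskTransform (sumSq (l, j)) x : ℂ) :=
        tsum_congr fun l => tsum_paraboloidFourier_eq hx l
    _ = ∑' p : ℤ × ℤ, (diskTransform (sumSq p) x : ℂ) :=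
        (Summable.tsum_prod (Complex.ofRealCLM.summable (summable_diskTransform hx))).symm

lemma diskTransform_zero (x : ℝ) : diskTransform 0 x = π * x ^ 2 / 2 := by
  simp only [diskTransform, zero_mul, Real.sqrt_zero, mul_zero, discKernel_zero]
  rw [intervalIntegral.integral_mul_const, intervalIntegral.integral_const_mul, integral_id]
  ring

/-- The integrated Hardy–Landau formula for the lattice point discrepancy. -/
lemma hasSum_integral_latticeP {x : ℝ} (hx : 0 ≤ x) :
    HasSum (fun n : ℕ => (rTwoSquares (n + 1) : ℝ) * diskTransform ((n + 1 : ℕ) : ℝ) x)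
      (∫ u in (0 : ℝ)..x, latticeP u) := by
  have h := hasSum_rTwoSquares_mul (g := fun n => diskTransform n x) (summable_diskTransform hx)
  rw [← integral_latticeA_eq_tsum hx] at h
  have h1 : ∫ u in (0 : ℝ)..x, latticeP u = (∫ u in (0 : ℝ)..x, (latticeA u : ℝ)) -
      (rTwoSquares 0 : ℝ) * diskTransform (0 : ℕ) x := by
    unfold latticeP
    rw [intervalIntegral.integral_sub (intervalIntegrable_latticeA _ _)
      (Continuous.intervalIntegrable (by fun_prop) _ _), intervalIntegral.integral_const_mul,
      integral_id, rTwoSquares_zero, Nat.cast_zero, diskTransform_zero]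
    push_cast
    ring
  rw [h1]
  simpa using (hasSum_nat_add_iff' 1).mpr h

lemma integral_cos_eq_sinc {μ : ℝ} (hμ : 0 < μ) {δ : ℝ} (hδ : 0 < δ) (t θ : ℝ) :
    ∫ v in t..(t + δ), Real.cos (μ * v + θ) =
      δ * (Real.sinc (μ * δ / 2) * Real.cos (μ * (t + δ / 2) + θ)) := by
  rw [intervalIntegral.integral_comp_mul_add Real.cos hμ.ne', integral_cos, Real.sin_sub_sin,
    Real.sinc_of_ne_zero (by positivity), smul_eq_mul]
  rw [show (μ * (t + δ) + θ - (μ * t + θ)) / 2 = μ * δ / 2 by ring,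
    show (μ * (t + δ) + θ + (μ * t + θ)) / 2 = μ * (t + δ / 2) + θ by ring]
  field_simp

lemma rpow_three_half_eq {t : ℝ} (ht : 0 ≤ t) : t ^ (3 / 2 : ℝ) = t * √t := by
  rcases ht.eq_or_lt with rfl | ht
  · simp [Real.zero_rpow]
  · rw [Real.sqrt_eq_rpow, ← Real.rpow_one_add' ht.le (by norm_num)]; norm_num

lemma sqrt_add_le {t δ : ℝ} (ht : 1 ≤ t) (hδ1 : δ ≤ 1) : √(t + δ) ≤ 3 / 2 * √t := by
  rw [Real.sqrt_le_left (by positivity), mul_pow, Real.sq_sqrt (by linarith)]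
  linarith

lemma rpow_three_half_sub_le {t δ : ℝ} (ht : 0 < t) (hδ : 0 ≤ δ) (hδt : δ ≤ t) :
    (t + δ) ^ (3 / 2 : ℝ) - t ^ (3 / 2 : ℝ) ≤ 2 * δ * √t := by
  have hs0 : 0 < √t := by positivity
  have hss : √t * √t = t := Real.mul_self_sqrt ht.le
  have hs1 : √t ≤ √(t + δ) := Real.sqrt_le_sqrt (by linarith)
  have hsd : √(t + δ) * √(t + δ) = t + δ := Real.mul_self_sqrt (by linarith)
  rw [rpow_three_half_eq (by linarith), rpow_three_half_eq ht.le]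
  generalize √(t + δ) = b at *
  rw [← hsd]
  generalize √t = a at *
  obtain rfl : t = a * a := hss.symm
  obtain rfl : δ = b * b - a * a := by linarith
  have h : b ≤ 3 / 2 * a := by nlinarith
  obtain ⟨e, rfl⟩ : ∃ e, b = a + e := ⟨b - a, by ring⟩
  have he : 0 ≤ e := by linarith
  have h2 : 0 ≤ a - 2 * e := by linarith
  nlinarith [mul_nonneg he (mul_nonneg h2 hs0.le), mul_nonneg he (mul_nonneg h2 he),
    mul_nonneg he (sq_nonneg a)]

/-- One term of the smoothed Hardy–Landau series, compared with a pure oscillation. -/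
lemma abs_diskTransform_div_sub_le {n : ℝ} (hn : 0 < n) {t δ : ℝ} (ht : 1 ≤ t) (hδ : 0 < δ)
    (hδ1 : δ ≤ 1) :
    |(diskTransform n ((t + δ) ^ 2) - diskTransform n (t ^ 2)) / ((t + δ) ^ 2 - t ^ 2) -
      √t * (1 / π * n ^ (-(3 / 4) : ℝ) * Real.sinc (π * √n * δ) *
        Real.cos (2 * π * √n * (t + δ / 2) + -(3 * π / 4)))| ≤
      4 * n ^ (-(5 / 4) : ℝ) / √t := by
  have hpi := Real.pi_gt_three
  have ht0 : 0 < t := by linarith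
  set μ := 2 * π * √n with hμ
  have hμ0 : 0 < μ := by positivity
  have hs0 : 0 < √t := by positivity
  have hss : √t * √t = t := Real.mul_self_sqrt ht0.le
  set κ := √t * (t + δ / 2) with hκ
  set O := Real.sinc (π * √n * δ) * Real.cos (μ * (t + δ / 2) + -(3 * π / 4)) with hO
  have h1 := abs_diskTransform_sub_main_le hn ht0.le (by linarith : t ≤ t + δ)
  have hs1 : √t ≤ √(t + δ) := Real.sqrt_le_sqrt (by linarith)
  have hsd : √(t + δ) * √(t + δ) = t + δ := Real.mul_self_sqrt (by linarith)
  have h2 := abs_integral_rpow_mul_cos_le hn ht0.le (by linarith : t ≤ t + δ) (κ := κ)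
    (by rw [rpow_three_half_eq ht0.le, hκ]; nlinarith)
    (by rw [rpow_three_half_eq (by linarith), hκ]; nlinarith)
  have h3 : ∫ v in t..(t + δ), v ^ (3 / 2 : ℝ) * Real.cos (μ * v + -(3 * π / 4)) =
      (∫ v in t..(t + δ), (v ^ (3 / 2 : ℝ) - κ) * Real.cos (μ * v + -(3 * π / 4))) +
        κ * (δ * O) := by
    have e := integral_cos_eq_sinc hμ0 hδ t (-(3 * π / 4))
    rw [show μ * δ / 2 = π * √n * δ by rw [hμ]; ring, ← hO] at e
    rw [← e, ← intervalIntegral.integral_const_mul, ← intervalIntegral.integral_add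
      (Continuous.intervalIntegrable (by fun_prop (disch := norm_num)) _ _)
      (Continuous.intervalIntegrable (by fun_prop) _ _)]
    congr 1
    ext v
    ring
  have h4 := rpow_three_half_sub_le ht0 hδ.le (hδ1.trans ht)
  set Q := n ^ (-(5 / 4) : ℝ) with hQ
  have hQ0 : 0 < Q := by positivity
  have h9 : n ^ (-(3 / 4) : ℝ) = Q * √n := by
    rw [hQ, Real.sqrt_eq_rpow, ← Real.rpow_add hn]; norm_num
  have h5 : |2 / π * n ^ (-(3 / 4) : ℝ) *
      ∫ v in t..(t + δ), (v ^ (3 / 2 : ℝ) - κ) * Real.cos (μ * v + -(3 * π / 4))| ≤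
      Q * (2 * δ * √t) := by
    rw [abs_mul, abs_of_pos (by positivity), h9]
    have h8 : 2 / π ≤ 1 := by rw [div_le_one (by positivity)]; linarith
    calc _ ≤ 1 * (Q * √n) * (2 * δ * √t / √n) := by
          gcongr
          exact h2.trans (by gcongr)
      _ = _ := by field_simp
  have h6 : |diskTransform n ((t + δ) ^ 2) - diskTransform n (t ^ 2) -
      2 / π * n ^ (-(3 / 4) : ℝ) * (κ * (δ * O))| ≤ 8 * Q * δ * √t := by
    have h7 : 3 * Q * √(t + δ) * (t + δ - t) ≤ 3 * Q * (3 / 2 * √t) * δ := by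
      rw [add_sub_cancel_left]
      gcongr
      exact sqrt_add_le ht hδ1
    have h8 : 0 ≤ Q * δ * √t := by positivity
    rw [h3, mul_add, ← sub_sub, sub_right_comm] at h1
    have h11 := (abs_sub_abs_le_abs_sub _ _).trans (h1.trans h7)
    linarith
  have hω : (t + δ) ^ 2 - t ^ 2 = 2 * δ * (t + δ / 2) := by ring
  have hω0 : 0 < 2 * δ * (t + δ / 2) := by positivity
  have h10 : (diskTransform n ((t + δ) ^ 2) - diskTransform n (t ^ 2)) / ((t + δ) ^ 2 - t ^ 2) -
      √t * (1 / π * n ^ (-(3 / 4) : ℝ) * Real.sinc (π * √n * δ) *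
        Real.cos (μ * (t + δ / 2) + -(3 * π / 4))) =
      (diskTransform n ((t + δ) ^ 2) - diskTransform n (t ^ 2) -
      2 / π * n ^ (-(3 / 4) : ℝ) * (κ * (δ * O))) / (2 * δ * (t + δ / 2)) := by
    rw [hω, hκ, hO]
    field_simp
  rw [h10, abs_div, abs_of_pos hω0, div_le_div_iff₀ hω0 hs0]
  calc _ ≤ 8 * Q * δ * √t * √t := by gcongr
    _ = 4 * Q * (2 * δ * t) := by rw [mul_assoc _ (√t), hss]; ring
    _ ≤ _ := by gcongr; linarith

lemma abs_diskTransform_div_le {n : ℝ} (hn : 0 < n) {t δ : ℝ} (ht : 1 ≤ t) (hδ : 0 < δ)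
    (hδ1 : δ ≤ 1) :
    |(diskTransform n ((t + δ) ^ 2) - diskTransform n (t ^ 2)) / ((t + δ) ^ 2 - t ^ 2)| ≤
      6 * √t / δ * n ^ (-(5 / 4) : ℝ) := by
  have ht0 : 0 < t := by linarith
  have h := abs_diskTransform_sub_le hn ht0.le (by linarith : t ≤ t + δ)
  have hω : (t + δ) ^ 2 - t ^ 2 = 2 * δ * (t + δ / 2) := by ring
  have hω0 : 0 < 2 * δ * (t + δ / 2) := by positivity
  have hs := sqrt_add_le ht hδ1
  have hs0 : 0 < √t := by positivity
  rw [abs_div, hω, abs_of_pos hω0, div_le_iff₀ hω0]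
  refine h.trans ?_
  rw [rpow_three_half_eq (by linarith), add_sub_cancel_left]
  have h1 : 2 * ((t + δ) * √(t + δ)) + 3 * √(t + δ) * δ ≤ 12 * √t * t := by
    calc _ ≤ 2 * ((t + δ) * (3 / 2 * √t)) + 3 * (3 / 2 * √t) * δ := by gcongr
      _ ≤ _ := by nlinarith
  calc _ ≤ n ^ (-(5 / 4) : ℝ) * (12 * √t * t) := by gcongr
    _ = 6 * √t / δ * n ^ (-(5 / 4) : ℝ) * (2 * δ * t) := by field_simp; ring
    _ ≤ _ := by gcongr; linarith

/-- The amplitudes of the trigonometric polynomial approximating the discrepancy. -/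
noncomputable def waveCoeff (δ : ℝ) (n : ℕ) : ℝ :=
  1 / π * rTwoSquares n * (n : ℝ) ^ (-(3 / 4) : ℝ) * Real.sinc (π * √n * δ)

/-- The trigonometric polynomial approximating the normalized discrepancy. -/
noncomputable def waveSum (δ : ℝ) (M : ℕ) (t : ℝ) : ℝ :=
  ∑ n ∈ Finset.Ico 1 M, waveCoeff δ n * Real.cos (2 * π * √n * t + -(3 * π / 4))

lemma hasSum_integral_latticeP_sub {a b : ℝ} (ha : 0 ≤ a) (hb : 0 ≤ b) :
    HasSum (fun n : ℕ => if n = 0 then 0 else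
      (rTwoSquares n : ℝ) * (diskTransform n b - diskTransform n a))
      (∫ u in a..b, latticeP u) := by
  rw [← intervalIntegral.integral_interval_sub_left (intervalIntegrable_latticeP 0 b)
    (intervalIntegrable_latticeP 0 a)]
  have h := (hasSum_nat_add_iff (f := fun n : ℕ => if n = 0 then (0 : ℝ) else
      (rTwoSquares n : ℝ) * (diskTransform n b - diskTransform n a))
      (g := (∫ u in (0 : ℝ)..b, latticeP u) - ∫ u in (0 : ℝ)..a, latticeP u) 1).mp
      (by simpa [mul_sub] using (hasSum_integral_latticeP hb).sub (hasSum_integral_latticeP ha))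
  simpa using h

/-- The value of the Epstein-type Dirichlet series `∑ r(n) n ^ (-s)`. -/
noncomputable def rSeries (s : ℝ) : ℝ := ∑' n : ℕ, (rTwoSquares n : ℝ) * (n : ℝ) ^ (-s)

lemma rSeries_nonneg (s : ℝ) : 0 ≤ rSeries s := tsum_nonneg fun n => by positivity

lemma abs_average_sub_waveSum_le {t δ : ℝ} (ht : 1 ≤ t) (hδ : 0 < δ) (hδ1 : δ ≤ 1) {M : ℕ}
    (hM : 1 ≤ M) :
    |(∫ u in (t ^ 2)..((t + δ) ^ 2), latticeP u) / ((t + δ) ^ 2 - t ^ 2) -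
      √t * waveSum δ M (t + δ / 2)| ≤
      4 / √t * rSeries (5 / 4) + 6 * √t / δ * (M : ℝ) ^ (-(1 / 8) : ℝ) * rSeries (9 / 8) := by
  have h1 := (hasSum_integral_latticeP_sub (sq_nonneg t) (sq_nonneg (t + δ))).div_const
    ((t + δ) ^ 2 - t ^ 2)
  have h2 : HasSum (fun n : ℕ => if n ∈ Finset.Ico 1 M then √t * (waveCoeff δ n *
      Real.cos (2 * π * √n * (t + δ / 2) + -(3 * π / 4))) else 0)
      (√t * waveSum δ M (t + δ / 2)) := by
    have := hasSum_sum_of_ne_finset_zero (L := SummationFilter.unconditional ℕ)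
      (s := Finset.Ico 1 M) (f := fun n : ℕ =>
      if n ∈ Finset.Ico 1 M then √t * (waveCoeff δ n *
      Real.cos (2 * π * √n * (t + δ / 2) + -(3 * π / 4))) else 0) fun n hn => if_neg hn
    rw [Finset.sum_congr rfl fun n hn => if_pos hn, ← Finset.mul_sum] at this
    exact this
  have h3 := ((summable_rTwoSquares_mul_rpow (s := 5 / 4) (by norm_num)).hasSum.mul_left
    (4 / √t)).add ((summable_rTwoSquares_mul_rpow (s := 9 / 8) (by norm_num)).hasSum.mul_left
      (6 * √t / δ * (M : ℝ) ^ (-(1 / 8) : ℝ)))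
  rw [← Real.norm_eq_abs]
  refine (h1.sub h2).norm_le_of_bounded h3 fun n => ?_
  rw [Real.norm_eq_abs]
  have ht0 : 0 < √t := by positivity
  have hr : (0 : ℝ) ≤ rTwoSquares n := Nat.cast_nonneg _
  rcases Nat.eq_zero_or_pos n with rfl | hn
  · simp
  have hn' : (0 : ℝ) < n := by exact_mod_cast hn
  rw [if_neg hn.ne']
  split_ifs with h
  · have h4 := abs_diskTransform_div_sub_le hn' ht hδ hδ1
    refine le_add_of_le_of_nonneg ?_ (by positivity)
    have : (rTwoSquares n : ℝ) * (diskTransform n ((t + δ) ^ 2) - diskTransform n (t ^ 2)) /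
        ((t + δ) ^ 2 - t ^ 2) - √t * (waveCoeff δ n *
          Real.cos (2 * π * √n * (t + δ / 2) + -(3 * π / 4))) = rTwoSquares n *
        ((diskTransform n ((t + δ) ^ 2) - diskTransform n (t ^ 2)) / ((t + δ) ^ 2 - t ^ 2) -
      √t * (1 / π * (n : ℝ) ^ (-(3 / 4) : ℝ) * Real.sinc (π * √n * δ) *
        Real.cos (2 * π * √n * (t + δ / 2) + -(3 * π / 4)))) := by
      rw [waveCoeff]; ring
    rw [this, abs_mul, abs_of_nonneg hr]
    calc _ ≤ (rTwoSquares n : ℝ) * (4 * (n : ℝ) ^ (-(5 / 4) : ℝ) / √t) := by gcongr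
      _ = _ := by ring
  · rw [Finset.mem_Ico, not_and, not_lt] at h
    have h4 := abs_diskTransform_div_le hn' ht hδ hδ1
    refine le_add_of_nonneg_of_le (by positivity) ?_
    rw [sub_zero, mul_div_assoc, abs_mul, abs_of_nonneg hr]
    have h5 : (n : ℝ) ^ (-(5 / 4) : ℝ) ≤ (M : ℝ) ^ (-(1 / 8) : ℝ) * (n : ℝ) ^ (-(9 / 8) : ℝ) := by
      rw [show (-(5 / 4) : ℝ) = -(1 / 8) + -(9 / 8) by norm_num, Real.rpow_add hn']
      gcongr ?_ * _
      exact Real.rpow_le_rpow_of_nonpos (by exact_mod_cast hM) (by exact_mod_cast h hn)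
        (by norm_num)
    calc _ ≤ (rTwoSquares n : ℝ) * (6 * √t / δ *
          ((M : ℝ) ^ (-(1 / 8) : ℝ) * (n : ℝ) ^ (-(9 / 8) : ℝ))) := by
          refine mul_le_mul_of_nonneg_left (h4.trans ?_) hr
          gcongr
      _ = _ := by ring

lemma measurable_latticeA : Measurable fun x : ℝ => (latticeA x : ℝ) :=
  (Nat.mono_cast.comp latticeA_mono).measurable

lemma measurable_latticeP : Measurable latticeP :=
  measurable_latticeA.sub (by fun_prop)

lemma intervalIntegrable_of_abs_le {f : ℝ → ℝ} {a b C : ℝ} (hab : a ≤ b) (hf : Measurable f)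
    (h : ∀ t ∈ Set.Icc a b, |f t| ≤ C) : IntervalIntegrable f MeasureTheory.volume a b := by
  refine (intervalIntegrable_const (c := C)).mono_fun hf.aestronglyMeasurable ?_
  rw [Filter.EventuallyLE, MeasureTheory.ae_restrict_iff' measurableSet_uIoc]
  refine Filter.Eventually.of_forall fun t ht => ?_
  rw [Set.uIoc_of_le hab] at ht
  exact (h t ⟨ht.1.le, ht.2⟩).trans (le_abs_self C)

lemma latticeA_le {T : ℝ} (hT : 1 ≤ T) {x : ℝ} (hx : x ≤ (2 * T) ^ 2) :
    (latticeA x : ℝ) ≤ 49 * T ^ 2 := by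
  have h1 := Nat.le_ceil (2 * T)
  have h2 := Nat.ceil_lt_add_one (by linarith : 0 ≤ 2 * T)
  rw [latticeA_eq_sum (W := ⌈2 * T⌉₊) (hx.trans (by gcongr))]
  calc _ ≤ ∑ p ∈ squareBox ⌈2 * T⌉₊, (1 : ℝ) :=
        Finset.sum_le_sum fun p _ => by split_ifs <;> norm_num
    _ = (2 * (⌈2 * T⌉₊ : ℝ) + 1) ^ 2 := by
      rw [Finset.sum_const, card_squareBox]; push_cast [nsmul_eq_mul]; ring
    _ ≤ (7 * T) ^ 2 := by gcongr; linarith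
    _ = _ := by ring

lemma abs_latticeP_le {T : ℝ} (hT : 1 ≤ T) {x : ℝ} (h0 : 0 ≤ x) (hx : x ≤ (2 * T) ^ 2) :
    |latticeP x| ≤ 49 * T ^ 2 := by
  have h := latticeA_le hT hx
  have h1 : π * x ≤ 4 * (2 * T) ^ 2 := by gcongr; exact Real.pi_le_four
  have h2 : 0 ≤ π * x := by positivity
  have h3 : (0 : ℝ) ≤ latticeA x := Nat.cast_nonneg _
  rw [latticeP, abs_le]
  constructor <;> nlinarith [sq_nonneg T]

lemma abs_latticeP_sub_average_le {a b : ℝ} (hab : a < b) :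
    |latticeP a - (∫ u in a..b, latticeP u) / (b - a)| ≤
      ((latticeA b : ℝ) - latticeA a) + π * (b - a) := by
  have h0 : 0 < b - a := by linarith
  have h1 : ∀ u ∈ Set.uIoc a b, ‖latticeP a - latticeP u‖ ≤
      ((latticeA b : ℝ) - latticeA a) + π * (b - a) := by
    intro u hu
    rw [Set.uIoc_of_le hab.le] at hu
    have e1 : (latticeA a : ℝ) ≤ latticeA u := by exact_mod_cast latticeA_mono hu.1.le
    have e2 : (latticeA u : ℝ) ≤ latticeA b := by exact_mod_cast latticeA_mono hu.2
    have e3 : π * u ≤ π * b := by gcongr; exact hu.2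
    have e4 : π * a ≤ π * u := by gcongr; exact hu.1.le
    rw [Real.norm_eq_abs, latticeP, latticeP, abs_le]
    constructor <;> linarith
  have h2 := intervalIntegral.norm_integral_le_of_norm_le_const h1
  rw [intervalIntegral.integral_sub (by simp) (intervalIntegrable_latticeP a b),
    intervalIntegral.integral_const, smul_eq_mul, Real.norm_eq_abs, abs_of_pos h0] at h2
  rw [show latticeP a - (∫ u in a..b, latticeP u) / (b - a) =
    ((b - a) * latticeP a - ∫ u in a..b, latticeP u) / (b - a) by field_simp, abs_div,
    abs_of_pos h0, div_le_iff₀ h0]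
  exact h2

/-- The constant in the pointwise bound for the truncation error. -/
noncomputable def truncConst : ℝ := 4 * rSeries (5 / 4) + 6 * rSeries (9 / 8) + 3 * π

lemma abs_latticeP_sub_waveSum_le {T δ : ℝ} {M : ℕ} (hδ : 0 < δ) (hδT : δ * T ^ 4 ≤ 1)
    (hM : 1 ≤ M) (hMT : (M : ℝ) ^ (-(1 / 8) : ℝ) ≤ δ / T) {t : ℝ} (ht : 1 ≤ t) (htT : t ≤ T) :
    |latticeP (t ^ 2) - √t * waveSum δ M (t + δ / 2)| ≤
      ((latticeA ((t + δ) ^ 2) : ℝ) - latticeA (t ^ 2)) + truncConst / √t := by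
  have hT : 1 ≤ T := ht.trans htT
  have hT4 : T ^ 2 ≤ T ^ 4 := pow_le_pow_right₀ hT (by norm_num)
  have hT2 : 1 ≤ T ^ 2 := one_le_pow₀ hT
  have hδ2 : δ * T ^ 2 ≤ 1 := by nlinarith
  have hδ1 : δ ≤ 1 := by nlinarith
  have hs0 : 0 < √t := by positivity
  have hss : √t * √t = t := Real.mul_self_sqrt (by linarith)
  have h1 := abs_latticeP_sub_average_le (a := t ^ 2) (b := (t + δ) ^ 2) (by nlinarith)
  have h2 := abs_average_sub_waveSum_le ht hδ hδ1 hM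
  have h3 : 6 * √t / δ * (M : ℝ) ^ (-(1 / 8) : ℝ) * rSeries (9 / 8) ≤
      6 * rSeries (9 / 8) / √t := by
    have := rSeries_nonneg (9 / 8)
    calc _ ≤ 6 * √t / δ * (δ / T) * rSeries (9 / 8) := by gcongr
      _ = 6 * rSeries (9 / 8) * (√t / T) := by field_simp
      _ ≤ 6 * rSeries (9 / 8) * (1 / √t) := by
        gcongr 6 * rSeries (9 / 8) * ?_
        rw [div_le_div_iff₀ (by linarith) hs0]
        linarith
      _ = _ := by ring
  have h4 : π * ((t + δ) ^ 2 - t ^ 2) ≤ 3 * π / √t := by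
    rw [le_div_iff₀ hs0]
    have hst : √t ≤ t := Real.sqrt_le_left (by linarith) |>.2 (by nlinarith)
    have : ((t + δ) ^ 2 - t ^ 2) * √t ≤ 3 := by
      calc ((t + δ) ^ 2 - t ^ 2) * √t ≤ (3 * δ * t) * t := by
            gcongr; nlinarith
        _ = 3 * (δ * t ^ 2) := by ring
        _ ≤ 3 * (δ * T ^ 2) := by gcongr
        _ ≤ 3 := by linarith
    nlinarith [Real.pi_pos]
  calc _ ≤ _ := abs_sub_le _ _ _
    _ ≤ _ := add_le_add h1 h2
    _ ≤ _ := by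
      rw [truncConst, add_div, add_div, ← div_mul_eq_mul_div 4]
      linarith

lemma continuous_waveSum (δ : ℝ) (M : ℕ) : Continuous (waveSum δ M) := by
  unfold waveSum; fun_prop

lemma intervalIntegrable_latticeA_sq {a b : ℝ} (ha : 0 ≤ a) (hb : 0 ≤ b) :
    IntervalIntegrable (fun t => (latticeA (t ^ 2) : ℝ)) MeasureTheory.volume a b := by
  refine MonotoneOn.intervalIntegrable fun s hs t ht hst => ?_
  have : 0 ≤ s := (le_min ha hb).trans hs.1
  exact Nat.mono_cast (latticeA_mono (by gcongr))

lemma integral_latticeA_jump_le {T δ : ℝ} (hT : 1 ≤ T) (hδ : 0 < δ) (hδ1 : δ ≤ 1) :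
    ∫ t in (1 : ℝ)..T, ((latticeA ((t + δ) ^ 2) : ℝ) - latticeA (t ^ 2)) ≤ δ * (49 * T ^ 2) := by
  have hi : ∀ {a b : ℝ}, 0 ≤ a → 0 ≤ b →
    IntervalIntegrable (fun t => (latticeA (t ^ 2) : ℝ)) MeasureTheory.volume a b :=
    intervalIntegrable_latticeA_sq
  have hs :
      IntervalIntegrable (fun t => (latticeA ((t + δ) ^ 2) : ℝ)) MeasureTheory.volume 1 T := by
    have := (hi (a := 1 + δ) (b := T + δ) (by linarith) (by linarith)).comp_add_right δ
    simpa using this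
  rw [intervalIntegral.integral_sub hs (hi zero_le_one (by linarith)),
    intervalIntegral.integral_comp_add_right (fun t => (latticeA (t ^ 2) : ℝ)),
    ← intervalIntegral.integral_add_adjacent_intervals
      (hi (by linarith : 0 ≤ 1 + δ) (by linarith : 0 ≤ T)) (hi (by linarith) (by linarith)),
    ← intervalIntegral.integral_add_adjacent_intervals
      (hi zero_le_one (by linarith : 0 ≤ 1 + δ)) (hi (by linarith) (by linarith : 0 ≤ T))]
  have h1 : 0 ≤ ∫ t in (1 : ℝ)..(1 + δ), (latticeA (t ^ 2) : ℝ) :=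
    intervalIntegral.integral_nonneg (by linarith) fun t _ => Nat.cast_nonneg _
  have h2 : ∫ t in T..(T + δ), (latticeA (t ^ 2) : ℝ) ≤ ∫ t in T..(T + δ), 49 * T ^ 2 := by
    refine intervalIntegral.integral_mono_on (by linarith) (hi (by linarith) (by linarith))
      (by simp) fun t ht => latticeA_le hT ?_
    have := ht.1
    have := ht.2
    gcongr
    · linarith
    · linarith
  rw [intervalIntegral.integral_const, smul_eq_mul] at h2
  linarith

lemma exists_integral_mul_sq_error_le : ∃ C : ℝ, ∀ {T δ : ℝ} {M : ℕ}, 1 ≤ T → 0 < δ →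
    δ * T ^ 4 ≤ 1 → 1 ≤ M → (M : ℝ) ^ (-(1 / 8) : ℝ) ≤ δ / T →
    ∫ t in (1 : ℝ)..T, t * (latticeP (t ^ 2) - √t * waveSum δ M (t + δ / 2)) ^ 2 ≤ C * T := by
  refine ⟨4802 + 2 * truncConst ^ 2, fun {T δ M} hT hδ hδT hM hMT => ?_⟩
  have hT4 : 1 ≤ T ^ 4 := one_le_pow₀ hT
  have hδ1 : δ ≤ 1 := by nlinarith
  set J : ℝ → ℝ := fun t => (latticeA ((t + δ) ^ 2) : ℝ) - latticeA (t ^ 2) with hJ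
  have hJ0 : ∀ t ∈ Set.Icc 1 T, 0 ≤ J t := fun t ht => by
    have : 0 ≤ t := by linarith [ht.1]
    exact sub_nonneg.2 (Nat.mono_cast (latticeA_mono (by gcongr; linarith)))
  have hJ1 : ∀ t ∈ Set.Icc 1 T, J t ≤ 49 * T ^ 2 := fun t ht => by
    have := ht.1
    have := ht.2
    have h1 := latticeA_le hT (x := (t + δ) ^ 2) (by gcongr; linarith)
    have h2 : (0 : ℝ) ≤ latticeA (t ^ 2) := Nat.cast_nonneg _
    exact (sub_le_self _ h2).trans h1
  have hJi : IntervalIntegrable J MeasureTheory.volume 1 T := by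
    refine intervalIntegrable_of_abs_le (C := 49 * T ^ 2) hT ?_ fun t ht => ?_
    · exact (measurable_latticeA.comp (by fun_prop)).sub (measurable_latticeA.comp (by fun_prop))
    · rw [abs_of_nonneg (hJ0 t ht)]; exact hJ1 t ht
  have hp : ∀ t ∈ Set.Icc 1 T, t * (latticeP (t ^ 2) - √t * waveSum δ M (t + δ / 2)) ^ 2 ≤
      98 * T ^ 3 * J t + 2 * truncConst ^ 2 := fun t ht => by
    have h1 := abs_latticeP_sub_waveSum_le hδ hδT hM hMT ht.1 ht.2
    have ht0 : 0 < t := by linarith [ht.1]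
    have h2 : (truncConst / √t) ^ 2 = truncConst ^ 2 / t := by
      rw [div_pow, Real.sq_sqrt ht0.le]
    have h3 := hJ0 t ht
    have h4 := hJ1 t ht
    calc _ ≤ t * (J t + truncConst / √t) ^ 2 := by
          gcongr t * ?_
          exact sq_le_sq' (by linarith [(abs_le.1 h1).1]) (abs_le.1 h1).2
      _ ≤ t * (2 * J t * J t + 2 * (truncConst ^ 2 / t)) := by
          gcongr
          nlinarith [sq_nonneg (J t - truncConst / √t)]
      _ = t * (2 * J t * J t) + 2 * truncConst ^ 2 := by field_simp
      _ ≤ T * (2 * (49 * T ^ 2) * J t) + 2 * truncConst ^ 2 := by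
          gcongr
          exact ht.2
      _ = _ := by ring
  have hei : IntervalIntegrable
      (fun t => t * (latticeP (t ^ 2) - √t * waveSum δ M (t + δ / 2)) ^ 2)
      MeasureTheory.volume 1 T := by
    refine intervalIntegrable_of_abs_le (C := 98 * T ^ 3 * (49 * T ^ 2) + 2 * truncConst ^ 2) hT
      ?_ fun t ht => ?_
    · have h1 : Measurable fun t => latticeP (t ^ 2) := measurable_latticeP.comp (by fun_prop)
      have h2 := (continuous_waveSum δ M).measurable
      fun_prop
    · have ht0 : 0 < t := by linarith [ht.1]
      rw [abs_of_nonneg (by positivity)]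
      refine (hp t ht).trans ?_
      gcongr
      exact hJ1 t ht
  calc _ ≤ ∫ t in (1 : ℝ)..T, (98 * T ^ 3 * J t + 2 * truncConst ^ 2) :=
        intervalIntegral.integral_mono_on hT hei ((hJi.const_mul _).add (by simp)) hp
    _ = 98 * T ^ 3 * (∫ t in (1 : ℝ)..T, J t) + (T - 1) * (2 * truncConst ^ 2) := by
        rw [intervalIntegral.integral_add (hJi.const_mul _) (by simp),
          intervalIntegral.integral_const_mul, intervalIntegral.integral_const, smul_eq_mul]
    _ ≤ 98 * T ^ 3 * (δ * (49 * T ^ 2)) + T * (2 * truncConst ^ 2) := by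
        gcongr
        · exact integral_latticeA_jump_le hT hδ hδ1
        · linarith
    _ = 4802 * T * (δ * T ^ 4) + T * (2 * truncConst ^ 2) := by ring
    _ ≤ 4802 * T * 1 + T * (2 * truncConst ^ 2) := by gcongr
    _ = _ := by ring

/-- The squared modulus of the exponential sum `∑ b n * exp (i μ n t)`. -/
noncomputable def pairSum (S : Finset ℕ) (b μ : ℕ → ℝ) (t : ℝ) : ℝ :=
  ∑ m ∈ S, ∑ n ∈ S, b m * b n * Real.cos ((μ m - μ n) * t)

/-- The off-diagonal part of the mean square of an exponential sum over `[0, τ]`. -/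
noncomputable def offDiag (S : Finset ℕ) (b μ : ℕ → ℝ) (τ : ℝ) : ℝ :=
  ∑ m ∈ S, ∑ n ∈ S, if m = n then 0 else b m * b n * (Real.sin ((μ m - μ n) * τ) / (μ m - μ n))

lemma pairSum_nonneg (S : Finset ℕ) (b μ : ℕ → ℝ) (t : ℝ) : 0 ≤ pairSum S b μ t := by
  have : pairSum S b μ t = (∑ n ∈ S, b n * Real.cos (μ n * t)) ^ 2 +
      (∑ n ∈ S, b n * Real.sin (μ n * t)) ^ 2 := by
    simp only [pairSum, sq, Finset.sum_mul_sum, ← Finset.sum_add_distrib]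
    refine Finset.sum_congr rfl fun m _ => Finset.sum_congr rfl fun n _ => ?_
    rw [sub_mul, Real.cos_sub]
    ring
  rw [this]
  positivity

lemma continuous_pairSum (S : Finset ℕ) (b μ : ℕ → ℝ) : Continuous (pairSum S b μ) := by
  unfold pairSum; fun_prop

lemma continuous_offDiag (S : Finset ℕ) (b μ : ℕ → ℝ) : Continuous (offDiag S b μ) := by
  unfold offDiag
  refine continuous_finsetSum _ fun m _ => continuous_finsetSum _ fun n _ => ?_
  split_ifs <;> fun_prop

lemma integral_cos_mul_eq {l : ℝ} (hl : l ≠ 0) (τ : ℝ) :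
    ∫ t in (0 : ℝ)..τ, Real.cos (l * t) = Real.sin (l * τ) / l := by
  rw [intervalIntegral.integral_comp_mul_left Real.cos hl, integral_cos]
  simp [div_eq_inv_mul]

lemma integral_pairSum {S : Finset ℕ} {b μ : ℕ → ℝ} (hμ : Set.InjOn μ S) (τ : ℝ) :
    ∫ t in (0 : ℝ)..τ, pairSum S b μ t = τ * ∑ n ∈ S, b n ^ 2 + offDiag S b μ τ := by
  have h : ∑ n ∈ S, b n ^ 2 = ∑ m ∈ S, ∑ n ∈ S, if m = n then b m * b n else 0 := by
    refine Finset.sum_congr rfl fun m hm => ?_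
    rw [Finset.sum_ite_eq, if_pos hm, sq]
  simp only [pairSum, offDiag, h, Finset.mul_sum, ← Finset.sum_add_distrib]
  rw [intervalIntegral.integral_finsetSum fun m _ =>
    Continuous.intervalIntegrable (by fun_prop) _ _]
  refine Finset.sum_congr rfl fun m hm => ?_
  rw [intervalIntegral.integral_finsetSum fun n _ =>
    Continuous.intervalIntegrable (by fun_prop) _ _]
  refine Finset.sum_congr rfl fun n hn => ?_
  rw [intervalIntegral.integral_const_mul]
  split_ifs with hmn
  · simp [hmn, mul_comm]
  · rw [integral_cos_mul_eq (sub_ne_zero.2 fun h => hmn (hμ hm hn h))]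
    ring

lemma offDiag_le_add {S : Finset ℕ} {b μ : ℕ → ℝ} (hμ : Set.InjOn μ S) {u v : ℝ} (huv : u ≤ v) :
    offDiag S b μ u ≤ offDiag S b μ v + (v - u) * ∑ n ∈ S, b n ^ 2 := by
  have h1 := integral_pairSum (b := b) hμ u
  have h2 := integral_pairSum (b := b) hμ v
  have h3 := intervalIntegral.integral_add_adjacent_intervals
    (μ := MeasureTheory.volume) ((continuous_pairSum S b μ).intervalIntegrable 0 u)
    ((continuous_pairSum S b μ).intervalIntegrable u v)
  have h4 : 0 ≤ ∫ t in u..v, pairSum S b μ t :=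
    intervalIntegral.integral_nonneg huv fun t _ => pairSum_nonneg S b μ t
  linarith

lemma abs_integral_sin_div_le {l Δ : ℝ} (hl : l ≠ 0) (hΔ : 0 < Δ) (a : ℝ) :
    |∫ u in a..(a + Δ), Real.sin (l * u) / l| ≤ Δ * min (1 / |l|) (2 / (Δ * l ^ 2)) := by
  have hl0 : 0 < |l| := abs_pos.2 hl
  rw [mul_min_of_nonneg _ _ hΔ.le]
  refine le_min ?_ ?_
  · have := intervalIntegral.norm_integral_le_of_norm_le_const (a := a) (b := a + Δ)
      (f := fun u => Real.sin (l * u) / l) (C := 1 / |l|) fun u _ => by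
        rw [norm_div, Real.norm_eq_abs, Real.norm_eq_abs]
        gcongr
        exact Real.abs_sin_le_one _
    rwa [add_sub_cancel_left, abs_of_pos hΔ, mul_comm] at this
  · rw [intervalIntegral.integral_div, intervalIntegral.integral_comp_mul_left Real.sin hl,
      integral_sin, smul_eq_mul, abs_div, abs_mul, abs_inv]
    have : |Real.cos (l * a) - Real.cos (l * (a + Δ))| ≤ 2 := by
      have h1 := Real.abs_cos_le_one (l * a)
      have h2 := Real.abs_cos_le_one (l * (a + Δ))
      rw [abs_le] at *
      constructor <;> linarith
    calc _ ≤ |l|⁻¹ * 2 / |l| := by gcongr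
      _ = _ := by rw [← sq_abs l]; field_simp

lemma abs_integral_offDiag_le {S : Finset ℕ} {b μ : ℕ → ℝ} (hμ : Set.InjOn μ S) {Δ : ℝ}
    (hΔ : 0 < Δ) (a : ℝ) :
    |∫ u in a..(a + Δ), offDiag S b μ u| ≤ Δ * ∑ m ∈ S, ∑ n ∈ S, if m = n then 0 else
      |b m * b n| * min (1 / |μ m - μ n|) (2 / (Δ * (μ m - μ n) ^ 2)) := by
  have hc : ∀ m n, Continuous fun u => if m = n then 0 else
      b m * b n * (Real.sin ((μ m - μ n) * u) / (μ m - μ n)) := fun m n => by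
    split_ifs <;> fun_prop
  simp only [offDiag]
  rw [intervalIntegral.integral_finsetSum fun m _ =>
    (continuous_finsetSum _ fun n _ => hc m n).intervalIntegrable _ _, Finset.mul_sum]
  refine (Finset.abs_sum_le_sum_abs _ _).trans (Finset.sum_le_sum fun m hm => ?_)
  rw [intervalIntegral.integral_finsetSum fun n _ => (hc m n).intervalIntegrable _ _,
    Finset.mul_sum]
  refine (Finset.abs_sum_le_sum_abs _ _).trans (Finset.sum_le_sum fun n hn => ?_)
  split_ifs with hmn
  · simp
  · rw [intervalIntegral.integral_const_mul, abs_mul, mul_left_comm]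
    gcongr
    exact abs_integral_sin_div_le (sub_ne_zero.2 fun h => hmn (hμ hm hn h)) hΔ a

/-- Smoothing over an interval of length `Δ`, justified by positivity of the integrand. -/
lemma abs_offDiag_le {S : Finset ℕ} {b μ : ℕ → ℝ} (hμ : Set.InjOn μ S) {Δ : ℝ} (hΔ : 0 < Δ)
    (τ : ℝ) :
    |offDiag S b μ τ| ≤ Δ * ∑ n ∈ S, b n ^ 2 + ∑ m ∈ S, ∑ n ∈ S, if m = n then 0 else
      |b m * b n| * min (1 / |μ m - μ n|) (2 / (Δ * (μ m - μ n) ^ 2)) := by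
  set B := ∑ n ∈ S, b n ^ 2 with hB
  have hB0 : 0 ≤ B := Finset.sum_nonneg fun n _ => sq_nonneg _
  set R := ∑ m ∈ S, ∑ n ∈ S, if m = n then 0 else
      |b m * b n| * min (1 / |μ m - μ n|) (2 / (Δ * (μ m - μ n) ^ 2)) with hR
  have hi : ∀ a c : ℝ, IntervalIntegrable (offDiag S b μ) MeasureTheory.volume a c := fun a c =>
    (continuous_offDiag S b μ).intervalIntegrable a c
  have h1 : ∫ u in τ..(τ + Δ), (offDiag S b μ τ - Δ * B) ≤ ∫ u in τ..(τ + Δ), offDiag S b μ u :=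
    intervalIntegral.integral_mono_on (by linarith) (by simp) (hi _ _) fun u hu => by
      have := offDiag_le_add (b := b) hμ hu.1
      have : (u - τ) * B ≤ Δ * B := by gcongr; linarith [hu.2]
      linarith
  have h2 : ∫ u in (τ - Δ)..(τ - Δ + Δ), offDiag S b μ u ≤
      ∫ u in (τ - Δ)..(τ - Δ + Δ), (offDiag S b μ τ + Δ * B) :=
    intervalIntegral.integral_mono_on (by linarith) (hi _ _) (by simp) fun u hu => by
      rw [sub_add_cancel] at hu
      have := offDiag_le_add (b := b) hμ hu.2
      have : (τ - u) * B ≤ Δ * B := by gcongr; linarith [hu.1]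
      linarith
  have h3 := abs_le.1 (abs_integral_offDiag_le (b := b) hμ hΔ τ)
  have h4 := abs_le.1 (abs_integral_offDiag_le (b := b) hμ hΔ (τ - Δ))
  rw [intervalIntegral.integral_const, add_sub_cancel_left, smul_eq_mul] at h1 h2
  rw [← hR] at h3 h4
  have h5 := h1.trans h3.2
  have h6 := h4.1.trans h2
  rw [← mul_neg] at h6
  have h7 := le_of_mul_le_mul_left h5 hΔ
  have h8 := le_of_mul_le_mul_left h6 hΔ
  rw [abs_le]
  constructor <;> linarith

/-- The frequencies occurring in the Hardy–Landau expansion. -/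
noncomputable def waveFreq (n : ℕ) : ℝ := 2 * π * √n

lemma waveFreq_injective : Function.Injective waveFreq := fun m n h => by
  have h1 : √(m : ℝ) = √n := mul_left_cancel₀ (by positivity) h
  exact_mod_cast (Real.sqrt_inj (Nat.cast_nonneg m) (Nat.cast_nonneg n)).1 h1

lemma rpow_neg_three_quarter_le {n j : ℕ} (h : 4 ^ j ≤ n) :
    (n : ℝ) ^ (-(3 / 4) : ℝ) ≤ (√2 ^ (3 * j))⁻¹ := by
  have h4 : √(2 : ℝ) ^ 4 = 4 := by
    rw [show 4 = 2 * 2 by norm_num, pow_mul, Real.sq_sqrt (by norm_num)]; norm_num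
  calc (n : ℝ) ^ (-(3 / 4) : ℝ) ≤ ((4 : ℝ) ^ j) ^ (-(3 / 4) : ℝ) :=
        Real.rpow_le_rpow_of_nonpos (by positivity) (by exact_mod_cast h) (by norm_num)
    _ = (√2 ^ (4 * j)) ^ (-(3 / 4) : ℝ) := by rw [pow_mul, h4]
    _ = _ := by
        rw [← Real.rpow_natCast, ← Real.rpow_mul (by positivity),
          ← Real.rpow_natCast, ← Real.rpow_neg (by positivity)]
        push_cast
        ring_nf

lemma abs_coeff_mul_le {b : ℕ → ℝ} (hb : ∀ n, |b n| ≤ rTwoSquares n * (n : ℝ) ^ (-(3 / 4) : ℝ))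
    {j m n : ℕ} (hm : 4 ^ j ≤ m) (hn : 4 ^ j ≤ n) :
    |b m * b n| ≤ rTwoSquares m * rTwoSquares n / ((2 : ℝ) ^ j) ^ 3 := by
  have h : (√2 ^ (3 * j))⁻¹ * (√2 ^ (3 * j))⁻¹ = 1 / ((2 : ℝ) ^ j) ^ 3 := by
    rw [← mul_inv, ← mul_pow, Real.mul_self_sqrt (by norm_num), ← pow_mul, mul_comm j, one_div]
  rw [abs_mul]
  calc _ ≤ (rTwoSquares m * (√2 ^ (3 * j))⁻¹) * (rTwoSquares n * (√2 ^ (3 * j))⁻¹) := by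
        gcongr
        · exact (hb m).trans (by gcongr; exact rpow_neg_three_quarter_le hm)
        · exact (hb n).trans (by gcongr; exact rpow_neg_three_quarter_le hn)
    _ = (rTwoSquares m * rTwoSquares n) * ((√2 ^ (3 * j))⁻¹ * (√2 ^ (3 * j))⁻¹) := by ring
    _ = _ := by rw [h]; ring

lemma le_abs_waveFreq_sub {j m n : ℕ} (hm : m < 4 ^ (j + 2)) (hn : n < 4 ^ (j + 2)) :
    |(m : ℝ) - n| ≤ 2 * 2 ^ j * |waveFreq m - waveFreq n| := by
  have h : ∀ k : ℕ, k < 4 ^ (j + 2) → √(k : ℝ) ≤ 4 * 2 ^ j := fun k hk => by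
    rw [Real.sqrt_le_left (by positivity)]
    calc (k : ℝ) ≤ 4 ^ (j + 2) := by exact_mod_cast hk.le
      _ = _ := by rw [show (4 : ℝ) = 2 ^ 2 by norm_num, ← pow_mul, mul_pow, ← pow_mul, ← pow_mul,
        ← pow_add]; ring_nf
  have e : (m : ℝ) - n = (√m + √n) * (√m - √n) := by
    rw [← sq_sub_sq, Real.sq_sqrt (Nat.cast_nonneg m), Real.sq_sqrt (Nat.cast_nonneg n)]
  rw [waveFreq, waveFreq, ← mul_sub, e, abs_mul, abs_mul, abs_of_pos Real.two_pi_pos,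
    abs_of_nonneg (by positivity), ← mul_assoc]
  gcongr
  have := h m hm
  have := h n hn
  have : (2 : ℝ) * 2 ^ j * (2 * 3) ≤ 2 * 2 ^ j * (2 * π) := by
    gcongr; exact Real.pi_gt_three.le
  have : (0 : ℝ) < 2 ^ j := by positivity
  linarith

lemma min_freq_le {c l h H : ℝ} (hc : 0 < c) (hh : 0 < h) (hH : 0 < H) (hl : h ≤ c * |l|) :
    min (1 / |l|) (2 / (2 * c / H * l ^ 2)) ≤ c * decayWeight H h := by
  have hl0 : 0 < |l| := by
    by_contra! h0
    have := abs_nonneg l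
    nlinarith
  rw [decayWeight, mul_min_of_nonneg _ _ hc.le]
  refine min_le_min ?_ ?_
  · rw [div_le_iff₀ hl0, mul_one_div, div_mul_eq_mul_div, le_div_iff₀ hh]
    linarith
  · rw [← sq_abs l]
    have : h ^ 2 ≤ (c * |l|) ^ 2 := by gcongr
    calc 2 / (2 * c / H * |l| ^ 2) = c * (H / (c * |l|) ^ 2) := by field_simp
      _ ≤ _ := by gcongr

lemma abs_offDiag_block_le {b : ℕ → ℝ}
    (hb : ∀ n, |b n| ≤ rTwoSquares n * (n : ℝ) ^ (-(3 / 4) : ℝ)) {j H : ℕ} (hH : j + 5 ≤ H)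
    {S : Finset ℕ} (hS : S ⊆ Finset.Ico (4 ^ j) (4 ^ (j + 2))) (τ : ℝ) :
    |offDiag S b waveFreq τ| ≤ 190000 * (2 + Real.log H) := by
  have hH0 : (0 : ℝ) < H := by exact_mod_cast (by omega : 0 < H)
  set p : ℝ := 2 ^ j with hp
  have hp0 : 0 < p := by positivity
  set Y : ℕ := 4 * 2 ^ j with hY
  have hYp : (Y : ℝ) = 4 * p := by rw [hY, hp]; push_cast; ring
  have hSY : S ⊆ Finset.range (Y ^ 2 + 1) := fun n hn => by
    have h1 := (Finset.mem_Ico.1 (hS hn)).2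
    have : Y ^ 2 = 4 ^ (j + 2) := by
      rw [hY, show 4 = 2 ^ 2 by norm_num, ← pow_mul, ← pow_add, ← pow_mul]; ring_nf
    rw [Finset.mem_range, this]
    omega
  have hlo : ∀ n ∈ S, 4 ^ j ≤ n := fun n hn => (Finset.mem_Ico.1 (hS hn)).1
  have hhi : ∀ n ∈ S, n < 4 ^ (j + 2) := fun n hn => (Finset.mem_Ico.1 (hS hn)).2
  have h := abs_offDiag_le (S := S) (b := b) (waveFreq_injective.injOn) (Δ := 2 * (2 * p) / H)
    (by positivity) τ
  have hdiag : ∑ n ∈ S, b n ^ 2 ≤ 1 / p ^ 3 * ((Y : ℝ) ^ 2 * (1152 * (j + 5))) := by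
    calc ∑ n ∈ S, b n ^ 2 ≤ ∑ n ∈ S, 1 / p ^ 3 * (rTwoSquares n : ℝ) ^ 2 :=
          Finset.sum_le_sum fun n hn => by
            have := abs_coeff_mul_le hb (hlo n hn) (hlo n hn)
            rw [← sq, abs_of_nonneg (sq_nonneg _), ← sq] at this
            rw [one_div_mul_eq_div]
            exact this
      _ ≤ ∑ n ∈ Finset.range (Y ^ 2 + 1), 1 / p ^ 3 * (rTwoSquares n : ℝ) ^ 2 :=
          Finset.sum_le_sum_of_subset_of_nonneg hSY fun _ _ _ => by positivity
      _ ≤ _ := by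
          rw [← Finset.mul_sum]
          refine mul_le_mul_of_nonneg_left ((sum_rTwoSquares_sq_le (by
            rw [hY]; exact Nat.one_le_iff_ne_zero.2 (by positivity))).trans ?_) (by positivity)
          have h1 := recipDivisorSum_zero_le (Z := 3 * Y)
          have h2 : Real.log ((3 * Y : ℕ) : ℝ) ≤ 3 + j := by
            have e : ((3 * Y : ℕ) : ℝ) = 12 * 2 ^ j := by push_cast; rw [hYp]; ring
            rw [e, Real.log_mul (by norm_num) (by positivity), Real.log_pow]
            have h3 : Real.log 12 ≤ 3 := by
              rw [show (12 : ℝ) = 2 ^ 2 * 3 by norm_num, Real.log_mul (by norm_num) (by norm_num),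
                Real.log_pow]
              have := Real.log_two_lt_d9
              have : Real.log 3 ≤ 3 / 2 := by
                have e1 : (3 : ℝ) ≤ 2 ^ 2 := by norm_num
                have := Real.log_le_log (by norm_num) e1
                rw [Real.log_pow] at this
                push_cast at this
                linarith
              push_cast
              linarith
            have h4 : (j : ℝ) * Real.log 2 ≤ j * 1 := by
              gcongr
              linarith [Real.log_two_lt_d9]
            linarith
          gcongr
          linarith
  have hoff : (∑ m ∈ S, ∑ n ∈ S, if m = n then 0 else
      |b m * b n| * min (1 / |waveFreq m - waveFreq n|)
        (2 / (2 * (2 * p) / H * (waveFreq m - waveFreq n) ^ 2))) ≤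
      2 * p / p ^ 3 * (4608 * (Y : ℝ) ^ 2 * (2 + Real.log H)) := by
    calc _ ≤ ∑ m ∈ S, ∑ n ∈ S, 2 * p / p ^ 3 * (if m = n then 0 else
          (rTwoSquares m : ℝ) * rTwoSquares n * decayWeight H |(m : ℝ) - n|) :=
          Finset.sum_le_sum fun m hm => Finset.sum_le_sum fun n hn => by
            split_ifs with hmn
            · simp
            · have h1 := abs_coeff_mul_le hb (hlo m hm) (hlo n hn)
              have h2 := min_freq_le (c := 2 * p) (h := |(m : ℝ) - n|) (by positivity)
                (abs_pos.2 (sub_ne_zero.2 (by exact_mod_cast hmn))) hH0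
                (le_abs_waveFreq_sub (hhi m hm) (hhi n hn))
              calc _ ≤ rTwoSquares m * rTwoSquares n / p ^ 3 *
                    (2 * p * decayWeight H |(m : ℝ) - n|) := by gcongr
                _ = _ := by ring
      _ ≤ ∑ m ∈ Finset.range (Y ^ 2 + 1), ∑ n ∈ Finset.range (Y ^ 2 + 1),
          2 * p / p ^ 3 * (if m = n then 0 else
          (rTwoSquares m : ℝ) * rTwoSquares n * decayWeight H |(m : ℝ) - n|) := by
          have hnn : ∀ m n : ℕ, 0 ≤ 2 * p / p ^ 3 * (if m = n then 0 else
            (rTwoSquares m : ℝ) * rTwoSquares n * decayWeight H |(m : ℝ) - n|) := fun m n => by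
              have := decayWeight_nonneg hH0.le (abs_nonneg ((m : ℝ) - n))
              split_ifs <;> positivity
          refine (Finset.sum_le_sum fun m _ => Finset.sum_le_sum_of_subset_of_nonneg hSY
            fun n _ _ => hnn m n).trans (Finset.sum_le_sum_of_subset_of_nonneg hSY
              fun m _ _ => Finset.sum_nonneg fun n _ => hnn m n)
      _ ≤ _ := by
          simp only [← Finset.mul_sum]
          refine mul_le_mul_of_nonneg_left ?_ (by positivity)
          exact sum_offDiag_decayWeight_le (by omega)
  have hlog : 0 ≤ Real.log H := Real.log_natCast_nonneg H
  have hj : (j : ℝ) + 5 ≤ H := by exact_mod_cast hH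
  calc _ ≤ 2 * (2 * p) / H * (1 / p ^ 3 * ((Y : ℝ) ^ 2 * (1152 * (j + 5)))) +
        2 * p / p ^ 3 * (4608 * (Y : ℝ) ^ 2 * (2 + Real.log H)) := by
        refine h.trans (add_le_add ?_ hoff)
        gcongr
    _ = 73728 * ((j + 5) / H) + 147456 * (2 + Real.log H) := by
        rw [hYp]; field_simp; ring
    _ ≤ 73728 * 1 + 147456 * (2 + Real.log H) := by
        gcongr
        rw [div_le_one hH0]
        exact hj
    _ ≤ _ := by linarith

lemma sum_abs_block_le {b : ℕ → ℝ}
    (hb : ∀ n, |b n| ≤ rTwoSquares n * (n : ℝ) ^ (-(3 / 4) : ℝ)) (j : ℕ) :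
    ∑ n ∈ Finset.Ico (4 ^ j) (4 ^ (j + 1)), |b n| ≤ 36 * √2 ^ j := by
  have hs : √(2 : ℝ) ^ 2 = 2 := Real.sq_sqrt (by norm_num)
  have hY : (2 ^ (j + 1)) ^ 2 = 4 ^ (j + 1) := by
    rw [show 4 = 2 ^ 2 by norm_num, ← pow_mul, ← pow_mul, mul_comm]
  have hsub : Finset.Ico (4 ^ j) (4 ^ (j + 1)) ⊆ Finset.range ((2 ^ (j + 1)) ^ 2 + 1) := by
    intro n hn
    rw [Finset.mem_range, hY]
    have := (Finset.mem_Ico.1 hn).2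
    omega
  have h1 : ∑ n ∈ Finset.range ((2 ^ (j + 1)) ^ 2 + 1), (rTwoSquares n : ℝ) ≤
      36 * √2 ^ (4 * j) := by
    have h2 : ∑ n ∈ Finset.range ((2 ^ (j + 1)) ^ 2 + 1), (rTwoSquares n : ℝ) ≤
        (2 * 2 ^ (j + 1) + 1) ^ 2 := by
      exact_mod_cast sum_rTwoSquares_range_le (2 ^ (j + 1))
    have h3 : (1 : ℝ) ≤ 2 ^ (j + 1) := one_le_pow₀ (by norm_num)
    calc _ ≤ _ := h2
      _ ≤ (3 * (2 : ℝ) ^ (j + 1)) ^ 2 := by gcongr; linarith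
      _ = 36 * (2 ^ j) ^ 2 := by ring
      _ = _ := by
        rw [show 4 * j = 2 * (j * 2) by ring, pow_mul, hs, ← pow_mul]
  calc _ ≤ ∑ n ∈ Finset.Ico (4 ^ j) (4 ^ (j + 1)), (rTwoSquares n : ℝ) * (√2 ^ (3 * j))⁻¹ :=
        Finset.sum_le_sum fun n hn => (hb n).trans (by
          gcongr; exact rpow_neg_three_quarter_le (Finset.mem_Ico.1 hn).1)
    _ ≤ ∑ n ∈ Finset.range ((2 ^ (j + 1)) ^ 2 + 1), (rTwoSquares n : ℝ) * (√2 ^ (3 * j))⁻¹ :=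
        Finset.sum_le_sum_of_subset_of_nonneg hsub fun _ _ _ => by positivity
    _ ≤ 36 * √2 ^ (4 * j) * (√2 ^ (3 * j))⁻¹ := by
        rw [← Finset.sum_mul]
        gcongr
    _ = _ := by
        rw [show 4 * j = j + 3 * j by ring, pow_add]
        field_simp

lemma sum_abs_initial_le {b : ℕ → ℝ}
    (hb : ∀ n, |b n| ≤ rTwoSquares n * (n : ℝ) ^ (-(3 / 4) : ℝ)) (J : ℕ) :
    ∑ n ∈ Finset.Ico 1 (4 ^ J), |b n| ≤ 90 * √2 ^ J := by
  induction J with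
  | zero => simp
  | succ J ih =>
    rw [← Finset.sum_Ico_consecutive _ (Nat.one_le_pow J 4 (by norm_num))
      (Nat.pow_le_pow_right (by norm_num) J.le_succ)]
    have h := sum_abs_block_le hb J
    have h2 : (1.4 : ℝ) ≤ √2 := Real.le_sqrt_of_sq_le (by norm_num)
    have h3 : 0 < √(2 : ℝ) ^ J := by positivity
    rw [pow_succ √(2 : ℝ)]
    nlinarith

lemma sum_abs_mul_div_sqrt_le {b : ℕ → ℝ}
    (hb : ∀ n, |b n| ≤ rTwoSquares n * (n : ℝ) ^ (-(3 / 4) : ℝ)) (J : ℕ) :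
    ∑ m ∈ Finset.Ico 1 (4 ^ (J + 1)), ∑ n ∈ Finset.Ico (4 ^ J) (4 ^ (J + 1)),
      |b m * b n| / √n ≤ 4600 := by
  have hs : √(2 : ℝ) ^ 2 = 2 := Real.sq_sqrt (by norm_num)
  have hsj : √(2 : ℝ) ^ J * √2 ^ J = 2 ^ J := by rw [← mul_pow, ← sq, hs]
  have h1 := sum_abs_initial_le hb (J + 1)
  have h2 := sum_abs_block_le hb J
  have h3 : √(2 : ℝ) ≤ 1.4143 := by rw [Real.sqrt_le_left (by norm_num)]; norm_num
  calc _ ≤ ∑ m ∈ Finset.Ico 1 (4 ^ (J + 1)), ∑ n ∈ Finset.Ico (4 ^ J) (4 ^ (J + 1)),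
      |b m| * (|b n| / 2 ^ J) :=
        Finset.sum_le_sum fun m _ => Finset.sum_le_sum fun n hn => by
          rw [abs_mul, mul_div_assoc]
          gcongr
          refine Real.le_sqrt_of_sq_le ?_
          rw [← pow_mul, mul_comm, pow_mul]
          norm_num
          exact_mod_cast (Finset.mem_Ico.1 hn).1
    _ = (∑ m ∈ Finset.Ico 1 (4 ^ (J + 1)), |b m|) *
        ((∑ n ∈ Finset.Ico (4 ^ J) (4 ^ (J + 1)), |b n|) / 2 ^ J) := by
        rw [Finset.sum_div, Finset.sum_mul_sum]
    _ ≤ 90 * √2 ^ (J + 1) * (36 * √2 ^ J / 2 ^ J) := by gcongr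
    _ = 3240 * √2 := by rw [← hsj]; field_simp; ring
    _ ≤ _ := by linarith

lemma sum_sum_union_eq {K : ℕ → ℕ → ℝ} (hK : ∀ m n, K m n = K n m) {A B C : Finset ℕ}
    (hAB : Disjoint A B) (hAC : Disjoint A C) (hBC : Disjoint B C) :
    ∑ m ∈ A ∪ B ∪ C, ∑ n ∈ A ∪ B ∪ C, K m n = (∑ m ∈ A ∪ B, ∑ n ∈ A ∪ B, K m n) +
      (∑ m ∈ B ∪ C, ∑ n ∈ B ∪ C, K m n) - (∑ m ∈ B, ∑ n ∈ B, K m n) +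
      2 * ∑ m ∈ A, ∑ n ∈ C, K m n := by
  have h : ∑ m ∈ C, ∑ n ∈ A, K m n = ∑ m ∈ A, ∑ n ∈ C, K m n := by
    rw [Finset.sum_comm]
    exact Finset.sum_congr rfl fun m _ => Finset.sum_congr rfl fun n _ => hK _ _
  simp only [Finset.sum_union (Finset.disjoint_union_left.2 ⟨hAC, hBC⟩), Finset.sum_union hAB,
    Finset.sum_union hBC, Finset.sum_add_distrib]
  linarith

lemma abs_sin_div_le_of_four_mul_le {m n : ℕ} (hm : 4 * m ≤ n) (hn : 1 ≤ n) (τ : ℝ) :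
    |Real.sin ((waveFreq m - waveFreq n) * τ) / (waveFreq m - waveFreq n)| ≤ 1 / √n := by
  have hn0 : (0 : ℝ) < √n := Real.sqrt_pos.2 (by exact_mod_cast hn)
  have h1 : 2 * √(m : ℝ) ≤ √n := by
    refine Real.le_sqrt_of_sq_le ?_
    rw [mul_pow, Real.sq_sqrt (Nat.cast_nonneg m)]
    norm_num
    exact_mod_cast hm
  have h2 : √(n : ℝ) ≤ |waveFreq m - waveFreq n| := by
    rw [waveFreq, waveFreq, ← mul_sub, abs_mul, abs_of_pos Real.two_pi_pos, abs_sub_comm]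
    have := le_abs_self (√(n : ℝ) - √m)
    nlinarith [Real.pi_gt_three]
  rw [abs_div]
  gcongr
  exact Real.abs_sin_le_one _

lemma abs_offDiag_dyadic_le {b : ℕ → ℝ}
    (hb : ∀ n, |b n| ≤ rTwoSquares n * (n : ℝ) ^ (-(3 / 4) : ℝ)) {H : ℕ} (τ : ℝ) :
    ∀ J : ℕ, J + 5 ≤ H → |offDiag (Finset.Ico 1 (4 ^ J)) b waveFreq τ| ≤
      J * (400000 * (2 + Real.log H))
  | 0, _ => by simp [offDiag]
  | 1, hH => by
    have hlog : 0 ≤ Real.log H := Real.log_natCast_nonneg H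
    refine (abs_offDiag_block_le hb (j := 0) (H := H) (by omega) ?_ τ).trans ?_
    · rw [pow_zero]
      exact Finset.Ico_subset_Ico_right (by norm_num)
    · push_cast; linarith
  | J + 2, hH => by
    have hlog : 0 ≤ Real.log H := Real.log_natCast_nonneg H
    have h1 := abs_offDiag_dyadic_le hb (H := H) τ (J + 1) (by omega)
    have p1 : 1 ≤ 4 ^ J := Nat.one_le_pow J 4 (by norm_num)
    have p2 : 4 ^ J ≤ 4 ^ (J + 1) := Nat.pow_le_pow_right (by norm_num) (by omega)
    have p3 : 4 ^ (J + 1) ≤ 4 ^ (J + 2) := Nat.pow_le_pow_right (by norm_num) (by omega)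
    have h2 := abs_offDiag_block_le hb (j := J) (H := H) (by omega)
      (S := Finset.Ico (4 ^ J) (4 ^ (J + 2))) subset_rfl τ
    have h3 := abs_offDiag_block_le hb (j := J) (H := H) (by omega)
      (S := Finset.Ico (4 ^ J) (4 ^ (J + 1))) (Finset.Ico_subset_Ico_right p3) τ
    set K : ℕ → ℕ → ℝ := fun m n => if m = n then 0 else
      b m * b n * (Real.sin ((waveFreq m - waveFreq n) * τ) / (waveFreq m - waveFreq n)) with hK
    have hsymm : ∀ m n, K m n = K n m := fun m n => by
      simp only [hK]
      rw [← neg_sub (waveFreq n), neg_mul, Real.sin_neg, neg_div_neg_eq]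
      simp only [eq_comm (a := m), mul_comm (b m)]
    have h4 : |∑ m ∈ Finset.Ico 1 (4 ^ J), ∑ n ∈ Finset.Ico (4 ^ (J + 1)) (4 ^ (J + 2)), K m n| ≤
        4600 := by
      refine le_trans ?_ (sum_abs_mul_div_sqrt_le hb (J + 1))
      calc _ ≤ ∑ m ∈ Finset.Ico 1 (4 ^ J), ∑ n ∈ Finset.Ico (4 ^ (J + 1)) (4 ^ (J + 2)),
            |b m * b n| / √n := by
            refine (Finset.abs_sum_le_sum_abs _ _).trans (Finset.sum_le_sum fun m hm =>
              (Finset.abs_sum_le_sum_abs _ _).trans (Finset.sum_le_sum fun n hn => ?_))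
            have hm := Finset.mem_Ico.1 hm
            have hn := Finset.mem_Ico.1 hn
            rw [pow_succ] at hn
            simp only [hK]
            rw [if_neg (by omega), abs_mul, div_eq_mul_one_div |b m * b n|]
            gcongr
            exact abs_sin_div_le_of_four_mul_le (by omega) (by omega) τ
        _ ≤ _ := Finset.sum_le_sum_of_subset_of_nonneg
            (Finset.Ico_subset_Ico_right (p2.trans p3)) fun m _ _ =>
              Finset.sum_nonneg fun n _ => by positivity
    have h5 := sum_sum_union_eq hsymm (Finset.Ico_disjoint_Ico_consecutive 1 (4 ^ J) (4 ^ (J + 1)))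
      (A := Finset.Ico 1 (4 ^ J)) (C := Finset.Ico (4 ^ (J + 1)) (4 ^ (J + 2)))
      (Finset.disjoint_left.2 fun n h1 h2 => by
        have := Finset.mem_Ico.1 h1
        have := Finset.mem_Ico.1 h2
        omega)
      (Finset.Ico_disjoint_Ico_consecutive _ _ _)
    rw [Finset.Ico_union_Ico_eq_Ico p1 p2, Finset.Ico_union_Ico_eq_Ico p2 p3,
      Finset.Ico_union_Ico_eq_Ico (p1.trans p2) p3] at h5
    change offDiag _ b waveFreq τ = offDiag _ b waveFreq τ + offDiag _ b waveFreq τ -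
      offDiag _ b waveFreq τ + _ at h5
    rw [h5]
    push_cast at h1 ⊢
    rw [abs_le] at *
    constructor <;> linarith [h1.1, h1.2, h2.1, h2.2, h3.1, h3.2, h4.1, h4.2]

lemma sum_abs_mul_div_sqrt_add_le {b : ℕ → ℝ}
    (hb : ∀ n, |b n| ≤ rTwoSquares n * (n : ℝ) ^ (-(3 / 4) : ℝ)) (J : ℕ) :
    ∑ m ∈ Finset.Ico 1 (4 ^ J), ∑ n ∈ Finset.Ico 1 (4 ^ J), |b m * b n| / (√m + √n) ≤
      J * 9200 := by
  induction J with
  | zero => simp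
  | succ J ih =>
    have p1 : 1 ≤ 4 ^ J := Nat.one_le_pow J 4 (by norm_num)
    have p2 : 4 ^ J ≤ 4 ^ (J + 1) := Nat.pow_le_pow_right (by norm_num) (by omega)
    set A := Finset.Ico 1 (4 ^ J) with hA
    set B := Finset.Ico (4 ^ J) (4 ^ (J + 1)) with hB
    have hI : Finset.Ico 1 (4 ^ (J + 1)) = A ∪ B := (Finset.Ico_union_Ico_eq_Ico p1 p2).symm
    have hd : Disjoint A B := Finset.Ico_disjoint_Ico_consecutive _ _ _
    set K : ℕ → ℕ → ℝ := fun m n => |b m * b n| / (√m + √n) with hK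
    have hsymm : ∑ m ∈ B, ∑ n ∈ A, K m n = ∑ m ∈ A, ∑ n ∈ B, K m n := by
      rw [Finset.sum_comm]
      refine Finset.sum_congr rfl fun m _ => Finset.sum_congr rfl fun n _ => ?_
      simp only [hK]
      rw [mul_comm, add_comm]
    have h1 : ∑ m ∈ A ∪ B, ∑ n ∈ B, K m n ≤ 4600 := by
      refine le_trans ?_ (sum_abs_mul_div_sqrt_le hb J)
      rw [← hI]
      refine Finset.sum_le_sum fun m hm => Finset.sum_le_sum fun n hn => ?_
      have : 0 < √(n : ℝ) := Real.sqrt_pos.2 (by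
        exact_mod_cast p1.trans (Finset.mem_Ico.1 hn).1)
      simp only [hK]
      gcongr
      linarith [Real.sqrt_nonneg (m : ℝ)]
    have h2 : 0 ≤ ∑ m ∈ B, ∑ n ∈ B, K m n :=
      Finset.sum_nonneg fun m _ => Finset.sum_nonneg fun n _ => by positivity
    rw [hI]
    rw [Finset.sum_union hd] at h1
    simp only [Finset.sum_union hd, Finset.sum_add_distrib]
    push_cast
    linarith

lemma abs_integral_cos_add_le {l : ℝ} (hl : 0 < l) (τ θ : ℝ) :
    |∫ t in (0 : ℝ)..τ, Real.cos (l * t + θ)| ≤ 2 / l := by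
  rw [intervalIntegral.integral_comp_mul_add Real.cos hl.ne', integral_cos, smul_eq_mul, abs_mul,
    abs_of_pos (inv_pos.2 hl), inv_mul_eq_div]
  gcongr
  have h1 := Real.abs_sin_le_one (l * τ + θ)
  have h2 := Real.abs_sin_le_one (l * 0 + θ)
  rw [abs_le] at *
  constructor <;> linarith

lemma abs_integral_sq_sum_cos_sub_le {b : ℕ → ℝ}
    (hb : ∀ n, |b n| ≤ rTwoSquares n * (n : ℝ) ^ (-(3 / 4) : ℝ)) {J H : ℕ} (hH : J + 5 ≤ H)
    (τ θ : ℝ) :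
    |(∫ t in (0 : ℝ)..τ, (∑ n ∈ Finset.Ico 1 (4 ^ J), b n * Real.cos (waveFreq n * t + θ)) ^ 2) -
      τ * ((∑ n ∈ Finset.Ico 1 (4 ^ J), b n ^ 2) / 2)| ≤ J * (210000 * (2 + Real.log H)) := by
  set S := Finset.Ico 1 (4 ^ J) with hS
  have hlog : 0 ≤ Real.log H := Real.log_natCast_nonneg H
  have e1 : ∀ t, (∑ n ∈ S, b n * Real.cos (waveFreq n * t + θ)) ^ 2 =
      pairSum S b waveFreq t / 2 + ∑ m ∈ S, ∑ n ∈ S, b m * b n / 2 *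
        Real.cos ((waveFreq m + waveFreq n) * t + 2 * θ) := fun t => by
    rw [sq, Finset.sum_mul_sum, pairSum, Finset.sum_div, ← Finset.sum_add_distrib]
    refine Finset.sum_congr rfl fun m _ => ?_
    rw [Finset.sum_div, ← Finset.sum_add_distrib]
    refine Finset.sum_congr rfl fun n _ => ?_
    rw [show (waveFreq m - waveFreq n) * t = (waveFreq m * t + θ) - (waveFreq n * t + θ) by ring,
      show (waveFreq m + waveFreq n) * t + 2 * θ = (waveFreq m * t + θ) + (waveFreq n * t + θ) by
        ring, Real.cos_sub (waveFreq m * t + θ), Real.cos_add (waveFreq m * t + θ)]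
    ring
  have e2 : ∫ t in (0 : ℝ)..τ, (∑ m ∈ S, ∑ n ∈ S, b m * b n / 2 *
        Real.cos ((waveFreq m + waveFreq n) * t + 2 * θ)) = ∑ m ∈ S, ∑ n ∈ S, b m * b n / 2 *
        ∫ t in (0 : ℝ)..τ, Real.cos ((waveFreq m + waveFreq n) * t + 2 * θ) := by
    rw [intervalIntegral.integral_finsetSum fun m _ =>
      Continuous.intervalIntegrable (by fun_prop) _ _]
    refine Finset.sum_congr rfl fun m _ => ?_
    rw [intervalIntegral.integral_finsetSum fun n _ =>
      Continuous.intervalIntegrable (by fun_prop) _ _]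
    exact Finset.sum_congr rfl fun n _ => intervalIntegral.integral_const_mul _ _
  have h1 : |∑ m ∈ S, ∑ n ∈ S, b m * b n / 2 *
        ∫ t in (0 : ℝ)..τ, Real.cos ((waveFreq m + waveFreq n) * t + 2 * θ)| ≤ J * 9200 / 2 := by
    refine le_trans ?_ (div_le_div_of_nonneg_right (sum_abs_mul_div_sqrt_add_le hb J) zero_le_two)
    rw [Finset.sum_div]
    refine (Finset.abs_sum_le_sum_abs _ _).trans (Finset.sum_le_sum fun m hm => ?_)
    rw [Finset.sum_div]
    refine (Finset.abs_sum_le_sum_abs _ _).trans (Finset.sum_le_sum fun n hn => ?_)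
    have hm0 : (0 : ℝ) < √m := Real.sqrt_pos.2 (by exact_mod_cast (Finset.mem_Ico.1 hm).1)
    have e3 : waveFreq m + waveFreq n = 2 * π * (√m + √n) := by rw [waveFreq, waveFreq]; ring
    have hp : 0 < 2 * π * (√(m : ℝ) + √n) := by positivity
    have h3 := abs_integral_cos_add_le hp τ (2 * θ)
    rw [e3, abs_mul, abs_div, abs_two, div_mul_eq_mul_div, mul_div_assoc]
    have h4 : 2 / (2 * π * (√(m : ℝ) + √n)) ≤ 1 / (√(m : ℝ) + √n) := by
      rw [div_le_div_iff₀ hp (by positivity)]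
      nlinarith [Real.pi_gt_three, Real.sqrt_nonneg (n : ℝ)]
    calc _ ≤ |b m * b n| * ((1 / (√(m : ℝ) + √n)) / 2) := by gcongr; exact h3.trans h4
      _ = _ := by ring
  have h2 := abs_offDiag_dyadic_le hb τ J hH
  rw [intervalIntegral.integral_congr fun t _ => e1 t, intervalIntegral.integral_add
    (((continuous_pairSum S b waveFreq).div_const 2).intervalIntegrable _ _)
    (Continuous.intervalIntegrable (by fun_prop) _ _), e2, intervalIntegral.integral_div,
    integral_pairSum waveFreq_injective.injOn]
  have hJ : (0 : ℝ) ≤ J := Nat.cast_nonneg J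
  have h5 : 0 ≤ (J : ℝ) * Real.log H := by positivity
  rw [← hS] at h2
  rw [abs_le] at *
  constructor <;> nlinarith [h1.1, h1.2, h2.1, h2.2]

lemma sum_rTwoSquares_sq_rpow_block_le (j : ℕ) :
    ∑ n ∈ Finset.Ico (4 ^ j) (4 ^ (j + 1)), (rTwoSquares n : ℝ) ^ 2 * (n : ℝ) ^ (-(5 / 4) : ℝ) ≤
      4608 * ((j + 5) * (√2)⁻¹ ^ j) := by
  have hY : (2 ^ (j + 1)) ^ 2 = 4 ^ (j + 1) := by
    rw [show 4 = 2 ^ 2 by norm_num, ← pow_mul, ← pow_mul, mul_comm]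
  have h4 : √(2 : ℝ) ^ 4 = 4 := by
    rw [show 4 = 2 * 2 by norm_num, pow_mul, Real.sq_sqrt (by norm_num)]; norm_num
  have hsub : Finset.Ico (4 ^ j) (4 ^ (j + 1)) ⊆ Finset.range ((2 ^ (j + 1)) ^ 2 + 1) := by
    intro n hn
    rw [Finset.mem_range, hY]
    have := (Finset.mem_Ico.1 hn).2
    omega
  have h1 : ∑ n ∈ Finset.range ((2 ^ (j + 1)) ^ 2 + 1), (rTwoSquares n : ℝ) ^ 2 ≤
      4 * 4 ^ j * (1152 * (j + 5)) := by
    refine (sum_rTwoSquares_sq_le (Nat.one_le_pow _ 2 (by norm_num))).trans ?_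
    have e : (((2 ^ (j + 1) : ℕ) : ℝ)) ^ 2 = 4 * 4 ^ j := by
      rw [← pow_succ']; exact_mod_cast hY
    rw [e]
    have h1 := recipDivisorSum_zero_le (Z := 3 * 2 ^ (j + 1))
    have h2 : Real.log ((3 * 2 ^ (j + 1) : ℕ) : ℝ) ≤ 3 + j := by
      have e : ((3 * 2 ^ (j + 1) : ℕ) : ℝ) ≤ 2 ^ (j + 3) := by
        push_cast
        rw [pow_succ, pow_add]
        have : (0 : ℝ) < 2 ^ j := by positivity
        linarith
      refine (Real.log_le_log (by positivity) e).trans ?_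
      rw [Real.log_pow]
      push_cast
      have := Real.log_two_lt_d9
      nlinarith [(Nat.cast_nonneg j : (0 : ℝ) ≤ j)]
    gcongr
    linarith
  calc _ ≤ ∑ n ∈ Finset.Ico (4 ^ j) (4 ^ (j + 1)), (rTwoSquares n : ℝ) ^ 2 * (√2 ^ (5 * j))⁻¹ := by
        refine Finset.sum_le_sum fun n hn => ?_
        gcongr
        calc (n : ℝ) ^ (-(5 / 4) : ℝ) ≤ ((4 : ℝ) ^ j) ^ (-(5 / 4) : ℝ) :=
              Real.rpow_le_rpow_of_nonpos (by positivity)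
                (by exact_mod_cast (Finset.mem_Ico.1 hn).1) (by norm_num)
          _ = (√2 ^ (4 * j)) ^ (-(5 / 4) : ℝ) := by rw [pow_mul, h4]
          _ = _ := by
              rw [← Real.rpow_natCast, ← Real.rpow_mul (by positivity),
                ← Real.rpow_natCast, ← Real.rpow_neg (by positivity)]
              push_cast
              ring_nf
    _ ≤ ∑ n ∈ Finset.range ((2 ^ (j + 1)) ^ 2 + 1), (rTwoSquares n : ℝ) ^ 2 * (√2 ^ (5 * j))⁻¹ :=
        Finset.sum_le_sum_of_subset_of_nonneg hsub fun _ _ _ => by positivity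
    _ ≤ 4 * 4 ^ j * (1152 * (j + 5)) * (√2 ^ (5 * j))⁻¹ := by
        rw [← Finset.sum_mul]
        gcongr
    _ = _ := by
        rw [← h4, ← pow_mul, show 5 * j = 4 * j + j by ring, pow_add, inv_pow, h4]
        field_simp
        ring

lemma summable_rTwoSquares_sq_mul_rpow_five_quarter :
    Summable fun n : ℕ => (rTwoSquares n : ℝ) ^ 2 * (n : ℝ) ^ (-(5 / 4) : ℝ) := by
  set f : ℕ → ℝ := fun n => (rTwoSquares n : ℝ) ^ 2 * (n : ℝ) ^ (-(5 / 4) : ℝ) with hf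
  have hf0 : ∀ n, 0 ≤ f n := fun n => by positivity
  have hq : ‖(√(2 : ℝ))⁻¹‖ < 1 := by
    rw [Real.norm_of_nonneg (by positivity)]
    exact inv_lt_one_of_one_lt₀ (Real.lt_sqrt_of_sq_lt (by norm_num))
  have hs : Summable fun j : ℕ => 4608 * (((j : ℝ) + 5) * (√2)⁻¹ ^ j) := by
    refine Summable.mul_left _ ?_
    simp only [add_mul]
    refine Summable.add ?_ ((summable_geometric_of_norm_lt_one hq).mul_left 5)
    simpa using summable_pow_mul_geometric_of_norm_lt_one 1 hq
  have hI : ∀ J : ℕ, ∑ n ∈ Finset.Ico 1 (4 ^ J), f n =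
      ∑ j ∈ Finset.range J, ∑ n ∈ Finset.Ico (4 ^ j) (4 ^ (j + 1)), f n := fun J => by
    induction J with
    | zero => simp
    | succ J ih =>
      rw [Finset.sum_range_succ, ← ih, Finset.sum_Ico_consecutive _
        (Nat.one_le_pow J 4 (by norm_num)) (Nat.pow_le_pow_right (by norm_num) J.le_succ)]
  refine summable_of_sum_range_le hf0 (c := ∑' j : ℕ, 4608 * (((j : ℝ) + 5) * (√2)⁻¹ ^ j))
    fun N => ?_
  calc ∑ n ∈ Finset.range N, f n ≤ ∑ n ∈ Finset.range (4 ^ N), f n :=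
        Finset.sum_le_sum_of_subset_of_nonneg (Finset.range_mono
          (Nat.lt_pow_self (by norm_num)).le) fun n _ _ => hf0 n
    _ = ∑ n ∈ Finset.Ico 1 (4 ^ N), f n := by
        rw [Finset.range_eq_Ico, Finset.sum_eq_sum_Ico_succ_bot (by positivity)]
        simp [hf, Real.zero_rpow]
    _ ≤ ∑ j ∈ Finset.range N, 4608 * (((j : ℝ) + 5) * (√2)⁻¹ ^ j) := by
        rw [hI]
        exact Finset.sum_le_sum fun j _ => sum_rTwoSquares_sq_rpow_block_le j
    _ ≤ _ := hs.sum_le_tsum _ fun j _ => by positivity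

/-- The Dirichlet series `∑ r(n)² n ^ (-s)`. -/
noncomputable def sqSeries (s : ℝ) : ℝ := ∑' n : ℕ, (rTwoSquares n : ℝ) ^ 2 * (n : ℝ) ^ (-s)

lemma sqSeries_nonneg (s : ℝ) : 0 ≤ sqSeries s := tsum_nonneg fun n => by positivity

lemma summable_rTwoSquares_sq_mul_rpow_three_half :
    Summable fun n : ℕ => (rTwoSquares n : ℝ) ^ 2 * (n : ℝ) ^ (-(3 / 2) : ℝ) := by
  refine summable_rTwoSquares_sq_mul_rpow_five_quarter.of_nonneg_of_le (fun n => by positivity)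
    fun n => ?_
  rcases Nat.eq_zero_or_pos n with rfl | hn
  · simp [Real.zero_rpow]
  · gcongr ?_ * ?_
    exact Real.rpow_le_rpow_of_exponent_le (by exact_mod_cast hn) (by norm_num)

lemma tsum_succ_eq_sqSeries :
    ∑' n : ℕ, (rTwoSquares (n + 1) : ℝ) ^ 2 / ((n + 1 : ℝ) ^ ((3 : ℝ) / 2)) = sqSeries (3 / 2) := by
  rw [sqSeries, summable_rTwoSquares_sq_mul_rpow_three_half.tsum_eq_zero_add]
  simp only [Nat.cast_zero, Real.zero_rpow (by norm_num : (-(3 / 2) : ℝ) ≠ 0), mul_zero, zero_add]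
  refine tsum_congr fun n => ?_
  rw [Real.rpow_neg (by positivity), ← div_eq_mul_inv]
  push_cast
  rfl

lemma one_sub_sinc_sq_le {x : ℝ} (hx : 0 ≤ x) : 1 - Real.sinc x ^ 2 ≤ √x := by
  rcases hx.eq_or_lt with rfl | hx0
  · simp
  rcases le_or_gt x 1 with h1 | h1
  · have h2 := Real.sin_gt_sub_cube hx0
    have h3 : 1 - x ^ 2 / 4 ≤ Real.sinc x := by
      rw [Real.sinc_of_ne_zero hx0.ne', le_div_iff₀ hx0]
      nlinarith [pow_pos hx0 3]
    have h4 : x ≤ √x := Real.le_sqrt_of_sq_le (by nlinarith)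
    have h5 : (1 - x ^ 2 / 4) ^ 2 ≤ Real.sinc x ^ 2 := by
      have : 0 ≤ 1 - x ^ 2 / 4 := by nlinarith
      gcongr
    nlinarith [sq_nonneg (x ^ 2)]
  · have : 1 ≤ √x := Real.one_le_sqrt.2 h1.le
    nlinarith [sq_nonneg (Real.sinc x)]

lemma sinc_sq_le_one (x : ℝ) : Real.sinc x ^ 2 ≤ 1 := by
  rw [sq_le_one_iff_abs_le_one]
  exact Real.abs_sinc_le_one x

lemma waveCoeff_sq (δ : ℝ) (n : ℕ) : waveCoeff δ n ^ 2 =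
    1 / π ^ 2 * ((rTwoSquares n : ℝ) ^ 2 * (n : ℝ) ^ (-(3 / 2) : ℝ)) *
      Real.sinc (π * √n * δ) ^ 2 := by
  have : ((n : ℝ) ^ (-(3 / 4) : ℝ)) ^ 2 = (n : ℝ) ^ (-(3 / 2) : ℝ) := by
    rw [← Real.rpow_natCast, ← Real.rpow_mul (Nat.cast_nonneg n)]
    norm_num
  rw [waveCoeff, mul_pow, mul_pow, mul_pow, this]
  ring

lemma abs_waveCoeff_le (δ : ℝ) (n : ℕ) :
    |waveCoeff δ n| ≤ rTwoSquares n * (n : ℝ) ^ (-(3 / 4) : ℝ) := by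
  have h1 := Real.abs_sinc_le_one (π * √n * δ)
  have h2 : 1 / π ≤ 1 := by
    rw [div_le_one Real.pi_pos]
    linarith [Real.pi_gt_three]
  rw [waveCoeff, abs_mul, mul_assoc (1 / π), abs_of_nonneg (by positivity)]
  calc _ ≤ 1 * ((rTwoSquares n : ℝ) * (n : ℝ) ^ (-(3 / 4) : ℝ)) * 1 := by gcongr
    _ = _ := by ring

lemma abs_sum_waveCoeff_sq_sub_le {δ : ℝ} (hδ : 0 < δ) {M : ℕ} (hM : 1 ≤ M) :
    |∑ n ∈ Finset.Ico 1 M, waveCoeff δ n ^ 2 - 1 / π ^ 2 * sqSeries (3 / 2)| ≤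
      (2 * √δ + (M : ℝ) ^ (-(1 / 4) : ℝ)) * sqSeries (5 / 4) := by
  have hpi := Real.pi_gt_three
  have h1 : HasSum (fun n : ℕ => if n ∈ Finset.Ico 1 M then waveCoeff δ n ^ 2 else 0)
      (∑ n ∈ Finset.Ico 1 M, waveCoeff δ n ^ 2) := by
    have := hasSum_sum_of_ne_finset_zero (L := SummationFilter.unconditional ℕ)
      (s := Finset.Ico 1 M) (f := fun n : ℕ =>
      if n ∈ Finset.Ico 1 M then waveCoeff δ n ^ 2 else 0) fun n hn => if_neg hn
    rwa [Finset.sum_congr rfl fun n hn => if_pos hn] at this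
  have h2 := summable_rTwoSquares_sq_mul_rpow_three_half.hasSum.mul_left (1 / π ^ 2)
  have h3 := summable_rTwoSquares_sq_mul_rpow_five_quarter.hasSum.mul_left
    (2 * √δ + (M : ℝ) ^ (-(1 / 4) : ℝ))
  rw [← Real.norm_eq_abs]
  refine (h1.sub h2).norm_le_of_bounded h3 fun n => ?_
  rcases Nat.eq_zero_or_pos n with rfl | hn
  · simp [Real.zero_rpow]
  have hn' : (0 : ℝ) < n := by exact_mod_cast hn
  have hp : 1 / π ^ 2 ≤ 1 := by
    rw [div_le_one (by positivity)]
    nlinarith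
  have e1 : (n : ℝ) ^ (-(3 / 2) : ℝ) * (n : ℝ) ^ (1 / 4 : ℝ) = (n : ℝ) ^ (-(5 / 4) : ℝ) := by
    rw [← Real.rpow_add hn']
    norm_num
  suffices h : ∃ y : ℝ, (if n ∈ Finset.Ico 1 M then waveCoeff δ n ^ 2 else 0) -
      1 / π ^ 2 * ((rTwoSquares n : ℝ) ^ 2 * (n : ℝ) ^ (-(3 / 2) : ℝ)) =
      -(1 / π ^ 2 * ((rTwoSquares n : ℝ) ^ 2 * (n : ℝ) ^ (-(3 / 2) : ℝ)) * y) ∧ 0 ≤ y ∧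
      y ≤ (2 * √δ + (M : ℝ) ^ (-(1 / 4) : ℝ)) * (n : ℝ) ^ (1 / 4 : ℝ) by
    obtain ⟨y, hy, hy0, hy1⟩ := h
    rw [hy, norm_neg, Real.norm_of_nonneg (by positivity)]
    calc _ ≤ 1 * ((rTwoSquares n : ℝ) ^ 2 * (n : ℝ) ^ (-(3 / 2) : ℝ)) *
          ((2 * √δ + (M : ℝ) ^ (-(1 / 4) : ℝ)) * (n : ℝ) ^ (1 / 4 : ℝ)) := by gcongr
      _ = (2 * √δ + (M : ℝ) ^ (-(1 / 4) : ℝ)) * ((rTwoSquares n : ℝ) ^ 2 *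
          ((n : ℝ) ^ (-(3 / 2) : ℝ) * (n : ℝ) ^ (1 / 4 : ℝ))) := by ring
      _ = _ := by rw [e1]
  split_ifs with h
  · refine ⟨1 - Real.sinc (π * √n * δ) ^ 2, ?_, ?_, ?_⟩
    · rw [waveCoeff_sq]; ring
    · linarith [sinc_sq_le_one (π * √n * δ)]
    · have h5 : √(√(n : ℝ)) = (n : ℝ) ^ (1 / 4 : ℝ) := by
        rw [Real.sqrt_eq_rpow, Real.sqrt_eq_rpow, ← Real.rpow_mul hn'.le]
        norm_num
      have h6 : √π ≤ 2 := by
        rw [Real.sqrt_le_left (by norm_num)]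
        linarith [Real.pi_le_four]
      calc _ ≤ √(π * √n * δ) := one_sub_sinc_sq_le (by positivity)
        _ = √π * √δ * (n : ℝ) ^ (1 / 4 : ℝ) := by
          rw [Real.sqrt_mul (by positivity), Real.sqrt_mul (by positivity), h5]
          ring
        _ ≤ (2 * √δ + (M : ℝ) ^ (-(1 / 4) : ℝ)) * (n : ℝ) ^ (1 / 4 : ℝ) := by
          gcongr
          calc √π * √δ ≤ 2 * √δ := by gcongr
            _ ≤ _ := le_add_of_nonneg_right (by positivity)
  · refine ⟨1, by ring, zero_le_one, ?_⟩
    rw [Finset.mem_Ico, not_and, not_lt] at h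
    have hM0 : (0 : ℝ) < M := by exact_mod_cast hM
    have h7 : (M : ℝ) ^ (1 / 4 : ℝ) ≤ (n : ℝ) ^ (1 / 4 : ℝ) := by
      gcongr
      exact_mod_cast h hn
    calc (1 : ℝ) = (M : ℝ) ^ (-(1 / 4) : ℝ) * (M : ℝ) ^ (1 / 4 : ℝ) := by
          rw [← Real.rpow_add hM0]; norm_num
      _ ≤ _ := by
          gcongr
          exact le_add_of_nonneg_left (by positivity)

lemma abs_integral_mul_sq_sub_le {g : ℝ → ℝ} (hg : Continuous g) {B K : ℝ}
    (h : ∀ τ, |(∫ t in (0 : ℝ)..τ, g t) - B * τ| ≤ K) {T : ℝ} (hT : 1 ≤ T) :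
    |(∫ t in (1 : ℝ)..T, 2 * t ^ 2 * g t) - 2 / 3 * B * (T ^ 3 - 1)| ≤ 4 * T ^ 2 * K := by
  set F : ℝ → ℝ := fun τ => (∫ t in (0 : ℝ)..τ, g t) - B * τ with hF
  have hK : 0 ≤ K := (abs_nonneg _).trans (h 0)
  have hFd : ∀ x, HasDerivAt F (g x - B) x := fun x => by
    refine HasDerivAt.sub (hg.integral_hasStrictDerivAt 0 x).hasDerivAt ?_
    simpa using (hasDerivAt_id x).const_mul B
  have hu : ∀ x : ℝ, HasDerivAt (fun t : ℝ => 2 * t ^ 2) (4 * x) x := fun x => by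
    refine ((hasDerivAt_pow 2 x).const_mul 2).congr_deriv ?_
    norm_num
    ring
  have hFc : Continuous F := continuous_iff_continuousAt.2 fun x => (hFd x).continuousAt
  have hparts := intervalIntegral.integral_mul_deriv_eq_deriv_mul (a := 1) (b := T)
    (fun x _ => hu x) (fun x _ => hFd x)
    ((continuous_const_mul (4 : ℝ)).intervalIntegrable 1 T)
    ((hg.sub continuous_const).intervalIntegrable 1 T)
  have hsplit : ∫ t in (1 : ℝ)..T, 2 * t ^ 2 * g t =
      (∫ t in (1 : ℝ)..T, 2 * t ^ 2 * (g t - B)) + 2 / 3 * B * (T ^ 3 - 1) := by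
    have e : ∫ t in (1 : ℝ)..T, 2 * B * t ^ 2 = 2 / 3 * B * (T ^ 3 - 1) := by
      rw [intervalIntegral.integral_const_mul, integral_pow]
      norm_num
      ring
    rw [← e, ← intervalIntegral.integral_add
      (Continuous.intervalIntegrable (by fun_prop) _ _)
      (Continuous.intervalIntegrable (by fun_prop) _ _)]
    exact intervalIntegral.integral_congr fun t _ => by ring
  have hrest : |∫ x in (1 : ℝ)..T, 4 * x * F x| ≤ 2 * (T ^ 2 - 1) * K := by
    have e : ∫ x in (1 : ℝ)..T, 4 * K * x = 2 * (T ^ 2 - 1) * K := by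
      rw [intervalIntegral.integral_const_mul, integral_id]
      ring
    rw [← e, ← Real.norm_eq_abs]
    refine intervalIntegral.norm_integral_le_of_norm_le hT
      (Filter.Eventually.of_forall fun x hx => ?_)
      (Continuous.intervalIntegrable (by fun_prop) _ _)
    have hx0 : 0 < x := one_pos.trans hx.1
    rw [Real.norm_eq_abs, abs_mul, abs_of_pos (by positivity)]
    have := h x
    nlinarith [mul_le_mul_of_nonneg_left this hx0.le]
  rw [hsplit, add_sub_cancel_right, hparts]
  have h1 := abs_le.1 (h 1)
  have h2 := abs_le.1 (h T)
  have h3 := abs_le.1 hrest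
  change |2 * T ^ 2 * F T - 2 * 1 ^ 2 * F 1 - ∫ x in (1 : ℝ)..T, 4 * x * F x| ≤ _
  have hT2 : (0 : ℝ) ≤ T ^ 2 := by positivity
  have e1 : -K ≤ F 1 ∧ F 1 ≤ K := h1
  have e2 : -K ≤ F T ∧ F T ≤ K := h2
  rw [abs_le]
  constructor
  · nlinarith [mul_le_mul_of_nonneg_left e2.1 hT2]
  · nlinarith [mul_le_mul_of_nonneg_left e2.2 hT2]

lemma abs_integral_waveSum_sq_sub_le (δ : ℝ) (J : ℕ) (τ : ℝ) :
    |(∫ t in (0 : ℝ)..τ, waveSum δ (4 ^ J) (t + δ / 2) ^ 2) -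
      (∑ n ∈ Finset.Ico 1 (4 ^ J), waveCoeff δ n ^ 2) / 2 * τ| ≤
      2 * (J * (210000 * (2 + Real.log ((J + 5 : ℕ) : ℝ)))) := by
  have key := fun s => abs_integral_sq_sum_cos_sub_le (b := waveCoeff δ) (abs_waveCoeff_le δ)
    (le_refl (J + 5)) s (-(3 * π / 4))
  have hc : Continuous fun t => waveSum δ (4 ^ J) t ^ 2 := (continuous_waveSum δ (4 ^ J)).pow 2
  have e : ∫ t in (0 : ℝ)..τ, waveSum δ (4 ^ J) (t + δ / 2) ^ 2 =
      (∫ t in (0 : ℝ)..(τ + δ / 2), waveSum δ (4 ^ J) t ^ 2) -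
        ∫ t in (0 : ℝ)..(δ / 2), waveSum δ (4 ^ J) t ^ 2 := by
    rw [intervalIntegral.integral_comp_add_right (fun t => waveSum δ (4 ^ J) t ^ 2), zero_add,
      intervalIntegral.integral_interval_sub_left (hc.intervalIntegrable _ _)
        (hc.intervalIntegrable _ _)]
  have k1 := abs_le.1 (key (τ + δ / 2))
  have k2 := abs_le.1 (key (δ / 2))
  rw [e, abs_le]
  change _ ≤ (∫ t in (0 : ℝ)..(τ + δ / 2), waveSum δ (4 ^ J) t ^ 2) - _ ∧
    (∫ t in (0 : ℝ)..(τ + δ / 2), waveSum δ (4 ^ J) t ^ 2) - _ ≤ _ at k1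
  change _ ≤ (∫ t in (0 : ℝ)..(δ / 2), waveSum δ (4 ^ J) t ^ 2) - _ ∧
    (∫ t in (0 : ℝ)..(δ / 2), waveSum δ (4 ^ J) t ^ 2) - _ ≤ _ at k2
  constructor <;> linarith [k1.1, k1.2, k2.1, k2.2]

lemma abs_integral_mul_waveSum_sq_sub_le (δ : ℝ) (J : ℕ) {T : ℝ} (hT : 1 ≤ T) :
    |(∫ t in (1 : ℝ)..T, 2 * t ^ 2 * waveSum δ (4 ^ J) (t + δ / 2) ^ 2) -
      1 / 3 * (∑ n ∈ Finset.Ico 1 (4 ^ J), waveCoeff δ n ^ 2) * (T ^ 3 - 1)| ≤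
      8 * T ^ 2 * (J * (210000 * (2 + Real.log ((J + 5 : ℕ) : ℝ)))) := by
  have hc := continuous_waveSum δ (4 ^ J)
  have h := abs_integral_mul_sq_sub_le (g := fun t => waveSum δ (4 ^ J) (t + δ / 2) ^ 2)
    (by fun_prop) (abs_integral_waveSum_sq_sub_le δ J) hT
  rw [show 1 / 3 * (∑ n ∈ Finset.Ico 1 (4 ^ J), waveCoeff δ n ^ 2) =
    2 / 3 * ((∑ n ∈ Finset.Ico 1 (4 ^ J), waveCoeff δ n ^ 2) / 2) by ring]
  linarith

lemma integral_latticeP_sq_eq {T : ℝ} (hT : 1 ≤ T) :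
    ∫ x in (0 : ℝ)..T ^ 2, latticeP x ^ 2 =
      (∫ x in (0 : ℝ)..1, latticeP x ^ 2) + ∫ t in (1 : ℝ)..T, 2 * t * latticeP (t ^ 2) ^ 2 := by
  have hm : Measurable fun x => latticeP x ^ 2 := measurable_latticeP.pow_const 2
  have hb : ∀ x ∈ Set.Icc 0 (T ^ 2), |latticeP x ^ 2| ≤ (49 * T ^ 2) ^ 2 := fun x hx => by
    rw [abs_pow]
    gcongr
    exact abs_latticeP_le hT hx.1 (hx.2.trans (by nlinarith))
  have hT2 : 1 ≤ T ^ 2 := one_le_pow₀ hT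
  have i1 : IntervalIntegrable (fun x => latticeP x ^ 2) MeasureTheory.volume 0 1 :=
    intervalIntegrable_of_abs_le zero_le_one hm fun x hx => hb x ⟨hx.1, hx.2.trans hT2⟩
  have i2 : IntervalIntegrable (fun x => latticeP x ^ 2) MeasureTheory.volume 1 (T ^ 2) :=
    intervalIntegrable_of_abs_le hT2 hm fun x hx => hb x ⟨zero_le_one.trans hx.1, hx.2⟩
  rw [← intervalIntegral.integral_add_adjacent_intervals i1 i2]
  congr 1
  have himg : (fun t : ℝ => t ^ 2) '' Set.Ioc 1 T = Set.Ioc 1 (T ^ 2) := by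
    ext y
    constructor
    · rintro ⟨t, ht, rfl⟩
      exact ⟨by nlinarith [ht.1], by nlinarith [ht.1, ht.2]⟩
    · intro hy
      have hy0 : 0 ≤ y := by linarith [hy.1]
      refine ⟨√y, ⟨?_, ?_⟩, Real.sq_sqrt hy0⟩
      · rw [Real.lt_sqrt (by norm_num)]; simpa using hy.1
      · rw [Real.sqrt_le_left (by linarith)]; exact hy.2
  rw [intervalIntegral.integral_of_le hT2, intervalIntegral.integral_of_le hT, ← himg,
    MeasureTheory.integral_image_eq_integral_abs_deriv_smul (f' := fun t => 2 * t)
      measurableSet_Ioc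
      (fun x _ => ((hasDerivAt_pow 2 x).congr_deriv (by norm_num)).hasDerivWithinAt)]
  · refine MeasureTheory.setIntegral_congr_fun measurableSet_Ioc fun t ht => ?_
    have : 0 < t := one_pos.trans ht.1
    simp only [smul_eq_mul, abs_of_pos (by positivity : 0 < 2 * t)]
  · intro x hx y hy hxy
    exact (pow_left_inj₀ (by linarith [hx.1]) (by linarith [hy.1]) two_ne_zero).1 hxy

lemma abs_sq_sub_sq_le (p q : ℝ) {T : ℝ} (hT : 0 < T) :
    |p ^ 2 - q ^ 2| ≤ 1 / T * q ^ 2 + (1 + T) * (p - q) ^ 2 := by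
  obtain ⟨e, rfl⟩ : ∃ e, p = q + e := ⟨p - q, by ring⟩
  have hs : (1 / T * q ^ 2 + T * e ^ 2) - 2 * q * e = (q - T * e) ^ 2 / T := by field_simp; ring
  have hs' : (1 / T * q ^ 2 + T * e ^ 2) + 2 * q * e = (q + T * e) ^ 2 / T := by field_simp; ring
  have h1 : 0 ≤ (q - T * e) ^ 2 / T := by positivity
  have h2 : 0 ≤ (q + T * e) ^ 2 / T := by positivity
  rw [add_sub_cancel_left, abs_le]
  constructor <;> nlinarith [sq_nonneg e]

lemma abs_integral_latticeP_sq_sub_le {T δ C : ℝ} {M : ℕ} (hT : 1 ≤ T)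
    (h : ∫ t in (1 : ℝ)..T, t * (latticeP (t ^ 2) - √t * waveSum δ M (t + δ / 2)) ^ 2 ≤ C * T) :
    |(∫ t in (1 : ℝ)..T, 2 * t * latticeP (t ^ 2) ^ 2) -
      ∫ t in (1 : ℝ)..T, 2 * t ^ 2 * waveSum δ M (t + δ / 2) ^ 2| ≤
      1 / T * (∫ t in (1 : ℝ)..T, 2 * t ^ 2 * waveSum δ M (t + δ / 2) ^ 2) +
        2 * (1 + T) * (C * T) := by
  have hT0 : 0 < T := by linarith
  have hD := continuous_waveSum δ M
  have hm : Measurable fun t => latticeP (t ^ 2) :=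
    measurable_latticeP.comp (measurable_id.pow_const 2)
  obtain ⟨K, hK⟩ := isCompact_Icc.exists_bound_of_continuousOn
    (s := Set.Icc 1 T) (f := fun t => √t * waveSum δ M (t + δ / 2)) (by fun_prop)
  have hP : ∀ t ∈ Set.Icc 1 T, |latticeP (t ^ 2)| ≤ 49 * T ^ 2 := fun t ht =>
    abs_latticeP_le hT (by positivity) (by nlinarith [ht.1, ht.2])
  have i1 :
      IntervalIntegrable (fun t => 2 * t * latticeP (t ^ 2) ^ 2) MeasureTheory.volume 1 T := by
    refine intervalIntegrable_of_abs_le hT (C := 2 * T * (49 * T ^ 2) ^ 2) (by fun_prop)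
      fun t ht => ?_
    have ht0 : 0 < t := one_pos.trans_le ht.1
    rw [abs_mul, abs_of_pos (by positivity : 0 < 2 * t), abs_pow]
    have := hP t ht
    gcongr
    exact ht.2
  have i2 : IntervalIntegrable (fun t => 2 * t ^ 2 * waveSum δ M (t + δ / 2) ^ 2)
      MeasureTheory.volume 1 T := Continuous.intervalIntegrable (by fun_prop) _ _
  have i3 : IntervalIntegrable
      (fun t => t * (latticeP (t ^ 2) - √t * waveSum δ M (t + δ / 2)) ^ 2)
      MeasureTheory.volume 1 T := by
    refine intervalIntegrable_of_abs_le hT (C := T * (49 * T ^ 2 + K) ^ 2) ?_ fun t ht => ?_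
    · have := hD.measurable
      fun_prop
    have ht0 : 0 < t := one_pos.trans_le ht.1
    rw [abs_mul, abs_of_pos ht0, abs_pow]
    have := (abs_sub (latticeP (t ^ 2)) (√t * waveSum δ M (t + δ / 2))).trans
      (add_le_add (hP t ht) (hK t ht))
    gcongr
    exact ht.2
  rw [← intervalIntegral.integral_sub i1 i2, ← Real.norm_eq_abs]
  calc _ ≤ ∫ t in (1 : ℝ)..T, 1 / T * (2 * t ^ 2 * waveSum δ M (t + δ / 2) ^ 2) +
          2 * (1 + T) * (t * (latticeP (t ^ 2) - √t * waveSum δ M (t + δ / 2)) ^ 2) := by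
        refine intervalIntegral.norm_integral_le_of_norm_le hT
          (Filter.Eventually.of_forall fun t ht => ?_)
          ((i2.const_mul _).add (i3.const_mul _))
        have ht0 : 0 < t := one_pos.trans ht.1
        have := abs_sq_sub_sq_le (latticeP (t ^ 2)) (√t * waveSum δ M (t + δ / 2)) hT0
        have e : (√t * waveSum δ M (t + δ / 2)) ^ 2 = t * waveSum δ M (t + δ / 2) ^ 2 := by
          rw [mul_pow, Real.sq_sqrt ht0.le]
        rw [e] at this
        rw [Real.norm_eq_abs, show 2 * t * latticeP (t ^ 2) ^ 2 -
          2 * t ^ 2 * waveSum δ M (t + δ / 2) ^ 2 =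
          2 * t * (latticeP (t ^ 2) ^ 2 - t * waveSum δ M (t + δ / 2) ^ 2) by ring,
          abs_mul, abs_of_pos (by positivity : 0 < 2 * t)]
        refine (mul_le_mul_of_nonneg_left this (by positivity)).trans_eq ?_
        ring
    _ = 1 / T * (∫ t in (1 : ℝ)..T, 2 * t ^ 2 * waveSum δ M (t + δ / 2) ^ 2) +
          2 * (1 + T) *
            ∫ t in (1 : ℝ)..T, t * (latticeP (t ^ 2) - √t * waveSum δ M (t + δ / 2)) ^ 2 := by
        rw [intervalIntegral.integral_add (i2.const_mul _) (i3.const_mul _),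
          intervalIntegral.integral_const_mul, intervalIntegral.integral_const_mul]
    _ ≤ _ := by gcongr

lemma pow_le_four_pow {T : ℝ} (hT : 1 ≤ T) : T ^ 40 ≤ 4 ^ ⌈40 * Real.log T⌉₊ := by
  have hT0 : 0 < T := by linarith
  have h4 : (1 : ℝ) ≤ Real.log 4 := by
    rw [Real.le_log_iff_exp_le (by norm_num)]
    linarith [Real.exp_one_lt_d9]
  rw [← Real.log_le_log_iff (by positivity) (by positivity), Real.log_pow, Real.log_pow]
  have h1 := Nat.le_ceil (40 * Real.log T)
  have h2 : (0 : ℝ) ≤ ⌈40 * Real.log T⌉₊ := by positivity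
  push_cast
  nlinarith

lemma rpow_le_of_pow_mul_le {T M : ℝ} (hT : 1 ≤ T) {k m : ℕ} (hk : k ≠ 0) (h : T ^ (k * m) ≤ M) :
    M ^ (-(1 / k) : ℝ) ≤ 1 / T ^ m := by
  have hT0 : 0 < T := by linarith
  have hM : 0 < M := lt_of_lt_of_le (by positivity) h
  rw [Real.rpow_neg hM.le, ← one_div]
  refine one_div_le_one_div_of_le (by positivity) ?_
  calc T ^ m = (T ^ (k * m)) ^ ((1 : ℝ) / k) := by
        rw [mul_comm k, pow_mul, one_div, Real.pow_rpow_inv_natCast (by positivity) hk]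
    _ ≤ _ := by gcongr

/-- The bookkeeping that combines the approximation of the discrepancy by its wave sum, the
mean square of the wave sum, and the evaluation of the leading coefficient. -/
lemma abs_add_sub_le_of_approximations {T R c C S s I₀ I₁ I₂ B : ℝ} (hT : 1 ≤ T) (hR : 0 ≤ R)
    (hs : 0 ≤ s) (hS : 0 ≤ S) (hB : 0 ≤ B) (h₀ : |I₀| ≤ c)
    (h₁ : |I₁ - I₂| ≤ 1 / T * I₂ + 2 * (1 + T) * (C * T))
    (h₂ : |I₂ - 1 / 3 * B * (T ^ 3 - 1)| ≤ 8 * T ^ 2 * (210000 * R))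
    (h₃ : |B - S| ≤ 3 * s * (1 / T)) :
    |I₀ + I₁ - 1 / 3 * S * T ^ 3| ≤
      (c + 4 * |C| + 2 * S + 10 * s + 3360000) * (T ^ 2 * (1 + R)) := by
  have hT0 : 0 < T := by linarith
  have hc : 0 ≤ c := (abs_nonneg _).trans h₀
  have hT2 : 1 ≤ T ^ 2 := one_le_pow₀ hT
  have hu1 : 1 / T ≤ 1 := by rw [div_le_one hT0]; exact hT
  have hBle : B ≤ S + 3 * s := by
    have := (abs_le.1 h₃).2
    have : 3 * s * (1 / T) ≤ 3 * s * 1 := by gcongr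
    linarith
  have hI2 : 1 / T * I₂ ≤ B * T ^ 2 + 1680000 * (T ^ 2 * R) := by
    have h : I₂ ≤ T * (B * T ^ 2 + 1680000 * (T * R)) := by
      have h3 : 0 ≤ B * T ^ 3 := by positivity
      linarith [(abs_le.1 h₂).2]
    calc 1 / T * I₂ ≤ 1 / T * (T * (B * T ^ 2 + 1680000 * (T * R))) := by gcongr
      _ = B * T ^ 2 + 1680000 * (T * R) := by field_simp
      _ ≤ _ := by gcongr; nlinarith
  have hCT : 2 * (1 + T) * (C * T) ≤ 4 * |C| * T ^ 2 := by
    calc 2 * (1 + T) * (C * T) ≤ 2 * (1 + T) * (|C| * T) := by gcongr; exact le_abs_self C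
      _ ≤ 2 * (T + T) * (|C| * T) := by gcongr
      _ = _ := by ring
  have hBS : |(B - S) * T ^ 3| ≤ 3 * s * T ^ 2 := by
    rw [abs_mul, abs_of_pos (by positivity : 0 < T ^ 3)]
    calc _ ≤ 3 * s * (1 / T) * T ^ 3 := by gcongr
      _ = _ := by field_simp
  have hA : |I₀ + I₁ - 1 / 3 * S * T ^ 3| ≤
      c + (1 / T * I₂ + 2 * (1 + T) * (C * T)) + 8 * T ^ 2 * (210000 * R) + 1 / 3 * B +
        s * T ^ 2 := by
    have h₀ := abs_le.1 h₀
    have h₁ := abs_le.1 h₁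
    have h₂ := abs_le.1 h₂
    have hBS := abs_le.1 hBS
    rw [abs_le]
    constructor <;> linarith [h₁.1, h₁.2, h₂.1, h₂.2, hBS.1, hBS.2, h₀.1, h₀.2]
  refine hA.trans ?_
  have k1 : c ≤ c * T ^ 2 := le_mul_of_one_le_right hc hT2
  have k2 : B * T ^ 2 ≤ (S + 3 * s) * T ^ 2 := by gcongr
  have k3 : B ≤ B * T ^ 2 := le_mul_of_one_le_right hB hT2
  have k4 : 0 ≤ (c + 4 * |C| + 2 * S + 10 * s) * (T ^ 2 * R) := by positivity
  have k5 : 0 ≤ s * T ^ 2 := by positivity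
  have k6 : 0 ≤ S * T ^ 2 := by positivity
  have k7 : 0 ≤ B * T ^ 2 := by positivity
  linarith

theorem exists_abs_integral_latticeP_sq_sub_le : ∃ K : ℝ, ∀ T : ℝ, 1 ≤ T →
    |(∫ x in (0 : ℝ)..T ^ 2, latticeP x ^ 2) - 1 / (3 * π ^ 2) * sqSeries (3 / 2) * T ^ 3| ≤
      K * (T ^ 2 * (1 + (⌈40 * Real.log T⌉₊ : ℝ) *
        (2 + Real.log ((⌈40 * Real.log T⌉₊ + 5 : ℕ) : ℝ)))) := by
  obtain ⟨C, hC⟩ := exists_integral_mul_sq_error_le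
  set S := 1 / π ^ 2 * sqSeries (3 / 2) with hS
  set s := sqSeries (5 / 4) with hs
  have hs0 : 0 ≤ s := sqSeries_nonneg _
  have hS0 : 0 ≤ S := mul_nonneg (by positivity) (sqSeries_nonneg _)
  refine ⟨|∫ x in (0 : ℝ)..1, latticeP x ^ 2| + 4 * |C| + 2 * S + 10 * s + 3360000, fun T hT => ?_⟩
  have hT0 : 0 < T := by linarith
  set J := ⌈40 * Real.log T⌉₊ with hJ
  set R := (J : ℝ) * (2 + Real.log ((J + 5 : ℕ) : ℝ)) with hR
  have hR0 : 0 ≤ R := by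
    have := Real.log_natCast_nonneg (J + 5)
    positivity
  set δ := 1 / T ^ 4 with hδ
  have hδ0 : 0 < δ := by positivity
  have hM : T ^ 40 ≤ ((4 ^ J : ℕ) : ℝ) := by exact_mod_cast pow_le_four_pow hT
  have hM1 : 1 ≤ 4 ^ J := Nat.one_le_pow _ _ (by norm_num)
  have h1 := abs_integral_latticeP_sq_sub_le hT <| hC hT hδ0
    (by rw [hδ]; field_simp; rfl) hM1 (by
      have := rpow_le_of_pow_mul_le (k := 8) (m := 5) hT (by norm_num) hM
      rw [hδ, div_div, ← pow_succ]
      exact_mod_cast this)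
  have h2 := abs_integral_mul_waveSum_sq_sub_le δ J hT
  have h3 : |∑ n ∈ Finset.Ico 1 (4 ^ J), waveCoeff δ n ^ 2 - S| ≤ 3 * s * (1 / T) := by
    refine (abs_sum_waveCoeff_sq_sub_le hδ0 hM1).trans ?_
    have e1 : √δ ≤ 1 / T := by
      rw [hδ, Real.sqrt_le_left (by positivity), div_pow, one_pow]
      exact one_div_le_one_div_of_le (by positivity) (pow_le_pow_right₀ hT (by norm_num))
    have e2 : ((4 ^ J : ℕ) : ℝ) ^ (-(1 / 4) : ℝ) ≤ 1 / T := by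
      have := rpow_le_of_pow_mul_le (k := 4) (m := 1) hT (by norm_num)
        ((pow_le_pow_right₀ hT (by norm_num)).trans hM)
      rw [pow_one] at this
      exact_mod_cast this
    have : 2 * √δ + ((4 ^ J : ℕ) : ℝ) ^ (-(1 / 4) : ℝ) ≤ 3 * (1 / T) := by linarith
    calc _ ≤ 3 * (1 / T) * s := by gcongr
      _ = _ := by ring
  have hE : (J : ℝ) * (210000 * (2 + Real.log ((J + 5 : ℕ) : ℝ))) = 210000 * R := by rw [hR]; ring
  rw [hE] at h2
  have hmain : 1 / (3 * π ^ 2) * sqSeries (3 / 2) * T ^ 3 = 1 / 3 * S * T ^ 3 := by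
    rw [hS]; field_simp
  rw [integral_latticeP_sq_eq hT, hmain]
  exact abs_add_sub_le_of_approximations hT hR0 hs0 hS0
    (Finset.sum_nonneg fun _ _ => sq_nonneg _) le_rfl h1 h2 h3

lemma one_add_ceil_mul_log_le {L : ℝ} (hL : 6 ≤ L) :
    1 + (⌈20 * L⌉₊ : ℝ) * (2 + Real.log ((⌈20 * L⌉₊ + 5 : ℕ) : ℝ)) ≤
      200 * (L ^ ((3 : ℝ) / 2) * Real.log L) := by
  have hL0 : 0 < L := by linarith
  have h1 : (⌈20 * L⌉₊ : ℝ) ≤ 21 * L := by linarith [Nat.ceil_lt_add_one (by linarith : 0 ≤ 20 * L)]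
  have hl : 1 ≤ Real.log L := by
    rw [Real.le_log_iff_exp_le hL0]
    linarith [Real.exp_one_lt_d9]
  have h2 : Real.log ((⌈20 * L⌉₊ + 5 : ℕ) : ℝ) ≤ 4 + Real.log L := by
    have h3 : (((⌈20 * L⌉₊ + 5 : ℕ) : ℝ)) ≤ Real.exp 4 * L := by
      have h4 : (22 : ℝ) ≤ Real.exp 4 := by
        have : (2.7 : ℝ) ≤ Real.exp 1 := by linarith [Real.exp_one_gt_d9]
        calc (22 : ℝ) ≤ 2.7 ^ 4 := by norm_num
          _ ≤ Real.exp 1 ^ 4 := by gcongr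
          _ = _ := by rw [← Real.exp_nat_mul]; norm_num
      push_cast
      nlinarith
    refine (Real.log_le_log (by positivity) h3).trans_eq ?_
    rw [Real.log_mul (by positivity) hL0.ne', Real.log_exp]
  have h5 : L ≤ L ^ ((3 : ℝ) / 2) := Real.self_le_rpow_of_one_le (by linarith) (by norm_num)
  calc _ ≤ L * Real.log L + 21 * L * (7 * Real.log L) := by
        gcongr
        · nlinarith
        · linarith
    _ ≤ 200 * (L * Real.log L) := by
        have : 0 ≤ L * Real.log L := by positivity
        linarith
    _ ≤ _ := by gcongr

theorem nowak_mean_square_circle :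
    (fun X : ℝ => (∫ x in (0 : ℝ)..X, (latticeP x) ^ 2) -
        (1 / (3 * Real.pi ^ 2) *
          ∑' n : ℕ, (rTwoSquares (n + 1) : ℝ) ^ 2 / ((n + 1 : ℝ) ^ ((3 : ℝ) / 2))) *
          X ^ ((3 : ℝ) / 2)) =O[atTop]
      (fun X : ℝ => X * Real.log X ^ ((3 : ℝ) / 2) * Real.log (Real.log X)) := by
  obtain ⟨K, hK⟩ := exists_abs_integral_latticeP_sq_sub_le
  refine IsBigO.of_bound (200 * |K|) ?_
  filter_upwards [eventually_ge_atTop (Real.exp 6)] with X hX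
  have hX1 : 1 ≤ X := (Real.one_le_exp (by norm_num)).trans hX
  have hX0 : 0 < X := by linarith
  have hL : 6 ≤ Real.log X := (Real.le_log_iff_exp_le hX0).2 hX
  have h := hK (√X) (Real.one_le_sqrt.2 hX1)
  have hlog : 40 * Real.log √X = 20 * Real.log X := by rw [Real.log_sqrt hX0.le]; ring
  have hcube : √X ^ 3 = X ^ ((3 : ℝ) / 2) := by
    rw [Real.sqrt_eq_rpow, ← Real.rpow_natCast, ← Real.rpow_mul hX0.le]; norm_num
  rw [Real.sq_sqrt hX0.le, hlog, hcube] at h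
  have hll : 0 ≤ Real.log (Real.log X) := Real.log_nonneg (by linarith)
  have hb := one_add_ceil_mul_log_le hL
  have hn : 0 ≤ 1 + (⌈20 * Real.log X⌉₊ : ℝ) *
      (2 + Real.log ((⌈20 * Real.log X⌉₊ + 5 : ℕ) : ℝ)) := by
    have := Real.log_natCast_nonneg (⌈20 * Real.log X⌉₊ + 5)
    positivity
  rw [tsum_succ_eq_sqSeries, Real.norm_eq_abs, Real.norm_of_nonneg (by positivity)]
  refine h.trans ?_
  calc _ ≤ |K| * (X * (200 * (Real.log X ^ ((3 : ℝ) / 2) * Real.log (Real.log X)))) := by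
        gcongr
        exact le_abs_self K
    _ = _ := by ring
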